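/- Fix integers r, g, 𝔙 ≥ 1 and reals 0 < ε, δ, λ < 1. There exist constants K, c₀, c₁, c₂ > 0 depending only on r, g, 𝔙, ε, δ, λ such that the following holds. Let Q₁, …, Q_r ∈ ℤ[X] be irreducible polynomials, pairwise coprime, such that Q := ∏_{j=1}^r Q_j has degree g, leading coefficient β, and no fixed prime divisor; let D be a nonzero integer divisible by every prime p modulo which Q has a repeated root or modulo which two of the Q_j share a common root (e.g. the discriminant of Q). Suppose M = Σ_{j=1}^r M_j and M' = Σ_{j=1}^r M_j' where, for each j, M_j, M_j' ≥ 1 are reals satisfying |Σ_{p ≤ t} ρ_j(p)/p − log log t| ≤ M_j for all t ≥ 2, and |Σ_{p ≤ t} ρ_j(p) − Li(t)| ≤ M_j' + t·exp(−c₁√(log t)) for all t ≥ 2. Let x ≥ c₀·‖Q‖^δ, let x^ε < y ≤ x, set z := exp((log x)^{1−λ}), and let f₁, …, f_r be real-valued additive functions (extended to ℤ) such that for every 1 ≤ j ≤ r, every real t ≥ z and every real u ≥ 1, #{f_j(n) : n ≤ t^u, P⁻(n) > t} ≤ 𝔙^u. Then for all k₁, …, k_r ∈ ℝ, #{n ∈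 ℤ : x < n ≤ x + y and f_j(Q_j(n)) = k_j for all 1 ≤ j ≤ r} ≤ c₂ · (|βD|/φ₀(|βD|))^K · e^{3M + M'/z} · y / ∏_{j=1}^r √(E_{f_j}(x; ρ_j)). -/

import Mathlib

open scoped Classical

/-- The finset of primes `p ≤ x` for a real `x`. -/
noncomputable def primesBelow (x : ℝ) : Finset ℕ :=
  (Finset.range (⌊x⌋₊ + 1)).filter Nat.Prime

/-- `E_f(x; r) := 1 + ∑_{p ≤ x, f(p) ≠ 0} r(p)/p`. -/
noncomputable def Ef (f : ℕ → ℝ) (x : ℝ) (r : ℕ → ℝ) : ℝ :=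
  1 + ∑ p ∈ (primesBelow x).filter (fun p => f p ≠ 0), r p / p

/-- `Li(t) := ∫₂ᵗ du / log u`. -/
noncomputable def Li (t : ℝ) : ℝ := ∫ u in (2:ℝ)..t, 1 / Real.log u

/-- `ρ_Q(m) := #{0 ≤ n < m : m ∣ Q(n)}`. -/
noncomputable def rho (Q : Polynomial ℤ) (m : ℕ) : ℕ :=
  ((Finset.range m).filter fun n => (m : ℤ) ∣ Q.eval (n : ℤ)).card

/-- `‖Q‖` is the maximum of the absolute values of the coefficients of `Q`. -/
noncomputable def polyNorm (Q : Polynomial ℤ) : ℝ :=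
  ((Q.support.sup fun i => (Q.coeff i).natAbs : ℕ) : ℝ)

/-- `φ_ρ(n) := n · ∏_{p ∣ n} (1 − ρ(p)/p)`. -/
noncomputable def phiRho (ρ : ℕ → ℝ) (n : ℕ) : ℝ :=
  n * ∏ p ∈ n.primeFactors, (1 - ρ p / p)

/-- Extension of `f : ℕ → ℝ` to `ℤ` by `f(−n) := f(n)` and `f(0) := 0`. -/
noncomputable def extZ (f : ℕ → ℝ) (n : ℤ) : ℝ := if n = 0 then 0 else f n.natAbs

lemma mem_primesBelow {x : ℝ} {p : ℕ} : p ∈ primesBelow x ↔ p.Prime ∧ (p : ℝ) ≤ x := by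
  unfold primesBelow
  rw [Finset.mem_filter, Finset.mem_range, Nat.lt_succ_iff]
  constructor
  · rintro ⟨h1, h2⟩
    exact ⟨h2, (Nat.le_floor_iff' h2.ne_zero).1 h1⟩
  · rintro ⟨h1, h2⟩
    exact ⟨(Nat.le_floor_iff' h1.ne_zero).2 h2, h1⟩

lemma pow_div_dvd_factorial {p : ℕ} (hp : p.Prime) (n : ℕ) : p ^ (n / p) ∣ n.factorial := by
  rw [hp.pow_dvd_factorial_iff (b := Nat.log p n + 2) (by omega)]
  have : n / p = n / p ^ 1 := by simp
  rw [this]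
  exact Finset.single_le_sum (f := fun i => n / p ^ i) (fun _ _ => Nat.zero_le _) (by simp)

/-- Mertens' first estimate (upper bound). -/
lemma mert (x : ℝ) (hx : 1 ≤ x) :
    ∑ p ∈ primesBelow x, Real.log p / p ≤ Real.log x + 2 := by
  set n := ⌊x⌋₊ with hn
  have hn1 : 1 ≤ n := by rw [hn]; exact Nat.le_floor (by simpa using hx)
  have hnx : (n : ℝ) ≤ x := Nat.floor_le (by linarith)
  have hn0 : (0 : ℝ) < n := by exact_mod_cast hn1
  have hmem : ∀ p ∈ primesBelow x, p.Prime := fun p hp => (mem_primesBelow.1 hp).1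
  have h1 : ∏ p ∈ primesBelow x, p ^ (n / p) ∣ n.factorial := by
    apply Finset.prod_dvd_of_isRelPrime
    · intro p hp q hq hpq
      exact Nat.coprime_iff_isRelPrime.1 (Nat.Coprime.pow _ _
        ((Nat.coprime_primes (hmem p hp) (hmem q hq)).2 hpq))
    · intro p hp
      exact pow_div_dvd_factorial (hmem p hp) n
  have h2 : (∏ p ∈ primesBelow x, (p : ℝ) ^ (n / p)) ≤ (n : ℝ) ^ n := by
    have := (Nat.le_of_dvd (Nat.factorial_pos n) h1).trans (Nat.factorial_le_pow n)
    exact_mod_cast this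
  have h3 : ∑ p ∈ primesBelow x, ((n / p : ℕ) : ℝ) * Real.log p ≤ n * Real.log n := by
    have h4 := Real.log_le_log (Finset.prod_pos fun p hp => by
      have := (hmem p hp).pos
      positivity) h2
    rw [Real.log_prod (fun p hp => by have := (hmem p hp).pos; positivity), Real.log_pow] at h4
    simpa [Real.log_pow] using h4
  have h5 : ∑ p ∈ primesBelow x, Real.log p ≤ Real.log 4 * n := by
    have := Chebyshev.theta_le_log4_mul_x (x := (n : ℝ)) (by positivity)
    rw [Chebyshev.theta_eq_sum_Icc] at this
    refine le_trans (le_of_eq ?_) this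
    apply Finset.sum_congr _ (fun _ _ => rfl)
    ext p
    simp only [mem_primesBelow, Finset.mem_filter, Finset.mem_Icc, Nat.floor_natCast]
    constructor
    · rintro ⟨a, b⟩
      exact ⟨⟨Nat.zero_le _, (Nat.le_floor_iff' a.ne_zero).2 b⟩, a⟩
    · rintro ⟨⟨_, b⟩, a⟩
      exact ⟨a, (Nat.le_floor_iff' a.ne_zero).1 b⟩
  have h6 : ∀ p ∈ primesBelow x, (n : ℝ) * (Real.log p / p) ≤
      ((n / p : ℕ) : ℝ) * Real.log p + Real.log p := by
    intro p hp
    have hp0 : (0 : ℝ) < p := by exact_mod_cast (hmem p hp).pos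
    have hl : 0 ≤ Real.log p := Real.log_natCast_nonneg p
    have : (n : ℝ) / p ≤ ((n / p : ℕ) : ℝ) + 1 := by
      have h := Nat.lt_floor_add_one ((n : ℝ) / p)
      rw [Nat.floor_div_natCast, Nat.floor_natCast] at h
      exact h.le
    calc (n : ℝ) * (Real.log p / p) = n / p * Real.log p := by ring
      _ ≤ (((n / p : ℕ) : ℝ) + 1) * Real.log p := by gcongr
      _ = _ := by ring
  have h7 : (n : ℝ) * ∑ p ∈ primesBelow x, Real.log p / p ≤ n * (Real.log n + Real.log 4) := by
    rw [Finset.mul_sum]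
    refine (Finset.sum_le_sum h6).trans ?_
    rw [Finset.sum_add_distrib]
    linarith
  have h8 := le_of_mul_le_mul_left h7 hn0
  have h9 : Real.log 4 ≤ 2 := by
    rw [show (4 : ℝ) = 2 ^ 2 by norm_num, Real.log_pow]
    have := Real.log_two_lt_d9
    push_cast; linarith
  have := Real.log_le_log hn0 hnx
  linarith

/-- Sum of reciprocals of primes between `T` and `x`. -/
lemma recip_gap (T x : ℝ) (hT : 2 ≤ T) (hTx : T ≤ x) :
    ∑ p ∈ (primesBelow x).filter (fun p : ℕ => T < (p : ℝ)), (1 : ℝ) / p ≤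
      (Real.log x + 2) / Real.log T := by
  have hlT : 0 < Real.log T := Real.log_pos (by linarith)
  rw [le_div_iff₀ hlT, Finset.sum_mul]
  refine le_trans ?_ (mert x (by linarith))
  calc ∑ p ∈ (primesBelow x).filter (fun p : ℕ => T < (p : ℝ)), 1 / (p:ℝ) * Real.log T
      ≤ ∑ p ∈ (primesBelow x).filter (fun p : ℕ => T < (p : ℝ)), Real.log p / p := by
        refine Finset.sum_le_sum fun p hp => ?_
        have h1 := (Finset.mem_filter.1 hp).2
        have h2 := Real.log_le_log (by linarith) h1.le
        rw [one_div, inv_mul_eq_div]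
        gcongr
    _ ≤ _ := by
        refine Finset.sum_le_sum_of_subset_of_nonneg (Finset.filter_subset _ _) fun p _ _ => ?_
        have := Real.log_natCast_nonneg p
        positivity

/-- Crude Mertens' second: `∑_{p ≤ T} 1/p ≤ 8 log log T + 16`. -/
lemma recip_sum_aux (k : ℕ) :
    ∑ p ∈ primesBelow ((2:ℝ) ^ (2 ^ k : ℕ)), (1 : ℝ) / p ≤ 8 * k + 1 := by
  induction k with
  | zero =>
    have : primesBelow ((2:ℝ) ^ (2 ^ 0 : ℕ)) ⊆ {2} := by
      intro p hp
      rw [mem_primesBelow] at hp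
      have h1 := hp.1.two_le
      have h2 : p ≤ 2 := by have := hp.2; norm_num at this; exact_mod_cast this
      simp; omega
    refine (Finset.sum_le_sum_of_subset_of_nonneg this (fun _ _ _ => by positivity)).trans ?_
    norm_num
  | succ k ih =>
    set T : ℝ := (2:ℝ) ^ (2 ^ k : ℕ) with hT
    have hT2 : (2:ℝ) ≤ T := by
      rw [hT]
      calc (2:ℝ) = 2 ^ 1 := by norm_num
        _ ≤ _ := pow_le_pow_right₀ (by norm_num) Nat.one_le_two_pow
    have hx : (2:ℝ) ^ (2 ^ (k+1) : ℕ) = T ^ 2 := by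
      rw [hT, ← pow_mul, pow_succ]
    rw [hx]
    have h0 := recip_gap T (T ^ 2) hT2 (by nlinarith)
    rw [← Finset.sum_filter_add_sum_filter_not _ (fun p : ℕ => T < (p : ℝ))]
    have h3 : ∑ p ∈ (primesBelow (T ^ 2)).filter (fun p : ℕ => ¬ T < (p : ℝ)), (1 : ℝ) / p ≤
        ∑ p ∈ primesBelow T, (1 : ℝ) / p := by
      apply Finset.sum_le_sum_of_subset_of_nonneg
      · intro p hp
        rw [Finset.mem_filter, mem_primesBelow] at hp
        rw [mem_primesBelow]
        exact ⟨hp.1.1, by linarith [not_lt.1 hp.2]⟩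
      · intros; positivity
    have h4 : (Real.log (T ^ 2) + 2) / Real.log T ≤ 8 := by
      have hl : Real.log 2 ≤ Real.log T := Real.log_le_log (by norm_num) hT2
      have := Real.log_two_gt_d9
      rw [Real.log_pow, div_le_iff₀ (by linarith)]
      push_cast; linarith
    push_cast
    linarith

lemma primesBelow_mono {a b : ℝ} (h : a ≤ b) : primesBelow a ⊆ primesBelow b := by
  intro p hp
  rw [mem_primesBelow] at *
  exact ⟨hp.1, hp.2.trans h⟩

lemma recip_sum (T : ℝ) (hT : 3 ≤ T) :
    ∑ p ∈ primesBelow T, (1 : ℝ) / p ≤ 16 * Real.log (Real.log T) + 16 := by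
  have hT1 : 1 ≤ Real.log T := by
    rw [Real.le_log_iff_exp_le (by linarith)]
    linarith [Real.exp_one_lt_d9]
  set k := ⌈Real.log (Real.log T / Real.log 2) / Real.log 2⌉₊ with hk
  have l2 := Real.log_two_gt_d9
  have l2' := Real.log_two_lt_d9
  have h1 : Real.log (Real.log T / Real.log 2) / Real.log 2 ≤ k := Nat.le_ceil _
  have hq : 1 ≤ Real.log T / Real.log 2 := by rw [le_div_iff₀ (by linarith)]; linarith
  have h2 : T ≤ (2:ℝ) ^ (2 ^ k : ℕ) := by
    rw [← Real.log_le_log_iff (by linarith) (by positivity), Real.log_pow,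
      ← div_le_iff₀ (by linarith)]
    push_cast
    rw [← Real.log_le_log_iff (by linarith) (by positivity), Real.log_pow,
      ← div_le_iff₀ (by linarith)]
    exact h1
  have h3 : (k : ℝ) ≤ Real.log (Real.log T / Real.log 2) / Real.log 2 + 1 :=
    (Nat.ceil_lt_add_one (div_nonneg (Real.log_nonneg hq) (by linarith))).le
  have h4 : Real.log (Real.log T / Real.log 2) / Real.log 2 ≤
      2 * Real.log (Real.log T) + 7/8 := by
    rw [Real.log_div (by linarith) (by linarith), div_le_iff₀ (by linarith)]
    have h5 : 0 ≤ Real.log (Real.log T) := Real.log_nonneg hT1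
    have h6 : -Real.log (Real.log 2) ≤ 0.45 := by
      rw [← Real.log_inv]
      have := Real.log_le_sub_one_of_pos (x := (Real.log 2)⁻¹) (by positivity)
      have h7 : (Real.log 2)⁻¹ ≤ 1.4428 := by
        rw [inv_le_comm₀ (by linarith) (by norm_num)]; norm_num; linarith
      linarith
    nlinarith
  have := recip_sum_aux k
  have h8 := Finset.sum_le_sum_of_subset_of_nonneg (f := fun p : ℕ => (1:ℝ) / p)
    (primesBelow_mono h2) (fun _ _ _ => by positivity)
  linarith

lemma centralBinom_sq_le (n : ℕ) : n.centralBinom ^ 2 * (2 * n + 1) ≤ 16 ^ n := by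
  induction n with
  | zero => simp
  | succ n ih =>
    have h := Nat.succ_mul_centralBinom_succ n
    have h1 : (n + 1) ^ 2 * ((n + 1).centralBinom ^ 2 * (2 * (n + 1) + 1)) ≤
        (n + 1) ^ 2 * 16 ^ (n + 1) := by
      calc (n + 1) ^ 2 * ((n + 1).centralBinom ^ 2 * (2 * (n + 1) + 1))
          = ((n + 1) * (n + 1).centralBinom) ^ 2 * (2 * n + 3) := by ring
        _ = (n.centralBinom ^ 2 * (2 * n + 1)) * (4 * ((2 * n + 1) * (2 * n + 3))) := by
            rw [h]; ring
        _ ≤ 16 ^ n * (4 * (4 * (n + 1) ^ 2)) := by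
            exact Nat.mul_le_mul ih (by nlinarith)
        _ = _ := by ring
    exact Nat.le_of_mul_le_mul_left h1 (by positivity)

lemma choose_half_sq_le (m : ℕ) : (m.choose (m / 2)) ^ 2 * (m + 1) ≤ 4 ^ m := by
  rcases Nat.even_or_odd' m with ⟨n, rfl | rfl⟩
  · have := centralBinom_sq_le n
    rw [Nat.centralBinom_eq_two_mul_choose] at this
    rw [Nat.mul_div_cancel_left _ (by norm_num), pow_mul]
    norm_num
    exact this
  · have h := centralBinom_sq_le (n + 1)
    have h2 : (2 * n + 1) / 2 = n := by omega
    rw [h2]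
    have h3 : (n + 1).centralBinom = 2 * (2 * n + 1).choose n := by
      rw [Nat.centralBinom_eq_two_mul_choose, show 2 * (n + 1) = (2 * n + 1) + 1 by ring,
        Nat.choose_succ_succ, ← Nat.choose_symm_half]
      ring
    rw [h3] at h
    have h4 : 4 * (((2 * n + 1).choose n) ^ 2 * (2 * n + 1 + 1)) ≤ 4 * 4 ^ (2 * n + 1) := by
      calc 4 * (((2 * n + 1).choose n) ^ 2 * (2 * n + 1 + 1)) ≤
          (2 * (2 * n + 1).choose n) ^ 2 * (2 * (n + 1) + 1) := by
            nlinarith [sq_nonneg ((2 * n + 1).choose n)]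
        _ ≤ 16 ^ (n + 1) := h
        _ = _ := by rw [show (16:ℕ) = 4 ^ 2 by norm_num, ← pow_mul]; ring
    omega

lemma sperner_count {ι : Type*} (Z : Finset ι) (φ : ι → ℝ) (hφ : ∀ i ∈ Z, 0 < φ i) (k : ℝ) :
    ((Z.powerset.filter (fun A => ∑ i ∈ A, φ i = k)).card : ℝ) ≤
      2 ^ Z.card / Real.sqrt (Z.card + 1) := by
  set 𝒜 : Finset (Finset Z) := (Finset.univ : Finset (Finset Z)).filter
    (fun A => ∑ i ∈ A, φ i = k) with h𝒜
  have hanti : IsAntichain (· ⊆ ·) (SetLike.coe 𝒜) := by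
    intro A hA B hB hAB hsub
    have hA' : ∑ i ∈ A, φ i = k := by simpa [h𝒜] using hA
    have hB' : ∑ i ∈ B, φ i = k := by simpa [h𝒜] using hB
    have hss : A ⊂ B := lt_of_le_of_ne hsub hAB
    obtain ⟨b, hb, hbA⟩ := Finset.exists_of_ssubset hss
    have : ∑ i ∈ A, φ i < ∑ i ∈ B, φ i :=
      Finset.sum_lt_sum_of_subset hsub hb hbA (hφ b b.2) (fun j _ _ => (hφ j j.2).le)
    linarith
  have hs := hanti.sperner
  have hcard : (Z.powerset.filter (fun A => ∑ i ∈ A, φ i = k)).card ≤ 𝒜.card := by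
    apply Finset.card_le_card_of_injOn (fun A => A.subtype (· ∈ Z))
    · intro A hA
      rw [Finset.mem_coe, Finset.mem_filter, Finset.mem_powerset] at hA
      simp only [h𝒜, Finset.coe_filter, Finset.mem_univ, true_and, Set.mem_ofPred_eq]
      rw [← hA.2]
      exact Finset.sum_subtype_of_mem (f := φ) (fun x hx => hA.1 hx)
    · intro A hA B hB h
      rw [Finset.mem_coe, Finset.mem_filter, Finset.mem_powerset] at hA hB
      ext x
      have := congrArg (fun S : Finset Z => S.map (Function.Embedding.subtype _)) h
      simp only [Finset.subtype_map_of_mem (fun x hx => hA.1 hx),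
        Finset.subtype_map_of_mem (fun x hx => hB.1 hx)] at this
      rw [this]
  rw [Fintype.card_coe] at hs
  have h2 := choose_half_sq_le Z.card
  rw [le_div_iff₀ (by positivity)]
  have h3 : ((Z.card.choose (Z.card / 2) : ℕ) : ℝ) * Real.sqrt (Z.card + 1) ≤ 2 ^ Z.card := by
    apply le_of_sq_le_sq _ (by positivity)
    rw [mul_pow, Real.sq_sqrt (by positivity), ← pow_mul, mul_comm Z.card 2, pow_mul]
    norm_num
    exact_mod_cast h2
  refine le_trans ?_ h3
  gcongr
  exact hcard.trans hs

lemma exp_integral_bound (W : ℝ) (hW : 0 < W) :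
    ∫ s in (0:ℝ)..1, Real.exp (W - 2 * W * (1 - s)) ≤ Real.exp W / (2 * W) := by
  have : ∀ s ∈ Set.uIcc (0:ℝ) 1, HasDerivAt (fun s => Real.exp (W - 2 * W * (1 - s)) / (2 * W))
      (Real.exp (W - 2 * W * (1 - s))) s := by
    intro s _
    have h1 : HasDerivAt (fun s : ℝ => W - 2 * W * (1 - s)) (2 * W) s := by
      have := ((hasDerivAt_id s).const_sub 1).const_mul (2 * W) |>.const_sub W
      simpa using this
    have := h1.exp.div_const (2 * W)
    rw [mul_div_cancel_right₀ _ (by positivity)] at this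
    exact this
  rw [intervalIntegral.integral_eq_sub_of_hasDerivAt this
    (Continuous.intervalIntegrable (by fun_prop) _ _)]
  have : 0 < Real.exp (W - 2 * W * (1 - 0)) / (2 * W) := by positivity
  simp only [sub_self, mul_zero, sub_zero]
  simp only [sub_zero] at this
  linarith

lemma weighted_recip {ι : Type*} (G : Finset ι) (w : ι → ℝ) (h0 : ∀ i ∈ G, 0 ≤ w i)
    (h1 : ∀ i ∈ G, w i ≤ 1) :
    ∑ Z ∈ G.powerset, (∏ i ∈ Z, 2 * w i) * (∏ i ∈ G \ Z, (1 - w i)) / (Z.card + 1) ≤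
      2 * Real.exp (∑ i ∈ G, w i) / (1 + ∑ i ∈ G, w i) := by
  set W := ∑ i ∈ G, w i with hW
  have hW0 : 0 ≤ W := Finset.sum_nonneg h0
  have hμ : ∀ Z ∈ G.powerset, 0 ≤ (∏ i ∈ Z, 2 * w i) * (∏ i ∈ G \ Z, (1 - w i)) := by
    intro Z hZ
    rw [Finset.mem_powerset] at hZ
    apply mul_nonneg
    · exact Finset.prod_nonneg fun i hi => by have := h0 i (hZ hi); positivity
    · exact Finset.prod_nonneg fun i hi => by
        have := h1 i (Finset.mem_sdiff.1 hi).1; linarith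
  have hIntg : ∀ s : ℝ, ∑ Z ∈ G.powerset, (∏ i ∈ Z, 2 * w i) * (∏ i ∈ G \ Z, (1 - w i)) * s ^ Z.card
      = ∏ i ∈ G, (2 * w i * s + (1 - w i)) := by
    intro s
    rw [Finset.prod_add]
    refine Finset.sum_congr rfl fun Z _ => ?_
    rw [Finset.prod_mul_distrib (g := fun _ => s), Finset.prod_const]
    ring
  have hprod : ∀ s ∈ Set.Icc (0:ℝ) 1, ∏ i ∈ G, (2 * w i * s + (1 - w i)) ≤
      Real.exp (W - 2 * W * (1 - s)) := by
    intro s hs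
    have : Real.exp (W - 2 * W * (1 - s)) = ∏ i ∈ G, Real.exp (w i - 2 * w i * (1 - s)) := by
      rw [← Real.exp_sum, Finset.sum_sub_distrib, ← Finset.sum_mul, ← Finset.mul_sum]
    rw [this]
    apply Finset.prod_le_prod
    · intro i hi
      have := h0 i hi
      have := h1 i hi
      have : 0 ≤ 2 * w i * s := by have := hs.1; positivity
      linarith
    · intro i hi
      have := Real.add_one_le_exp (w i - 2 * w i * (1 - s))
      linarith
  have key : ∑ Z ∈ G.powerset, (∏ i ∈ Z, 2 * w i) * (∏ i ∈ G \ Z, (1 - w i)) / (Z.card + 1) ≤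
      ∫ s in (0:ℝ)..1, Real.exp (W - 2 * W * (1 - s)) := by
    have e1 : ∑ Z ∈ G.powerset, (∏ i ∈ Z, 2 * w i) * (∏ i ∈ G \ Z, (1 - w i)) / (Z.card + 1)
        = ∫ s in (0:ℝ)..1, ∑ Z ∈ G.powerset,
          (∏ i ∈ Z, 2 * w i) * (∏ i ∈ G \ Z, (1 - w i)) * s ^ Z.card := by
      rw [intervalIntegral.integral_finsetSum
        (fun Z _ => Continuous.intervalIntegrable (by fun_prop) _ _)]
      refine Finset.sum_congr rfl fun Z _ => ?_
      rw [intervalIntegral.integral_const_mul, integral_pow]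
      simp [div_eq_mul_inv]
    rw [e1]
    apply intervalIntegral.integral_mono_on (by norm_num)
      (Continuous.intervalIntegrable (by fun_prop) _ _)
      (Continuous.intervalIntegrable (by fun_prop) _ _)
    intro s hs
    rw [hIntg s]
    exact hprod s hs
  rcases le_or_gt W 1 with h | h
  · have t1 : ∑ Z ∈ G.powerset, (∏ i ∈ Z, 2 * w i) * (∏ i ∈ G \ Z, (1 - w i)) / (Z.card + 1) ≤
        Real.exp W := by
      refine le_trans (Finset.sum_le_sum (g := fun Z => (∏ i ∈ Z, 2 * w i) *
        (∏ i ∈ G \ Z, (1 - w i)) * 1 ^ Z.card) fun Z hZ => ?_) ?_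
      · rw [one_pow, mul_one]
        apply div_le_self (hμ Z hZ)
        have : (0:ℝ) ≤ Z.card := by positivity
        linarith
      · rw [hIntg 1]
        have := hprod 1 (by simp)
        simpa using this
    refine t1.trans ?_
    rw [le_div_iff₀ (by linarith)]
    have := Real.exp_pos W
    nlinarith
  · refine key.trans ((exp_integral_bound W (by linarith)).trans ?_)
    have := Real.exp_pos W
    rw [div_le_div_iff₀ (by linarith) (by linarith)]
    nlinarith

lemma conc_pos {ι : Type*} (G : Finset ι) (w φ : ι → ℝ) (h0 : ∀ i ∈ G, 0 ≤ w i)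
    (h1 : ∀ i ∈ G, w i ≤ 1) (hφ : ∀ i ∈ G, 0 < φ i) (k : ℝ) :
    ∑ A ∈ G.powerset.filter (fun A => ∑ i ∈ A, φ i = k), ∏ i ∈ A, w i ≤
      2 * Real.exp (∑ i ∈ G, w i) / Real.sqrt (1 + ∑ i ∈ G, w i) := by
  set W := ∑ i ∈ G, w i with hW
  have hW0 : 0 ≤ W := Finset.sum_nonneg h0
  set μ : Finset ι → ℝ := fun Z => (∏ i ∈ Z, 2 * w i) * (∏ i ∈ G \ Z, (1 - w i)) with hμdef
  have hμ : ∀ Z ∈ G.powerset, 0 ≤ μ Z := by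
    intro Z hZ
    rw [Finset.mem_powerset] at hZ
    apply mul_nonneg
    · exact Finset.prod_nonneg fun i hi => by have := h0 i (hZ hi); positivity
    · exact Finset.prod_nonneg fun i hi => by
        have := h1 i (Finset.mem_sdiff.1 hi).1; linarith
  have hμsum : ∑ Z ∈ G.powerset, μ Z ≤ Real.exp W := by
    rw [hμdef, ← Finset.prod_add, hW, Real.exp_sum]
    apply Finset.prod_le_prod
    · intro i hi
      have := h0 i hi; have := h1 i hi; linarith
    · intro i hi
      have := Real.add_one_le_exp (w i)
      linarith
  have expand : ∀ A ∈ G.powerset, ∏ i ∈ A, w i =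
      ∑ Z ∈ G.powerset, if A ⊆ Z then (∏ i ∈ Z, w i) * (∏ i ∈ G \ Z, (1 - w i)) else 0 := by
    intro A hA
    rw [Finset.mem_powerset] at hA
    have e : ∏ i ∈ G, (w i + if i ∈ A then 0 else 1 - w i) = ∏ i ∈ A, w i := by
      rw [← Finset.prod_sdiff hA]
      have : ∏ i ∈ G \ A, (w i + if i ∈ A then 0 else 1 - w i) = 1 := by
        apply Finset.prod_eq_one
        intro i hi
        rw [if_neg (Finset.mem_sdiff.1 hi).2]; ring
      rw [this, one_mul]
      exact Finset.prod_congr rfl fun i hi => by rw [if_pos hi, add_zero]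
    rw [← e, Finset.prod_add]
    refine Finset.sum_congr rfl fun Z hZ => ?_
    rw [Finset.mem_powerset] at hZ
    split_ifs with h
    · congr 1
      refine Finset.prod_congr rfl fun i hi => ?_
      rw [if_neg fun hA' => (Finset.mem_sdiff.1 hi).2 (h hA')]
    · obtain ⟨a, haA, haZ⟩ := Finset.not_subset.1 h
      rw [Finset.prod_eq_zero (i := a) (Finset.mem_sdiff.2 ⟨hA haA, haZ⟩) (by rw [if_pos haA]),
        mul_zero]
  have step1 : ∑ A ∈ G.powerset.filter (fun A => ∑ i ∈ A, φ i = k), ∏ i ∈ A, w i ≤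
      ∑ Z ∈ G.powerset, μ Z / Real.sqrt (Z.card + 1) := by
    rw [Finset.sum_congr rfl fun A hA => expand A (Finset.mem_filter.1 hA).1, Finset.sum_comm]
    refine Finset.sum_le_sum fun Z hZ => ?_
    have hZG := Finset.mem_powerset.1 hZ
    rw [← Finset.sum_filter, Finset.sum_const, nsmul_eq_mul]
    have hc : (((G.powerset.filter (fun A => ∑ i ∈ A, φ i = k)).filter (fun A => A ⊆ Z)).card : ℝ)
        ≤ 2 ^ Z.card / Real.sqrt (Z.card + 1) := by
      refine le_trans ?_ (sperner_count Z φ (fun i hi => hφ i (hZG hi)) k)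
      norm_cast
      apply Finset.card_le_card
      intro A hA
      simp only [Finset.mem_filter, Finset.mem_powerset] at hA ⊢
      exact ⟨hA.2, hA.1.2⟩
    have hnn : 0 ≤ (∏ i ∈ Z, w i) * (∏ i ∈ G \ Z, (1 - w i)) := by
      apply mul_nonneg
      · exact Finset.prod_nonneg fun i hi => h0 i (hZG hi)
      · exact Finset.prod_nonneg fun i hi => by
          have := h1 i (Finset.mem_sdiff.1 hi).1; linarith
    refine (mul_le_mul_of_nonneg_right hc hnn).trans (le_of_eq ?_)
    simp only [hμdef]
    rw [Finset.prod_mul_distrib, Finset.prod_const]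
    ring
  have step2 : (∑ Z ∈ G.powerset, μ Z / Real.sqrt (Z.card + 1)) ^ 2 ≤
      Real.exp W * (2 * Real.exp W / (1 + W)) := by
    calc (∑ Z ∈ G.powerset, μ Z / Real.sqrt (Z.card + 1)) ^ 2
        = (∑ Z ∈ G.powerset, Real.sqrt (μ Z) * Real.sqrt (μ Z / (Z.card + 1))) ^ 2 := by
          congr 1
          refine Finset.sum_congr rfl fun Z hZ => ?_
          rw [Real.sqrt_div (hμ Z hZ), ← mul_div_assoc, Real.mul_self_sqrt (hμ Z hZ)]
      _ ≤ (∑ Z ∈ G.powerset, Real.sqrt (μ Z) ^ 2) *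
          (∑ Z ∈ G.powerset, Real.sqrt (μ Z / (Z.card + 1)) ^ 2) :=
          Finset.sum_mul_sq_le_sq_mul_sq _ _ _
      _ = (∑ Z ∈ G.powerset, μ Z) * (∑ Z ∈ G.powerset, μ Z / (Z.card + 1)) := by
          congr 1
          · exact Finset.sum_congr rfl fun Z hZ => Real.sq_sqrt (hμ Z hZ)
          · exact Finset.sum_congr rfl fun Z hZ =>
              Real.sq_sqrt (div_nonneg (hμ Z hZ) (by positivity))
      _ ≤ _ := by
          have hw := weighted_recip G w h0 h1
          apply mul_le_mul hμsum hw _ (Real.exp_pos _).le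
          exact Finset.sum_nonneg fun Z hZ => div_nonneg (hμ Z hZ) (by positivity)
  refine step1.trans ?_
  apply le_of_sq_le_sq _ (by positivity)
  refine step2.trans ?_
  rw [div_pow, Real.sq_sqrt (by linarith), mul_pow]
  have := Real.exp_pos W
  rw [mul_div_assoc', div_le_div_iff_of_pos_right (by linarith)]
  nlinarith

lemma sum_le_of_inj {α β : Type*} (s : Finset α) (t : Finset β) (e : α → β) (f : α → ℝ) (g : β → ℝ)
    (he : ∀ a ∈ s, e a ∈ t) (hinj : ∀ a ∈ s, ∀ b ∈ s, e a = e b → a = b)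
    (hfg : ∀ a ∈ s, f a ≤ g (e a)) (hg : ∀ b ∈ t, 0 ≤ g b) :
    ∑ a ∈ s, f a ≤ ∑ b ∈ t, g b := by
  calc ∑ a ∈ s, f a ≤ ∑ a ∈ s, g (e a) := Finset.sum_le_sum hfg
    _ = ∑ b ∈ s.image e, g b := (Finset.sum_image (fun a ha b hb h => hinj a ha b hb h)).symm
    _ ≤ _ := Finset.sum_le_sum_of_subset_of_nonneg
        (Finset.image_subset_iff.2 he) (fun b hb _ => hg b hb)

lemma conc_split {ι : Type*} (G G' : Finset ι) (hG : G' ⊆ G) (w φ : ι → ℝ)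
    (h0 : ∀ i ∈ G, 0 ≤ w i) (B : ℝ)
    (hB : ∀ k : ℝ, ∑ A ∈ G'.powerset.filter (fun A => ∑ i ∈ A, φ i = k), ∏ i ∈ A, w i ≤ B)
    (k : ℝ) :
    ∑ A ∈ G.powerset.filter (fun A => ∑ i ∈ A, φ i = k), ∏ i ∈ A, w i ≤
      Real.exp (∑ i ∈ G \ G', w i) * B := by
  have hB0 : 0 ≤ B := le_trans (Finset.sum_nonneg fun A hA => Finset.prod_nonneg fun i hi =>
    h0 i (hG (Finset.mem_powerset.1 (Finset.mem_filter.1 hA).1 hi))) (hB 0)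
  calc ∑ A ∈ G.powerset.filter (fun A => ∑ i ∈ A, φ i = k), ∏ i ∈ A, w i
      ≤ ∑ P ∈ (G \ G').powerset.sigma (fun C => G'.powerset.filter
          (fun A => ∑ i ∈ A, φ i = k - ∑ i ∈ C, φ i)), (∏ i ∈ P.1, w i) * ∏ i ∈ P.2, w i := by
        apply sum_le_of_inj _ _ (fun A => ⟨A \ G', A ∩ G'⟩)
        · intro A hA
          simp only [Finset.mem_filter, Finset.mem_powerset, Finset.mem_sigma] at hA ⊢
          refine ⟨Finset.sdiff_subset_sdiff hA.1 (le_refl _), Finset.inter_subset_right, ?_⟩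
          rw [← hA.2, ← Finset.sum_inter_add_sum_sdiff A G']
          ring
        · intro A _ B _ h
          simp only [Sigma.mk.injEq, heq_eq_eq] at h
          rw [← Finset.sdiff_union_inter A G', ← Finset.sdiff_union_inter B G', h.1, h.2]
        · intro A _
          rw [mul_comm]
          exact le_of_eq (Finset.prod_inter_mul_prod_sdiff A G' w).symm
        · intro P hP
          simp only [Finset.mem_filter, Finset.mem_powerset, Finset.mem_sigma] at hP
          apply mul_nonneg <;> apply Finset.prod_nonneg <;> intro i hi <;> apply h0
          · exact (Finset.mem_sdiff.1 (hP.1 hi)).1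
          · exact hG (hP.2.1 hi)
    _ = ∑ C ∈ (G \ G').powerset, (∏ i ∈ C, w i) * ∑ A ∈ G'.powerset.filter
          (fun A => ∑ i ∈ A, φ i = k - ∑ i ∈ C, φ i), ∏ i ∈ A, w i := by
        rw [Finset.sum_sigma]
        simp only [Finset.mul_sum]
    _ ≤ ∑ C ∈ (G \ G').powerset, (∏ i ∈ C, w i) * B := by
        refine Finset.sum_le_sum fun C hC => mul_le_mul_of_nonneg_left (hB _) ?_
        exact Finset.prod_nonneg fun i hi =>
          h0 i (Finset.mem_sdiff.1 (Finset.mem_powerset.1 hC hi)).1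
    _ = (∏ i ∈ G \ G', (w i + 1)) * B := by
        rw [← Finset.sum_mul, Finset.prod_add_one]
    _ ≤ _ := by
        apply mul_le_mul_of_nonneg_right _ hB0
        rw [Real.exp_sum]
        refine Finset.prod_le_prod (fun i hi => ?_) (fun i _ => Real.add_one_le_exp _)
        have := h0 i (Finset.mem_sdiff.1 hi).1
        linarith

lemma conc1 {ι : Type*} (G : Finset ι) (w φ : ι → ℝ) (h0 : ∀ i ∈ G, 0 ≤ w i)
    (h1 : ∀ i ∈ G, w i ≤ 1) (k : ℝ) :
    ∑ A ∈ G.powerset.filter (fun A => ∑ i ∈ A, φ i = k), ∏ i ∈ A, w i ≤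
      4 * Real.exp (∑ i ∈ G, w i) / Real.sqrt (1 + ∑ i ∈ G.filter (fun i => φ i ≠ 0), w i) := by
  have main : ∀ G' ⊆ G, ∑ i ∈ G.filter (fun i => φ i ≠ 0), w i ≤ 2 * ∑ i ∈ G', w i →
      (∀ k : ℝ, ∑ A ∈ G'.powerset.filter (fun A => ∑ i ∈ A, φ i = k), ∏ i ∈ A, w i ≤
        2 * Real.exp (∑ i ∈ G', w i) / Real.sqrt (1 + ∑ i ∈ G', w i)) →
      ∑ A ∈ G.powerset.filter (fun A => ∑ i ∈ A, φ i = k), ∏ i ∈ A, w i ≤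
      4 * Real.exp (∑ i ∈ G, w i) / Real.sqrt (1 + ∑ i ∈ G.filter (fun i => φ i ≠ 0), w i) := by
    intro G' hG' hw hc
    refine (conc_split G G' hG' w φ h0 _ hc k).trans ?_
    have hG0 : 0 ≤ ∑ i ∈ G', w i := Finset.sum_nonneg fun i hi => h0 i (hG' hi)
    have hF0 : 0 ≤ ∑ i ∈ G.filter (fun i => φ i ≠ 0), w i :=
      Finset.sum_nonneg fun i hi => h0 i (Finset.mem_filter.1 hi).1
    rw [← Finset.sum_sdiff hG', Real.exp_add]
    have hs : Real.sqrt (1 + ∑ i ∈ G.filter (fun i => φ i ≠ 0), w i) ≤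
        2 * Real.sqrt (1 + ∑ i ∈ G', w i) := by
      rw [Real.sqrt_le_left (by positivity), mul_pow, Real.sq_sqrt (by linarith)]
      linarith
    have e1 := Real.exp_pos (∑ i ∈ G \ G', w i)
    have e2 := Real.exp_pos (∑ i ∈ G', w i)
    rw [mul_div_assoc', div_le_div_iff₀ (Real.sqrt_pos.2 (by linarith))
      (Real.sqrt_pos.2 (by linarith))]
    have e3 := mul_pos e1 e2
    nlinarith
  have hsplit : ∑ i ∈ G.filter (fun i => φ i ≠ 0), w i =
      ∑ i ∈ G.filter (fun i => 0 < φ i), w i + ∑ i ∈ G.filter (fun i => φ i < 0), w i := by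
    rw [← Finset.sum_union]
    · apply Finset.sum_congr _ (fun _ _ => rfl)
      ext i
      simp only [Finset.mem_filter, Finset.mem_union, ne_eq, ← and_or_left]
      rw [and_congr_right_iff]
      intro _
      constructor
      · intro h; rcases lt_or_gt_of_ne h with h | h
        · exact Or.inr h
        · exact Or.inl h
      · rintro (h | h)
        · exact h.ne'
        · exact h.ne
    · rw [Finset.disjoint_filter]
      intro i _ h1 h2
      linarith
  rcases le_total (∑ i ∈ G.filter (fun i => φ i < 0), w i) (∑ i ∈ G.filter (fun i => 0 < φ i), w i)
    with h | h
  · apply main (G.filter (fun i => 0 < φ i)) (Finset.filter_subset _ _) (by linarith)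
    intro k
    exact conc_pos _ w φ (fun i hi => h0 i (Finset.mem_filter.1 hi).1)
      (fun i hi => h1 i (Finset.mem_filter.1 hi).1) (fun i hi => (Finset.mem_filter.1 hi).2) k
  · apply main (G.filter (fun i => φ i < 0)) (Finset.filter_subset _ _) (by linarith)
    intro k
    have := conc_pos (G.filter (fun i => φ i < 0)) w (fun i => - φ i)
      (fun i hi => h0 i (Finset.mem_filter.1 hi).1)
      (fun i hi => h1 i (Finset.mem_filter.1 hi).1)
      (fun i hi => by have := (Finset.mem_filter.1 hi).2; linarith) (-k)
    simpa only [Finset.sum_neg_distrib, neg_inj] using this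

lemma concR {r : ℕ} {ι : Type*} [Fintype ι] (S : Finset (Fin r → ℕ)) (W : ι → (Fin r → ℕ) → ℝ)
    (hW : ∀ i ν, 0 ≤ W i ν) (hW0 : ∀ i, W i 0 ≤ 1) (good : ι → Prop) (w : Fin r → ι → ℝ)
    (hw0 : ∀ j i, 0 ≤ w j i) (hw1 : ∀ j i, good i → w j i ≤ 1)
    (hw : ∀ j i, good i → W i (Pi.single j 1) ≤ w j i)
    (φ : Fin r → ι → ℕ → ℝ) (hφ0 : ∀ j i, φ j i 0 = 0) (k : Fin r → ℝ) :
    ∑ s ∈ (Fintype.piFinset (fun _ : ι => S)).filter (fun s => ∀ j, ∑ i, φ j i (s i j) = k j),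
        ∏ i, W i (s i) ≤
      (∏ i, (1 + ∑ ν ∈ S.filter (fun ν => ν ≠ 0 ∧ ¬ (good i ∧ ∃ j, ν = Pi.single j 1)), W i ν)) *
      ∏ j, (4 * Real.exp (∑ i ∈ Finset.univ.filter good, w j i) /
        Real.sqrt (1 + ∑ i ∈ (Finset.univ.filter good).filter (fun i => φ j i 1 ≠ 0), w j i)) := by
  set G := (Finset.univ : Finset ι).filter good with hG
  set S' : ι → Finset (Fin r → ℕ) := fun i =>
    insert 0 (S.filter (fun ν => ν ≠ 0 ∧ ¬ (good i ∧ ∃ j, ν = Pi.single j 1))) with hS'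
  set T : (ι → Fin r → ℕ) → Finset (Fin r → Finset ι) := fun h =>
    Fintype.piFinset (fun j => G.powerset.filter
      (fun A => ∑ i ∈ A, φ j i 1 = k j - ∑ i, φ j i (h i j))) with hT
  set W' : ι → (Fin r → ℕ) → ℝ := fun i ν => if ν = 0 then 1 else W i ν with hW'
  have hW'0 : ∀ i ν, 0 ≤ W' i ν := by
    intro i ν; simp only [hW']; split_ifs; · norm_num
    · exact hW i ν
  have hsingle : ∀ j j' : Fin r, (Pi.single j 1 : Fin r → ℕ) = Pi.single j' 1 → j = j' := by
    intro j j' h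
    by_contra hne
    have := congrFun h j
    simp [hne] at this
  set e : (ι → Fin r → ℕ) → (Σ _ : ι → Fin r → ℕ, Fin r → Finset ι) := fun s =>
    ⟨fun i => if good i ∧ ∃ j, s i = Pi.single j 1 then 0 else s i,
      fun j => G.filter (fun i => s i = Pi.single j 1)⟩ with he
  calc ∑ s ∈ (Fintype.piFinset (fun _ : ι => S)).filter
        (fun s => ∀ j, ∑ i, φ j i (s i j) = k j), ∏ i, W i (s i)
      ≤ ∑ P ∈ (Fintype.piFinset S').sigma T, (∏ i, W' i (P.1 i)) * ∏ j, ∏ i ∈ P.2 j, w j i := by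
        apply sum_le_of_inj _ _ e
        · intro s hs
          rw [Finset.mem_filter, Fintype.mem_piFinset] at hs
          rw [Finset.mem_sigma, Fintype.mem_piFinset, Fintype.mem_piFinset]
          refine ⟨fun i => ?_, fun j => ?_⟩
          · simp only [he, hS']
            split_ifs with h
            · exact Finset.mem_insert_self _ _
            · by_cases h0 : s i = 0
              · rw [h0]; exact Finset.mem_insert_self _ _
              · exact Finset.mem_insert_of_mem (Finset.mem_filter.2 ⟨hs.1 i, h0, h⟩)
          · rw [Finset.mem_filter, Finset.mem_powerset]
            refine ⟨Finset.filter_subset _ _, ?_⟩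
            rw [← hs.2 j, eq_sub_iff_add_eq]
            simp only [he, hG, Finset.filter_filter, Finset.sum_filter]
            rw [← Finset.sum_add_distrib]
            refine Finset.sum_congr rfl fun i _ => ?_
            by_cases h : good i ∧ ∃ j, s i = Pi.single j 1
            · rw [if_pos h]
              obtain ⟨hg, j', hj'⟩ := h
              simp only [hg, true_and, hj', Pi.zero_apply, hφ0, add_zero]
              by_cases hjj : j' = j
              · subst hjj; simp
              · rw [if_neg (fun h => hjj (hsingle _ _ h)), Pi.single_apply,
                  if_neg (fun h => hjj h.symm), hφ0]
            · rw [if_neg h, if_neg (fun h' => h ⟨h'.1, j, h'.2⟩), zero_add]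
        · intro s _ s' _ h
          simp only [he, Sigma.mk.injEq, heq_eq_eq] at h
          obtain ⟨h1, h2⟩ := h
          funext i
          have a1 := congrFun h1 i
          have a2 : ∀ j, good i → (s i = Pi.single j 1 ↔ s' i = Pi.single j 1) := by
            intro j hg
            have := congrFun h2 j
            have := congrArg (fun A => i ∈ A) this
            simpa [hG, hg] using this
          by_cases h : good i ∧ ∃ j, s i = Pi.single j 1
          · obtain ⟨hg, j, hj⟩ := h
            rw [hj, (a2 j hg).1 hj]
          · have h' : ¬ (good i ∧ ∃ j, s' i = Pi.single j 1) := by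
              rintro ⟨hg, j, hj⟩
              exact h ⟨hg, j, (a2 j hg).2 hj⟩
            simpa only [if_neg h, if_neg h'] using a1
        · intro s _
          have : ∏ j, ∏ i ∈ (e s).2 j, w j i =
              ∏ i, ∏ j, if good i ∧ s i = Pi.single j 1 then w j i else 1 := by
            rw [Finset.prod_comm]
            refine Finset.prod_congr rfl fun j _ => ?_
            simp only [he, hG, Finset.filter_filter, Finset.prod_filter]
          rw [this, ← Finset.prod_mul_distrib]
          refine Finset.prod_le_prod (fun i _ => hW i _) fun i _ => ?_
          by_cases h : good i ∧ ∃ j, s i = Pi.single j 1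
          · have h' := h
            obtain ⟨hg, j, hj⟩ := h
            have e1 : W' i ((e s).1 i) = 1 := by simp [he, hW', if_pos h']
            rw [e1, one_mul, Finset.prod_eq_single j]
            · rw [if_pos ⟨hg, hj⟩, hj]; exact hw j i hg
            · intro j' _ hjj
              rw [if_neg]
              rintro ⟨_, h3⟩
              exact hjj (hsingle _ _ (h3.symm.trans hj))
            · simp
          · have e1 : (e s).1 i = s i := by simp only [he, if_neg h]
            rw [e1, Finset.prod_eq_one, mul_one]
            · simp only [hW']
              split_ifs with h0
              · rw [h0]; exact hW0 i
              · exact le_refl _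
            · intro j _
              rw [if_neg fun h3 => h ⟨h3.1, j, h3.2⟩]
        · intro P _
          apply mul_nonneg
          · exact Finset.prod_nonneg fun i _ => hW'0 _ _
          · exact Finset.prod_nonneg fun j _ => Finset.prod_nonneg fun i _ => hw0 j i
    _ = ∑ h ∈ Fintype.piFinset S', (∏ i, W' i (h i)) * ∏ j, ∑ A ∈ G.powerset.filter
          (fun A => ∑ i ∈ A, φ j i 1 = k j - ∑ i, φ j i (h i j)), ∏ i ∈ A, w j i := by
        rw [Finset.sum_sigma]
        refine Finset.sum_congr rfl fun h _ => ?_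
        rw [Finset.prod_univ_sum, Finset.mul_sum]
    _ ≤ ∑ h ∈ Fintype.piFinset S', (∏ i, W' i (h i)) *
          ∏ j, (4 * Real.exp (∑ i ∈ G, w j i) /
            Real.sqrt (1 + ∑ i ∈ G.filter (fun i => φ j i 1 ≠ 0), w j i)) := by
        refine Finset.sum_le_sum fun h _ => mul_le_mul_of_nonneg_left ?_
          (Finset.prod_nonneg fun i _ => hW'0 _ _)
        refine Finset.prod_le_prod (fun j _ => Finset.sum_nonneg fun A _ =>
          Finset.prod_nonneg fun i _ => hw0 j i) fun j _ => ?_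
        exact conc1 G (w j) (fun i => φ j i 1) (fun i _ => hw0 j i)
          (fun i hi => hw1 j i (Finset.mem_filter.1 hi).2) _
    _ = _ := by
        rw [← Finset.sum_mul, ← Finset.prod_univ_sum]
        congr 1
        refine Finset.prod_congr rfl fun i _ => ?_
        simp only [hS']
        rw [Finset.sum_insert (by simp)]
        congr 1
        · simp [hW']
        · refine Finset.sum_congr rfl fun ν hν => ?_
          simp only [hW']
          rw [if_neg (Finset.mem_filter.1 hν).2.1]

lemma periodic_emod {F : ℤ → ℝ} {m : ℕ} (hF : ∀ k, F (k + m) = F k) (k : ℤ) : F (k % m) = F k := by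
  have h : Function.Periodic F (m : ℤ) := hF
  have := h.sub_zsmul_eq (x := k) (k / m)
  rw [← this]
  congr 1
  rw [smul_eq_mul, Int.emod_def, mul_comm]

lemma full_two (m n : ℕ) (hm : 0 < m) (hn : 0 < n) (hmn : Nat.Coprime m n) (F1 F2 : ℤ → ℝ)
    (h1 : ∀ k, F1 (k + m) = F1 k) (h2 : ∀ k, F2 (k + n) = F2 k) (a : ℤ) :
    ∑ k ∈ Finset.Ico a (a + (m * n : ℕ)), F1 k * F2 k =
      (∑ k ∈ Finset.Ico (0:ℤ) m, F1 k) * ∑ k ∈ Finset.Ico (0:ℤ) n, F2 k := by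
  have hinj : Set.InjOn (fun k : ℤ => (k % m, k % n)) (Finset.Ico a (a + (m * n : ℕ))) := by
    intro x hx y hy h
    simp only [Prod.mk.injEq] at h
    simp only [Finset.coe_Ico, Set.mem_Ico] at hx hy
    have e1 : (m : ℤ) ∣ x - y := Int.ModEq.dvd (Int.ModEq.symm h.1)
    have e2 : (n : ℤ) ∣ x - y := Int.ModEq.dvd (Int.ModEq.symm h.2)
    have e3 : ((m * n : ℕ) : ℤ) ∣ x - y := by
      push_cast
      exact IsCoprime.mul_dvd (Nat.isCoprime_iff_coprime.2 hmn) e1 e2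
    have := Int.eq_zero_of_abs_lt_dvd e3 (by rw [abs_lt]; omega)
    omega
  have himg : (Finset.Ico a (a + (m * n : ℕ))).image (fun k : ℤ => (k % m, k % n)) =
      Finset.Ico (0:ℤ) m ×ˢ Finset.Ico (0:ℤ) n := by
    apply Finset.eq_of_subset_of_card_le
    · intro p hp
      obtain ⟨k, _, rfl⟩ := Finset.mem_image.1 hp
      simp only [Finset.mem_product, Finset.mem_Ico]
      exact ⟨⟨Int.emod_nonneg _ (by omega), Int.emod_lt_of_pos _ (by omega)⟩,
        ⟨Int.emod_nonneg _ (by omega), Int.emod_lt_of_pos _ (by omega)⟩⟩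
    · rw [Finset.card_image_of_injOn hinj, Finset.card_product]
      have : ((m:ℤ)*n).toNat = m*n := by rw [← Nat.cast_mul, Int.toNat_natCast]
      simp [this]
  rw [Finset.sum_mul_sum, ← Finset.sum_product', ← himg, Finset.sum_image hinj]
  refine Finset.sum_congr rfl fun k _ => ?_
  simp only
  rw [periodic_emod h1, periodic_emod h2]

lemma full_period (l : Finset ℕ) (hl : ∀ p ∈ l, p.Prime) (F : ℕ → ℤ → ℝ)
    (hF : ∀ p ∈ l, ∀ k, F p (k + p) = F p k) :
    (∀ k : ℤ, ∏ p ∈ l, F p (k + (∏ p ∈ l, p : ℕ)) = ∏ p ∈ l, F p k) ∧ ∀ a : ℤ,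
    ∑ k ∈ Finset.Ico a (a + (∏ p ∈ l, p : ℕ)), ∏ p ∈ l, F p k =
      ∏ p ∈ l, ∑ k ∈ Finset.Ico (0:ℤ) p, F p k := by
  induction l using Finset.induction_on with
  | empty =>
    refine ⟨by simp, fun a => ?_⟩
    have : Finset.Ico a (a + 1) = {a} := by ext x; simp; omega
    simp [this]
  | insert q l hq ih =>
    have ih' := ih (fun p hp => hl p (Finset.mem_insert_of_mem hp))
      (fun p hp => hF p (Finset.mem_insert_of_mem hp))
    have hqp := hl q (Finset.mem_insert_self _ _)
    have hcop : Nat.Coprime q (∏ p ∈ l, p) := by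
      apply Nat.Coprime.prod_right
      intro p hp
      rw [Nat.coprime_primes hqp (hl p (Finset.mem_insert_of_mem hp))]
      rintro rfl
      exact hq hp
    have hper : ∀ p ∈ insert q l, ∀ (k : ℤ) (c : ℕ), F p (k + (c * p : ℕ)) = F p k := by
      intro p hp k c
      have h : Function.Periodic (F p) (p : ℤ) := hF p hp
      have := h.nat_mul c k
      push_cast
      exact_mod_cast this
    refine ⟨?_, fun a => ?_⟩
    · intro k
      refine Finset.prod_congr rfl fun p hp => ?_
      obtain ⟨c, hc⟩ := Finset.dvd_prod_of_mem (fun p : ℕ => p) hp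
      rw [hc, mul_comm]
      exact hper p hp k c
    · rw [Finset.prod_insert hq, Finset.prod_insert hq]
      simp only [Finset.prod_insert hq]
      rw [full_two q (∏ p ∈ l, p) hqp.pos
        (Finset.prod_pos fun p hp => (hl p (Finset.mem_insert_of_mem hp)).pos) hcop (F q)
        (fun k => ∏ p ∈ l, F p k) (hF q (Finset.mem_insert_self _ _)) ih'.1 a]
      congr 1
      have := ih'.2 0
      rw [zero_add] at this
      exact this

lemma sum_Ico_int (F : ℤ → ℝ) {a b c : ℤ} (h1 : a ≤ b) (h2 : b ≤ c) :
    ∑ k ∈ Finset.Ico a b, F k + ∑ k ∈ Finset.Ico b c, F k = ∑ k ∈ Finset.Ico a c, F k := by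
  rw [← Finset.Ico_union_Ico_eq_Ico h1 h2,
    Finset.sum_union (Finset.Ico_disjoint_Ico_consecutive a b c)]

lemma sum_blocks (F : ℤ → ℝ) (q : ℕ) (Sf : ℝ)
    (hS : ∀ a : ℤ, ∑ k ∈ Finset.Ico a (a + q), F k = Sf) (a : ℤ) (j : ℕ) :
    ∑ k ∈ Finset.Ico a (a + (j * q : ℕ)), F k = j * Sf := by
  induction j with
  | zero => simp
  | succ j ih =>
    have h1 : a ≤ a + (j * q : ℕ) := by omega
    have h2 : a + (j * q : ℕ) ≤ a + ((j + 1) * q : ℕ) := by push_cast; nlinarith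
    rw [← sum_Ico_int _ h1 h2, ih]
    have : a + ((j + 1) * q : ℕ) = (a + (j * q : ℕ)) + q := by push_cast; ring
    rw [this, hS]
    push_cast; ring

lemma sum_upper (F : ℤ → ℝ) (q : ℕ) (hq : 0 < q) (Sf : ℝ) (hF : ∀ k, 0 ≤ F k)
    (hS : ∀ a : ℤ, ∑ k ∈ Finset.Ico a (a + q), F k = Sf) (a b : ℤ) (hab : a ≤ b) :
    ∑ k ∈ Finset.Ico a b, F k ≤ (((b - a : ℤ) : ℝ) / q + 1) * Sf := by
  have hSf : 0 ≤ Sf := by rw [← hS 0]; exact Finset.sum_nonneg fun k _ => hF k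
  obtain ⟨N, hN⟩ := Int.eq_ofNat_of_zero_le (sub_nonneg.2 hab)
  have hsub : Finset.Ico a b ⊆ Finset.Ico a (a + ((N / q + 1) * q : ℕ)) := by
    apply Finset.Ico_subset_Ico_right
    have : N < (N / q + 1) * q := by
      have := Nat.lt_div_mul_add hq (a := N)
      nlinarith
    zify at this
    push_cast
    linarith
  refine (Finset.sum_le_sum_of_subset_of_nonneg hsub fun k _ _ => hF k).trans ?_
  rw [sum_blocks F q Sf hS, hN]
  apply mul_le_mul_of_nonneg_right _ hSf
  push_cast
  have : ((N / q : ℕ) : ℝ) ≤ (N : ℝ) / q := Nat.cast_div_le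
  linarith

lemma sum_zero_bound (F : ℤ → ℝ) (q : ℕ) (hq : 0 < q) (M : ℝ) (hF : ∀ k, |F k| ≤ M)
    (hS : ∀ a : ℤ, ∑ k ∈ Finset.Ico a (a + q), F k = 0) (a b : ℤ) (hab : a ≤ b) :
    ∑ k ∈ Finset.Ico a b, F k ≤ q * M := by
  have hM : 0 ≤ M := (abs_nonneg _).trans (hF 0)
  obtain ⟨N, hN⟩ := Int.eq_ofNat_of_zero_le (sub_nonneg.2 hab)
  have h1 : a ≤ a + (N / q * q : ℕ) := by omega
  have h3 : N / q * q ≤ N := Nat.div_mul_le_self N q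
  have h4 : N < N / q * q + q := Nat.lt_div_mul_add hq
  have h2 : a + (N / q * q : ℕ) ≤ b := by omega
  rw [← sum_Ico_int _ h1 h2, sum_blocks F q 0 hS, mul_zero, zero_add]
  calc ∑ k ∈ Finset.Ico (a + (N / q * q : ℕ)) b, F k
      ≤ ∑ k ∈ Finset.Ico (a + (N / q * q : ℕ)) b, M :=
        Finset.sum_le_sum fun k _ => (le_abs_self _).trans (hF k)
    _ = (Finset.Ico (a + ((N / q * q : ℕ) : ℤ)) b).card * M := by
        rw [Finset.sum_const, nsmul_eq_mul]
    _ ≤ _ := by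
        apply mul_le_mul_of_nonneg_right _ hM
        rw [Int.card_Ico]
        norm_cast
        omega

/-- number of forbidden classes -/
noncomputable def omg (Ω : ℕ → ℤ → Prop) (p : ℕ) : ℕ :=
  ((Finset.Ico (0:ℤ) p).filter (fun k => Ω p k)).card

noncomputable def hsv (Ω : ℕ → ℤ → Prop) (p : ℕ) : ℝ := (omg Ω p : ℝ) / (p - omg Ω p)

noncomputable def psv (Ω : ℕ → ℤ → Prop) (p : ℕ) (k : ℤ) : ℝ := if Ω p k then -1 else hsv Ω p

lemma psv_sum (Ω : ℕ → ℤ → Prop) (p : ℕ) (h : omg Ω p < p) :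
    ∑ k ∈ Finset.Ico (0:ℤ) p, psv Ω p k = 0 ∧
    ∑ k ∈ Finset.Ico (0:ℤ) p, psv Ω p k ^ 2 = p * hsv Ω p := by
  have hc : ((Finset.Ico (0:ℤ) p).filter (fun k => ¬ Ω p k)).card + omg Ω p = p := by
    have := Finset.card_filter_add_card_filter_not (s := Finset.Ico (0:ℤ) p) (fun k => Ω p k)
    rw [Int.card_Ico] at this
    unfold omg
    omega
  have hc' : (((Finset.Ico (0:ℤ) p).filter (fun k => ¬ Ω p k)).card : ℝ) = p - omg Ω p := by
    rw [eq_sub_iff_add_eq]; exact_mod_cast hc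
  have hpos : (0:ℝ) < p - omg Ω p := by
    rw [sub_pos]; exact_mod_cast h
  constructor
  · unfold psv
    rw [Finset.sum_ite, Finset.sum_const, Finset.sum_const, nsmul_eq_mul, nsmul_eq_mul, hc']
    change (omg Ω p : ℝ) * _ + _ = 0
    unfold hsv
    field_simp
    ring
  · have : ∀ k, psv Ω p k ^ 2 = if Ω p k then 1 else hsv Ω p ^ 2 := by
      intro k; unfold psv; split_ifs <;> norm_num
    simp only [this]
    rw [Finset.sum_ite, Finset.sum_const, Finset.sum_const, nsmul_eq_mul, nsmul_eq_mul, hc']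
    change (omg Ω p : ℝ) * _ + _ = _
    unfold hsv
    field_simp
    ring

lemma hsv_nonneg (Ω : ℕ → ℤ → Prop) (p : ℕ) (h : omg Ω p < p) : 0 ≤ hsv Ω p := by
  unfold hsv
  have : (omg Ω p : ℝ) < p := by exact_mod_cast h
  exact div_nonneg (by positivity) (by linarith)

lemma psv_abs (Ω : ℕ → ℤ → Prop) (p : ℕ) (h : omg Ω p < p) (k : ℤ) : |psv Ω p k| ≤ p := by
  have h1 : (1:ℝ) ≤ p := by exact_mod_cast (by omega : 1 ≤ p)
  unfold psv
  split_ifs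
  · simpa using h1
  · rw [abs_of_nonneg (hsv_nonneg Ω p h)]
    unfold hsv
    have h3 : (omg Ω p : ℝ) + 1 ≤ p := by exact_mod_cast h
    rw [div_le_iff₀ (by linarith)]
    have : (0:ℝ) ≤ omg Ω p := by positivity
    nlinarith

theorem sieve_basic (P : Finset ℕ) (hP : ∀ p ∈ P, p.Prime) (Ω : ℕ → ℤ → Prop)
    (hper : ∀ p ∈ P, ∀ k, Ω p (k + p) ↔ Ω p k) (hω : ∀ p ∈ P, omg Ω p < p)
    (R : ℝ) (hR : 1 ≤ R) (a b : ℤ) (hab : a ≤ b) :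
    (((Finset.Ico a b).filter (fun k => ∀ p ∈ P, ¬ Ω p k)).card : ℝ) *
      (∑ l ∈ P.powerset.filter (fun l => ((∏ p ∈ l, p : ℕ) : ℝ) ≤ R), ∏ p ∈ l, hsv Ω p) ≤
      ((b - a : ℤ) : ℝ) + 2 * R ^ 6 := by
  set 𝓛 := P.powerset.filter (fun l => ((∏ p ∈ l, p : ℕ) : ℝ) ≤ R) with h𝓛
  set L := ∑ l ∈ 𝓛, ∏ p ∈ l, hsv Ω p with hL
  set N : ℝ := ((b - a : ℤ) : ℝ) with hN
  have hN0 : 0 ≤ N := by rw [hN]; exact_mod_cast sub_nonneg.2 hab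
  have hsub : ∀ l ∈ 𝓛, l ⊆ P := fun l hl => Finset.mem_powerset.1 (Finset.mem_filter.1 hl).1
  have hle : ∀ l ∈ 𝓛, ((∏ p ∈ l, p : ℕ) : ℝ) ≤ R := fun l hl => (Finset.mem_filter.1 hl).2
  have hhl : ∀ l ∈ 𝓛, 0 ≤ ∏ p ∈ l, hsv Ω p := fun l hl =>
    Finset.prod_nonneg fun p hp => hsv_nonneg Ω p (hω p (hsub l hl hp))
  have hL1 : 1 ≤ L := by
    have : (∅ : Finset ℕ) ∈ 𝓛 := by simp [h𝓛, hR]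
    have := Finset.single_le_sum hhl this
    simpa using this
  have hcard : (𝓛.card : ℝ) ≤ R := by
    have : 𝓛.card ≤ (Finset.Icc 1 ⌊R⌋₊).card := by
      apply Finset.card_le_card_of_injOn (fun l => ∏ p ∈ l, p)
      · intro l hl
        have hl' := Finset.mem_coe.1 hl
        simp only [Finset.coe_Icc, Set.mem_Icc]
        exact ⟨Finset.prod_pos fun p hp => (hP p (hsub l hl' hp)).pos, Nat.le_floor (hle l hl')⟩
      · intro l hl l' hl' h
        have e1 := Nat.primeFactors_prod (fun p hp => hP p (hsub l hl hp))
        have e2 := Nat.primeFactors_prod (fun p hp => hP p (hsub l' hl' hp))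
        simp only at h
        rw [← e1, ← e2, h]
    rw [Nat.card_Icc, Nat.add_sub_cancel] at this
    exact (Nat.cast_le.2 this).trans (Nat.floor_le (by linarith))
  set Ψ : Finset ℕ → ℤ → ℝ := fun l k => ∏ p ∈ l, psv Ω p k with hΨ
  have hpsvper : ∀ p ∈ P, ∀ k : ℤ, psv Ω p (k + p) = psv Ω p k := by
    intro p hp k
    unfold psv
    simp only [hper p hp k]
  have hΨabs : ∀ l ∈ 𝓛, ∀ k, |Ψ l k| ≤ R := by
    intro l hl k
    rw [hΨ]
    simp only [Finset.abs_prod]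
    refine le_trans (Finset.prod_le_prod (fun _ _ => abs_nonneg _)
      (fun p hp => psv_abs Ω p (hω p (hsub l hl hp)) k)) ?_
    have := hle l hl
    push_cast at this
    exact this
  have hdiag : ∀ l ∈ 𝓛, ∑ k ∈ Finset.Ico a b, Ψ l k * Ψ l k ≤ (N + R) * ∏ p ∈ l, hsv Ω p := by
    intro l hl
    have hq0 : 0 < ∏ p ∈ l, p := Finset.prod_pos fun p hp => (hP p (hsub l hl hp)).pos
    have fp := full_period l (fun p hp => hP p (hsub l hl hp)) (fun p k => psv Ω p k ^ 2)
      (fun p hp k => by simp only [hpsvper p (hsub l hl hp) k])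
    have := sum_upper (fun k => ∏ p ∈ l, psv Ω p k ^ 2) (∏ p ∈ l, p) hq0 _
      (fun k => Finset.prod_nonneg fun _ _ => sq_nonneg _) fp.2 a b hab
    have e1 : ∀ k, Ψ l k * Ψ l k = ∏ p ∈ l, psv Ω p k ^ 2 := by
      intro k; rw [hΨ]; simp only; rw [← Finset.prod_mul_distrib]
      exact Finset.prod_congr rfl fun _ _ => (sq _).symm
    simp only [e1]
    refine this.trans ?_
    have e2 : ∏ p ∈ l, ∑ k ∈ Finset.Ico (0:ℤ) p, psv Ω p k ^ 2 =
        ((∏ p ∈ l, p : ℕ) : ℝ) * ∏ p ∈ l, hsv Ω p := by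
      push_cast
      rw [← Finset.prod_mul_distrib]
      exact Finset.prod_congr rfl fun p hp => (psv_sum Ω p (hω p (hsub l hl hp))).2
    rw [e2]
    have hq0' : (0:ℝ) < ((∏ p ∈ l, p : ℕ) : ℝ) := by exact_mod_cast hq0
    rw [← mul_assoc]
    apply mul_le_mul_of_nonneg_right _ (hhl l hl)
    rw [add_mul, div_mul_cancel₀ _ hq0'.ne', one_mul]
    have := hle l hl
    linarith
  have hoff : ∀ l ∈ 𝓛, ∀ l' ∈ 𝓛, l ≠ l' → ∑ k ∈ Finset.Ico a b, Ψ l k * Ψ l' k ≤ R ^ 4 := by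
    intro l hl l' hl' hne
    set F : ℕ → ℤ → ℝ := fun p k => (if p ∈ l then psv Ω p k else 1) *
      (if p ∈ l' then psv Ω p k else 1) with hF
    have hu : ∀ p ∈ l ∪ l', p ∈ P := fun p hp => by
      rcases Finset.mem_union.1 hp with h | h
      · exact hsub l hl h
      · exact hsub l' hl' h
    have e1 : ∀ k, Ψ l k * Ψ l' k = ∏ p ∈ l ∪ l', F p k := by
      intro k
      rw [hF]; simp only
      rw [Finset.prod_mul_distrib, Finset.prod_ite_mem, Finset.prod_ite_mem,
        Finset.union_inter_cancel_left, Finset.union_inter_cancel_right]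
    have fp := full_period (l ∪ l') (fun p hp => hP p (hu p hp)) F
      (fun p hp k => by simp only [hF, hpsvper p (hu p hp) k])
    have hz : ∏ p ∈ l ∪ l', ∑ k ∈ Finset.Ico (0:ℤ) p, F p k = 0 := by
      have : ∃ p ∈ l ∪ l', ¬ (p ∈ l ↔ p ∈ l') := by
        by_contra hcon
        push Not at hcon
        apply hne
        ext p
        constructor
        · intro h; exact (hcon p (Finset.mem_union_left _ h)).1 h
        · intro h; exact (hcon p (Finset.mem_union_right _ h)).2 h
      obtain ⟨p, hp, hpp⟩ := this
      apply Finset.prod_eq_zero hp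
      rw [← (psv_sum Ω p (hω p (hu p hp))).1]
      refine Finset.sum_congr rfl fun k _ => ?_
      rw [hF]
      by_cases h1 : p ∈ l <;> by_cases h2 : p ∈ l' <;> simp_all
    rw [hz] at fp
    have hq0 : 0 < ∏ p ∈ l ∪ l', p := Finset.prod_pos fun p hp => (hP p (hu p hp)).pos
    have := sum_zero_bound (fun k => ∏ p ∈ l ∪ l', F p k) (∏ p ∈ l ∪ l', p) hq0 (R * R)
      (fun k => by
        rw [← e1 k, abs_mul]
        exact mul_le_mul (hΨabs l hl k) (hΨabs l' hl' k) (abs_nonneg _) (by linarith)) fp.2 a b hab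
    simp only [e1]
    refine this.trans ?_
    have hq : ((∏ p ∈ l ∪ l', p : ℕ) : ℝ) ≤ R * R := by
      have : (∏ p ∈ l ∪ l', p) ≤ (∏ p ∈ l, p) * ∏ p ∈ l', p := by
        rw [← Finset.prod_union_inter]
        exact Nat.le_mul_of_pos_right _ (Finset.prod_pos fun p hp =>
          (hP p (hsub l hl (Finset.mem_inter.1 hp).1)).pos)
      calc ((∏ p ∈ l ∪ l', p : ℕ) : ℝ) ≤ (((∏ p ∈ l, p) * ∏ p ∈ l', p : ℕ) : ℝ) := by
            exact_mod_cast this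
        _ = ((∏ p ∈ l, p : ℕ) : ℝ) * ((∏ p ∈ l', p : ℕ) : ℝ) := by push_cast; ring
        _ ≤ _ := mul_le_mul (hle l hl) (hle l' hl') (by positivity) (by linarith)
    calc _ ≤ (R * R) * (R * R) := mul_le_mul_of_nonneg_right hq (by positivity)
      _ = R ^ 4 := by ring
  have hmain : (((Finset.Ico a b).filter (fun k => ∀ p ∈ P, ¬ Ω p k)).card : ℝ) * L ^ 2 ≤
      ∑ k ∈ Finset.Ico a b, (∑ l ∈ 𝓛, Ψ l k) ^ 2 := by
    calc (((Finset.Ico a b).filter (fun k => ∀ p ∈ P, ¬ Ω p k)).card : ℝ) * L ^ 2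
        = ∑ k ∈ (Finset.Ico a b).filter (fun k => ∀ p ∈ P, ¬ Ω p k), (∑ l ∈ 𝓛, Ψ l k) ^ 2 := by
          rw [← nsmul_eq_mul, ← Finset.sum_const]
          refine Finset.sum_congr rfl fun k hk => ?_
          congr 1
          refine Finset.sum_congr rfl fun l hl => Finset.prod_congr rfl fun p hp => ?_
          unfold psv
          rw [if_neg ((Finset.mem_filter.1 hk).2 p (hsub l hl hp))]
      _ ≤ _ := Finset.sum_le_sum_of_subset_of_nonneg (Finset.filter_subset _ _)
          fun _ _ _ => sq_nonneg _
  have hexp : ∑ k ∈ Finset.Ico a b, (∑ l ∈ 𝓛, Ψ l k) ^ 2 ≤ (N + R) * L + R ^ 6 := by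
    have : ∀ k, (∑ l ∈ 𝓛, Ψ l k) ^ 2 = ∑ l ∈ 𝓛, ∑ l' ∈ 𝓛, Ψ l k * Ψ l' k := by
      intro k; rw [sq, Finset.sum_mul_sum]
    simp only [this]
    rw [Finset.sum_comm]
    calc ∑ l ∈ 𝓛, ∑ k ∈ Finset.Ico a b, ∑ l' ∈ 𝓛, Ψ l k * Ψ l' k
        = ∑ l ∈ 𝓛, ∑ l' ∈ 𝓛, ∑ k ∈ Finset.Ico a b, Ψ l k * Ψ l' k :=
          Finset.sum_congr rfl fun l _ => Finset.sum_comm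
      _ ≤ ∑ l ∈ 𝓛, ∑ l' ∈ 𝓛, ((if l = l' then (N + R) * ∏ p ∈ l, hsv Ω p else 0) + R ^ 4) := by
          refine Finset.sum_le_sum fun l hl => Finset.sum_le_sum fun l' hl' => ?_
          split_ifs with h
          · subst h
            have := hdiag l hl
            have : 0 ≤ R ^ 4 := by positivity
            linarith
          · have := hoff l hl l' hl' h
            linarith
      _ = (N + R) * L + 𝓛.card * 𝓛.card * R ^ 4 := by
          simp only [Finset.sum_add_distrib, Finset.sum_ite_eq, Finset.sum_const, nsmul_eq_mul]
          rw [Finset.sum_ite_mem, Finset.inter_self, ← Finset.mul_sum]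
          ring
      _ ≤ (N + R) * L + R * R * R ^ 4 := by gcongr
      _ = _ := by ring
  set X : ℝ := (((Finset.Ico a b).filter (fun k => ∀ p ∈ P, ¬ Ω p k)).card : ℝ)
  have hR6 : R ≤ R ^ 6 := by
    calc R = R ^ 1 := (pow_one R).symm
      _ ≤ _ := pow_le_pow_right₀ hR (by norm_num)
  have h1 : X * L * L ≤ (N + 2 * R ^ 6) * L := by
    have h6 : R ^ 6 ≤ R ^ 6 * L := le_mul_of_one_le_right (by positivity) hL1
    nlinarith
  exact le_of_mul_le_mul_right h1 (by linarith)

lemma exp_sub_one_le (y : ℝ) (h0 : 0 ≤ y) (h1 : y ≤ 1) : Real.exp y - 1 ≤ 2 * y := by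
  have h := Real.abs_exp_sub_one_sub_id_le (x := y) (by rw [abs_of_nonneg h0]; exact h1)
  have := (abs_le.1 h).2
  nlinarith

lemma hsv_eq (Ω : ℕ → ℤ → Prop) (p : ℕ) (h : omg Ω p < p) :
    1 + hsv Ω p = (1 - (omg Ω p : ℝ) / p)⁻¹ ∧ hsv Ω p = (1 + hsv Ω p) * ((omg Ω p : ℝ) / p) := by
  have h0 : (0:ℝ) < p := by exact_mod_cast (by omega : 0 < p)
  have hpos : (0:ℝ) < p - omg Ω p := by
    rw [sub_pos]; exact_mod_cast h
  have h2 : (1 - (omg Ω p : ℝ) / p) = (p - omg Ω p) / p := by field_simp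
  rw [h2]
  unfold hsv
  constructor
  · field_simp
    ring
  · field_simp
    ring

theorem sieve_final (t : ℝ) (ht : 2 ≤ t) (g : ℕ) (P : Finset ℕ) (hP : P ⊆ primesBelow t)
    (Ω : ℕ → ℤ → Prop)
    (hper : ∀ p ∈ P, ∀ k, Ω p (k + p) ↔ Ω p k) (hω : ∀ p ∈ P, omg Ω p < p)
    (hg : ∀ p ∈ P, omg Ω p ≤ g) (a b : ℤ) (hab : a ≤ b) :
    (((Finset.Ico a b).filter (fun k => ∀ p ∈ P, ¬ Ω p k)).card : ℝ) ≤
      2 * (((b - a : ℤ) : ℝ) + 2 * (t ^ (8 * g + 1)) ^ 6) *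
        ∏ p ∈ P, (1 - (omg Ω p : ℝ) / p) := by
  have hP' : ∀ p ∈ P, p.Prime := fun p hp => (mem_primesBelow.1 (hP hp)).1
  have hPt : ∀ p ∈ P, (p:ℝ) ≤ t := fun p hp => (mem_primesBelow.1 (hP hp)).2
  have hlt : 0.69 < Real.log t := by
    have : Real.log 2 ≤ Real.log t := Real.log_le_log (by norm_num) ht
    have := Real.log_two_gt_d9
    linarith
  set R : ℝ := t ^ (8 * g + 1) with hR
  have hR1 : 1 ≤ R := one_le_pow₀ (by linarith)
  have hs := sieve_basic P hP' Ω hper hω R hR1 a b hab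
  set L := ∑ l ∈ P.powerset.filter (fun l => ((∏ p ∈ l, p : ℕ) : ℝ) ≤ R), ∏ p ∈ l, hsv Ω p with hL
  set H := ∏ p ∈ P, (1 + hsv Ω p) with hH
  have hh0 : ∀ p ∈ P, 0 ≤ hsv Ω p := fun p hp => hsv_nonneg Ω p (hω p hp)
  have hHpos : 0 < H := Finset.prod_pos fun p hp => by have := hh0 p hp; linarith
  set α := (Real.log t)⁻¹ with hα
  have hα0 : 0 < α := by positivity
  have hαt : α * Real.log t = 1 := inv_mul_cancel₀ (by linarith)
  have htot : ∑ l ∈ P.powerset, ∏ p ∈ l, hsv Ω p = H := by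
    rw [hH, Finset.prod_one_add]
  have htail : ∑ l ∈ P.powerset.filter (fun l => ¬ ((∏ p ∈ l, p : ℕ) : ℝ) ≤ R), ∏ p ∈ l, hsv Ω p
      ≤ R ^ (-α) * ∏ p ∈ P, (1 + hsv Ω p * (p:ℝ) ^ α) := by
    rw [Finset.prod_one_add, Finset.mul_sum]
    calc _ ≤ ∑ l ∈ P.powerset.filter (fun l => ¬ ((∏ p ∈ l, p : ℕ) : ℝ) ≤ R),
          R ^ (-α) * ∏ p ∈ l, (hsv Ω p * (p:ℝ) ^ α) := by
          refine Finset.sum_le_sum fun l hl => ?_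
          obtain ⟨hl1, hl2⟩ := Finset.mem_filter.1 hl
          have hl1 := Finset.mem_powerset.1 hl1
          push Not at hl2
          rw [Finset.prod_mul_distrib, Real.finsetProd_rpow _ _ (fun p _ => by positivity)]
          have h0 : 0 ≤ ∏ p ∈ l, hsv Ω p := Finset.prod_nonneg fun p hp => hh0 p (hl1 hp)
          have h1 : 1 ≤ R ^ (-α) * (∏ p ∈ l, (p:ℝ)) ^ α := by
            rw [Real.rpow_neg (by linarith), ← div_eq_inv_mul, ← Real.div_rpow (by positivity) (by linarith)]
            apply Real.one_le_rpow _ hα0.le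
            rw [one_le_div (by linarith)]
            push_cast at hl2
            exact hl2.le
          nlinarith
      _ ≤ _ := by
          apply Finset.sum_le_sum_of_subset_of_nonneg (Finset.filter_subset _ _)
          intro l hl _
          have hl1 := Finset.mem_powerset.1 hl
          apply mul_nonneg (by positivity)
          exact Finset.prod_nonneg fun p hp => mul_nonneg (hh0 p (hl1 hp)) (by positivity)
  have hprod : ∏ p ∈ P, (1 + hsv Ω p * (p:ℝ) ^ α) ≤ H * Real.exp (8 * g) := by
    calc ∏ p ∈ P, (1 + hsv Ω p * (p:ℝ) ^ α)
        ≤ ∏ p ∈ P, ((1 + hsv Ω p) * Real.exp (2 * g * α * (Real.log p / p))) := by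
          apply Finset.prod_le_prod
          · intro p hp
            have := mul_nonneg (hh0 p hp) (by positivity : 0 ≤ (p:ℝ) ^ α)
            linarith
          · intro p hp
            have hpp := hP' p hp
            have hp1 : (1:ℝ) < p := by exact_mod_cast hpp.one_lt
            have hlp : 0 ≤ Real.log p := Real.log_nonneg hp1.le
            have e1 : (p:ℝ) ^ α - 1 ≤ 2 * (Real.log p * α) := by
              rw [Real.rpow_def_of_pos (by linarith)]
              apply exp_sub_one_le _ (by positivity)
              rw [← hαt, mul_comm]
              exact mul_le_mul_of_nonneg_left (Real.log_le_log (by linarith) (hPt p hp)) hα0.le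
            obtain ⟨q1, q2⟩ := hsv_eq Ω p (hω p hp)
            set h := hsv Ω p
            have hh := hh0 p hp
            have hw : (omg Ω p : ℝ) / p ≤ g / p := by
              gcongr
              exact_mod_cast hg p hp
            have hw0 : 0 ≤ (omg Ω p : ℝ) / p := by positivity
            have e2 : (omg Ω p : ℝ) / p * ((p:ℝ) ^ α - 1) ≤ 2 * g * α * (Real.log p / p) := by
              calc (omg Ω p : ℝ) / p * ((p:ℝ) ^ α - 1) ≤ (omg Ω p : ℝ) / p * (2 * (Real.log p * α)) :=
                    mul_le_mul_of_nonneg_left e1 hw0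
                _ ≤ g / p * (2 * (Real.log p * α)) := mul_le_mul_of_nonneg_right hw (by positivity)
                _ = _ := by ring
            have e3 := Real.add_one_le_exp (2 * g * α * (Real.log p / p))
            calc 1 + h * (p:ℝ) ^ α = (1 + h) * (1 + (omg Ω p : ℝ) / p * ((p:ℝ) ^ α - 1)) := by
                  have : h * ((p:ℝ) ^ α - 1) = (1 + h) * ((omg Ω p : ℝ) / p) * ((p:ℝ) ^ α - 1) := by
                    rw [← q2]
                  linarith
              _ ≤ _ := mul_le_mul_of_nonneg_left (by linarith) (by linarith)
      _ = H * Real.exp (∑ p ∈ P, 2 * g * α * (Real.log p / p)) := by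
          rw [Finset.prod_mul_distrib, Real.exp_sum]
      _ ≤ _ := by
          apply mul_le_mul_of_nonneg_left _ hHpos.le
          apply Real.exp_le_exp.2
          rw [← Finset.mul_sum]
          have e1 : ∑ p ∈ P, Real.log p / p ≤ Real.log t + 2 := by
            refine le_trans (Finset.sum_le_sum_of_subset_of_nonneg hP fun p hp _ => ?_)
              (mert t (by linarith))
            have := (mem_primesBelow.1 hp).1
            have hp1 : (1:ℝ) < p := by exact_mod_cast this.one_lt
            exact div_nonneg (Real.log_nonneg hp1.le) (by linarith)
          have e2 : α * (Real.log t + 2) ≤ 4 := by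
            rw [hα, inv_mul_le_iff₀ (by linarith)]
            linarith
          have hg0 : (0:ℝ) ≤ g := by positivity
          calc 2 * g * α * ∑ p ∈ P, Real.log p / p ≤ 2 * g * α * (Real.log t + 2) := by gcongr
            _ = 2 * g * (α * (Real.log t + 2)) := by ring
            _ ≤ 2 * g * 4 := by gcongr
            _ = 8 * g := by ring
  have hRα : R ^ (-α) = Real.exp (-(8 * g + 1)) := by
    rw [hR, Real.rpow_def_of_pos (by positivity), Real.log_pow]
    congr 1
    push_cast
    linear_combination (-(8 * (g:ℝ) + 1)) * hαt
  have hLH : H / 2 ≤ L := by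
    have e1 := Finset.sum_filter_add_sum_filter_not P.powerset
      (fun l => ((∏ p ∈ l, p : ℕ) : ℝ) ≤ R) (fun l => ∏ p ∈ l, hsv Ω p)
    rw [htot] at e1
    have e2 : R ^ (-α) * ∏ p ∈ P, (1 + hsv Ω p * (p:ℝ) ^ α) ≤ H / 2 := by
      calc R ^ (-α) * ∏ p ∈ P, (1 + hsv Ω p * (p:ℝ) ^ α) ≤ R ^ (-α) * (H * Real.exp (8 * g)) :=
            mul_le_mul_of_nonneg_left hprod (by positivity)
        _ = H * Real.exp (-1) := by
            rw [hRα, mul_comm, mul_assoc, ← Real.exp_add]; ring_nf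
        _ ≤ H * (1 / 2) := by
            apply mul_le_mul_of_nonneg_left _ hHpos.le
            have := Real.exp_neg_one_lt_d9
            linarith
        _ = _ := by ring
    linarith
  have hprodinv : ∏ p ∈ P, (1 - (omg Ω p : ℝ) / p) = H⁻¹ := by
    rw [hH, ← Finset.prod_inv_distrib]
    refine Finset.prod_congr rfl fun p hp => ?_
    rw [(hsv_eq Ω p (hω p hp)).1, inv_inv]
  rw [hprodinv, ← div_eq_mul_inv, le_div_iff₀ hHpos]
  have : (((Finset.Ico a b).filter (fun k => ∀ p ∈ P, ¬ Ω p k)).card : ℝ) * (H / 2) ≤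
      (((Finset.Ico a b).filter (fun k => ∀ p ∈ P, ¬ Ω p k)).card : ℝ) * L :=
    mul_le_mul_of_nonneg_left hLH (by positivity)
  linarith

lemma hit_card (p : ℕ) (hp : p.Prime) (Q : Polynomial ℤ) (g : ℕ) (hdeg : Q.natDegree ≤ g)
    (n0 : ℤ) (hn0 : ¬ (p:ℤ) ∣ Q.eval n0) (m N : ℕ) (hmN : g * (m - 1) < N)
    (A : Finset ℤ) (hA : ∀ n ∈ A, (p:ℤ) ^ N ∣ Q.eval n)
    (hdist : ∀ a ∈ A, ∀ b ∈ A, (p:ℤ) ^ m ∣ a - b → a = b) : A.card ≤ g := by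
  have := Fact.mk hp
  by_contra hcon
  push Not at hcon
  obtain ⟨B, hBA, hB⟩ := Finset.exists_subset_card_eq (Nat.succ_le_of_lt hcon)
  apply hn0
  have hinj : Set.InjOn (fun a : ℤ => (a:ℚ)) (B : Set ℤ) := fun a _ b _ h => by
    simpa using h
  set F : Polynomial ℚ := Q.map (Int.castRingHom ℚ) with hF
  have hFe : ∀ a : ℤ, F.eval (a:ℚ) = ((Q.eval a : ℤ) : ℚ) := by
    intro a
    rw [hF, Polynomial.eval_intCast_map]; rfl
  have hFd : F.degree < B.card := by
    refine lt_of_le_of_lt (Polynomial.degree_map_le) ?_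
    refine lt_of_le_of_lt Polynomial.degree_le_natDegree ?_
    rw [hB]
    exact_mod_cast Nat.lt_succ_of_le hdeg
  have hIntg := Lagrange.eq_interpolate hinj hFd
  have hval : ((Q.eval n0 : ℤ) : ℚ) = ∑ i ∈ B, ((Q.eval i : ℤ) : ℚ) *
      ∏ j ∈ B.erase i, (((i:ℚ) - j)⁻¹ * ((n0:ℚ) - j)) := by
    rw [← hFe n0]
    conv_lhs => rw [hIntg]
    rw [Lagrange.interpolate_apply, Polynomial.eval_finsetSum]
    refine Finset.sum_congr rfl fun i _ => ?_
    rw [Polynomial.eval_mul, Polynomial.eval_C, hFe i, Lagrange.basis, Polynomial.eval_prod]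
    congr 1
    refine Finset.prod_congr rfl fun j _ => ?_
    simp [Lagrange.basisDivisor]
  have hp1 : (1:ℚ) < p := by exact_mod_cast hp.one_lt
  have hp0 : (0:ℚ) < p := by linarith
  rw [← padicNorm.int_lt_one_iff, hval]
  apply padicNorm.sum_lt' _ (by norm_num)
  intro i hi
  rw [padicNorm.mul]
  have h1 : padicNorm p ((Q.eval i : ℤ) : ℚ) ≤ (p:ℚ) ^ (-(N:ℤ)) :=
    padicNorm.dvd_iff_norm_le.1 (by exact_mod_cast hA i (hBA hi))
  have h2 : padicNorm p (∏ j ∈ B.erase i, (((i:ℚ) - j)⁻¹ * ((n0:ℚ) - j))) ≤ (p:ℚ) ^ (g * (m - 1)) := by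
    have hpr : padicNorm p (∏ j ∈ B.erase i, (((i:ℚ) - j)⁻¹ * ((n0:ℚ) - j))) =
        ∏ j ∈ B.erase i, padicNorm p (((i:ℚ) - j)⁻¹ * ((n0:ℚ) - j)) := by
      induction (B.erase i) using Finset.induction_on with
      | empty => simp
      | insert a s ha ih => rw [Finset.prod_insert ha, Finset.prod_insert ha, padicNorm.mul, ih]
    rw [hpr]
    calc ∏ j ∈ B.erase i, padicNorm p (((i:ℚ) - j)⁻¹ * ((n0:ℚ) - j))
        ≤ ∏ j ∈ B.erase i, (p:ℚ) ^ (m - 1) := by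
          apply Finset.prod_le_prod (fun j _ => padicNorm.nonneg _)
          intro j hj
          obtain ⟨hji, hj⟩ := Finset.mem_erase.1 hj
          rw [padicNorm.mul]
          have e1 : padicNorm p ((n0:ℚ) - j) ≤ 1 := by
            have := padicNorm.of_int (p := p) (n0 - j)
            push_cast at this
            exact this
          have e2 : padicNorm p (((i:ℚ) - j)⁻¹) ≤ (p:ℚ) ^ (m - 1) := by
            have hnd : ¬ ((p ^ m : ℕ) : ℤ) ∣ i - j := by
              intro h
              push_cast at h
              exact hji (hdist i (hBA hi) j (hBA hj) h).symm
            rw [padicNorm.dvd_iff_norm_le] at hnd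
            push Not at hnd
            have hne : (i:ℚ) - j ≠ 0 := by
              rw [sub_ne_zero]; exact_mod_cast hji.symm
            push_cast at hnd
            have hinv : padicNorm p (((i:ℚ) - j)⁻¹) = (padicNorm p ((i:ℚ) - j))⁻¹ := by
              have := padicNorm.div (p := p) 1 ((i:ℚ) - j)
              simpa using this
            rw [hinv]
            obtain ⟨z, hz⟩ := padicNorm.values_discrete (p := p) hne
            rw [hz] at hnd ⊢
            rw [← zpow_neg]
            have := (zpow_lt_zpow_iff_right₀ hp1).1 hnd
            rw [← zpow_natCast, neg_neg]
            apply zpow_le_zpow_right₀ hp1.le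
            omega
          calc _ ≤ (p:ℚ) ^ (m - 1) * 1 := mul_le_mul e2 e1 (padicNorm.nonneg _) (by positivity)
            _ = _ := mul_one _
      _ = _ := by
          rw [Finset.prod_const, Finset.card_erase_of_mem hi, hB, Nat.succ_sub_one, ← pow_mul, mul_comm]
  calc _ ≤ (p:ℚ) ^ (-(N:ℤ)) * (p:ℚ) ^ (g * (m - 1)) :=
        mul_le_mul h1 h2 (padicNorm.nonneg _) (by positivity)
    _ < 1 := by
        rw [zpow_neg, zpow_natCast, inv_mul_lt_iff₀ (by positivity), mul_one]
        exact pow_lt_pow_right₀ hp1 hmN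

/-- counting integers via residues -/
lemma res_card (q : ℕ) (hq : 0 < q) (c : ℕ) (G : ℤ → Prop) (hG : ∀ A : Finset ℤ, (∀ n ∈ A, G n) →
    (∀ a ∈ A, ∀ b ∈ A, (q:ℤ) ∣ a - b → a = b) → A.card ≤ c) (a b : ℤ) (hab : a ≤ b) :
    (((Finset.Ico a b).filter G).card : ℝ) ≤ (((b - a : ℤ):ℝ) / q + 1) * c := by
  set s := (Finset.Ico a b).filter G
  have hq' : (q:ℤ) ≠ 0 := by omega
  have himg : (s.image (fun n : ℤ => n % q)).card ≤ c := by
    have : ∀ y ∈ s.image (fun n : ℤ => n % q), ∃ n ∈ s, n % q = y := fun y hy => by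
      simpa using hy
    choose! e he1 he2 using this
    have hc : ((s.image (fun n : ℤ => n % q)).image e).card = (s.image (fun n : ℤ => n % q)).card := by
      apply Finset.card_image_of_injOn
      intro y hy y' hy' h
      rw [← he2 y hy, ← he2 y' hy', h]
    rw [← hc]
    apply hG
    · intro n hn
      obtain ⟨y, hy, rfl⟩ := Finset.mem_image.1 hn
      exact (Finset.mem_filter.1 (he1 y hy)).2
    · intro n hn n' hn' h
      obtain ⟨y, hy, rfl⟩ := Finset.mem_image.1 hn
      obtain ⟨y', hy', rfl⟩ := Finset.mem_image.1 hn'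
      have : e y % q = e y' % q := (Int.ModEq.symm ((Int.modEq_iff_dvd).2 h))
      rw [he2 y hy, he2 y' hy'] at this
      rw [this]
  have hfib : ∀ y ∈ s.image (fun n : ℤ => n % q), ((s.filter (fun n => n % q = y)).card : ℝ) ≤
      (((b - a : ℤ):ℝ) / q + 1) := by
    intro y _
    have hsub : s.filter (fun n => n % q = y) ⊆ (Finset.Ico a b).filter (fun n => n % q = y) :=
      Finset.filter_subset_filter _ (Finset.filter_subset _ _)
    refine le_trans (Nat.cast_le.2 (Finset.card_le_card hsub)) ?_
    have := sum_upper (fun n => if n % q = y % q then 1 else 0) q hq 1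
      (fun n => by positivity) ?_ a b hab
    · refine le_trans ?_ (this.trans_eq (mul_one _))
      rw [Finset.sum_boole]
      apply Nat.cast_le.2
      apply Finset.card_le_card
      apply Finset.monotone_filter_right
      intro n _ hn
      rw [← hn, Int.emod_emod_of_dvd _ (dvd_refl _)]
    · intro a'
      have := full_two q 1 hq one_pos (Nat.coprime_one_right q)
        (fun n => if n % q = y % q then 1 else 0) (fun _ => 1) (fun k => by simp) (fun _ => rfl) a'
      simp only [mul_one] at this
      rw [this]
      have h2 : ∑ k ∈ Finset.Ico (0:ℤ) q, (if k % q = y % q then (1:ℝ) else 0) = 1 := by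
        rw [Finset.sum_eq_single (y % q)]
        · rw [if_pos (Int.emod_emod_of_dvd _ (dvd_refl _))]
        · intro k hk hne
          rw [Finset.mem_Ico] at hk
          rw [if_neg]
          rw [Int.emod_eq_of_lt hk.1 hk.2]
          exact hne
        · intro h
          exact absurd (Finset.mem_Ico.2 ⟨Int.emod_nonneg _ hq', Int.emod_lt_of_pos _ (by omega)⟩) h
      rw [h2]; simp
  rw [Finset.card_eq_sum_card_image (fun n : ℤ => n % q) s]
  rw [Nat.cast_sum]
  calc _ ≤ ∑ y ∈ s.image (fun n : ℤ => n % q), (((b - a : ℤ):ℝ) / q + 1) := Finset.sum_le_sum hfib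
    _ = (s.image (fun n : ℤ => n % q)).card * (((b - a : ℤ):ℝ) / q + 1) := by
        rw [Finset.sum_const, nsmul_eq_mul]
    _ ≤ _ := by
        rw [mul_comm]
        apply mul_le_mul_of_nonneg_left (by exact_mod_cast himg)
        have : (0:ℝ) ≤ ((b - a : ℤ):ℝ) := by exact_mod_cast sub_nonneg.2 hab
        positivity

lemma rho_eq (Q : Polynomial ℤ) (m : ℕ) :
    rho Q m = ((Finset.Ico (0:ℤ) m).filter (fun n => (m:ℤ) ∣ Q.eval n)).card := by
  unfold rho
  congr 1
  ext n
  simp only [Finset.mem_filter, Finset.bind_def, Finset.pure_def, Finset.mem_Ico, Finset.mem_sup,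
    Finset.mem_singleton, Finset.mem_range]
  constructor
  · rintro ⟨⟨a, ha, rfl⟩, h⟩
    exact ⟨⟨by omega, by omega⟩, h⟩
  · rintro ⟨⟨h1, h2⟩, h⟩
    exact ⟨⟨n.toNat, by omega, by omega⟩, h⟩

lemma exists_nondiv (Q : Polynomial ℤ) (p : ℕ) (h : rho Q p < p) :
    ∃ n0 : ℤ, ¬ (p:ℤ) ∣ Q.eval n0 := by
  by_contra hcon
  push Not at hcon
  rw [rho_eq, Finset.filter_true_of_mem (fun n _ => hcon n), Int.card_Ico] at h
  omega

lemma rho_le_deg (Q : Polynomial ℤ) (p : ℕ) (hp : p.Prime) (h : rho Q p < p) :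
    rho Q p ≤ Q.natDegree := by
  obtain ⟨n0, hn0⟩ := exists_nondiv Q p h
  rw [rho_eq]
  apply hit_card p hp Q _ le_rfl n0 hn0 1 1 (by simp)
  · intro n hn; rw [pow_one]; exact (Finset.mem_filter.1 hn).2
  · intro a ha b hb hab
    rw [pow_one] at hab
    have ha := Finset.mem_Ico.1 (Finset.mem_filter.1 ha).1
    have hb := Finset.mem_Ico.1 (Finset.mem_filter.1 hb).1
    have := Int.eq_zero_of_abs_lt_dvd hab (by rw [abs_lt]; omega)
    omega

lemma dens (Q : Polynomial ℤ) (g : ℕ) (hdeg : Q.natDegree ≤ g) (p : ℕ) (hp : p.Prime)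
    (h : rho Q p < p) (m N : ℕ) (hmN : g * (m - 1) < N) (a b : ℤ) (hab : a ≤ b) :
    (((Finset.Ico a b).filter (fun n => (p:ℤ) ^ N ∣ Q.eval n)).card : ℝ) ≤
      (((b - a : ℤ):ℝ) / (p:ℝ) ^ m + 1) * g := by
  obtain ⟨n0, hn0⟩ := exists_nondiv Q p h
  have := res_card (p ^ m) (pow_pos hp.pos m) g (fun n => (p:ℤ) ^ N ∣ Q.eval n) ?_ a b hab
  · push_cast at this ⊢
    convert this
  · intro A hA hd
    push_cast at hd
    exact hit_card p hp Q g hdeg n0 hn0 m N hmN A hA hd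

lemma rho_pow_le (Q : Polynomial ℤ) (g : ℕ) (hdeg : Q.natDegree ≤ g) (p : ℕ) (hp : p.Prime)
    (h : rho Q p < p) (m N : ℕ) (hmN : g * (m - 1) < N) (hm : m ≤ N) :
    (rho Q (p ^ N) : ℝ) ≤ 2 * g * ((p:ℝ) ^ N / (p:ℝ) ^ m) := by
  have := dens Q g hdeg p hp h m N hmN 0 ((p ^ N : ℕ) : ℤ) (by positivity)
  rw [rho_eq]
  push_cast at this ⊢
  refine this.trans ?_
  have hp1 : (1:ℝ) ≤ p := by exact_mod_cast hp.one_lt.le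
  have : 1 ≤ (p:ℝ) ^ N / (p:ℝ) ^ m := by
    rw [one_le_div (by positivity)]
    exact pow_le_pow_right₀ hp1 hm
  have hg : (0:ℝ) ≤ g := by positivity
  simp only [sub_zero]
  nlinarith

lemma hensel (Q : Polynomial ℤ) (p : ℕ) (hp : p.Prime) (N : ℕ) (hN : 1 ≤ N)
    (hD : ∀ n : ℤ, (p:ℤ) ∣ Q.eval n → ¬ (p:ℤ) ∣ (Polynomial.derivative Q).eval n) :
    rho Q (p ^ N) ≤ rho Q p := by
  rw [rho_eq, rho_eq]
  have hp0 : (p:ℤ) ≠ 0 := by exact_mod_cast hp.ne_zero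
  have hmod : ∀ n : ℤ, (p:ℤ) ∣ Q.eval n → (p:ℤ) ∣ Q.eval (n % p) := by
    intro n hn
    have h1 : n % p - n ∣ Q.eval (n % p) - Q.eval n := Polynomial.sub_dvd_eval_sub _ _ _
    have h2 : (p:ℤ) ∣ n % p - n := by
      rw [Int.emod_def]; exact ⟨-(n / p), by ring⟩
    exact (dvd_sub_left hn).1 (h2.trans h1)
  have hpN : ∀ n : ℤ, ((p ^ N : ℕ) : ℤ) ∣ Q.eval n → (p:ℤ) ∣ Q.eval n := fun n hn =>
    (by exact_mod_cast dvd_pow_self p (by omega) : (p:ℤ) ∣ ((p ^ N : ℕ) : ℤ)).trans hn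
  apply Finset.card_le_card_of_injOn (fun n : ℤ => n % (p:ℤ))
  · intro n hn
    have hn := (Finset.mem_filter.1 (Finset.mem_coe.1 hn)).2
    apply Finset.mem_coe.2
    apply Finset.mem_filter.2
    exact ⟨Finset.mem_Ico.2 ⟨Int.emod_nonneg _ hp0, Int.emod_lt_of_pos _ (by have := hp.pos; omega)⟩,
      hmod n (hpN n hn)⟩
  · intro n hn n' hn' hnn
    have h1 := Finset.mem_filter.1 (Finset.mem_coe.1 hn)
    have h2 := Finset.mem_filter.1 (Finset.mem_coe.1 hn')
    have hh : (p:ℤ) ∣ n' - n := (Int.modEq_iff_dvd).1 hnn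
    obtain ⟨k, hk⟩ := Polynomial.binomExpansion Q n (n' - n)
    rw [add_sub_cancel] at hk
    have hd : ((p ^ N : ℕ) : ℤ) ∣ (n' - n) * ((Polynomial.derivative Q).eval n + k * (n' - n)) := by
      have : (n' - n) * ((Polynomial.derivative Q).eval n + k * (n' - n)) = Q.eval n' - Q.eval n := by
        rw [hk]; ring
      rw [this]
      exact dvd_sub h2.2 h1.2
    have hcop : IsCoprime ((p ^ N : ℕ) : ℤ) ((Polynomial.derivative Q).eval n + k * (n' - n)) := by
      push_cast
      apply IsCoprime.pow_left
      rw [(Nat.prime_iff_prime_int.1 hp).coprime_iff_not_dvd]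
      intro h
      exact hD n (hpN n h1.2) ((dvd_add_left (hh.mul_left k)).1 h)
    have h3 := hcop.dvd_of_dvd_mul_right hd
    have r1 := Finset.mem_Ico.1 h1.1
    have r2 := Finset.mem_Ico.1 h2.1
    have := Int.eq_zero_of_abs_lt_dvd h3 (by rw [abs_lt]; omega)
    omega

/-- local solution count of a state at `p` -/
noncomputable def locc {r : ℕ} (Qs : Fin r → Polynomial ℤ) (p : ℕ) (ν : Fin r → ℕ) : ℕ :=
  ((Finset.Ico (0:ℤ) ((p ^ (∑ j, ν j) : ℕ) : ℤ)).filter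
    (fun n => ∀ j, ((p ^ ν j : ℕ) : ℤ) ∣ (Qs j).eval n)).card

lemma locc_zero {r : ℕ} (Qs : Fin r → Polynomial ℤ) (p : ℕ) : locc Qs p 0 = 1 := by
  simp [locc, show Finset.Ico (0:ℤ) 1 = {0} from rfl]

lemma locc_le_rho {r : ℕ} (Qs : Fin r → Polynomial ℤ) (p : ℕ) (ν : Fin r → ℕ) :
    locc Qs p ν ≤ rho (∏ j, Qs j) (p ^ (∑ j, ν j)) := by
  rw [rho_eq]
  apply Finset.card_le_card
  apply Finset.monotone_filter_right
  intro n _ hn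
  rw [Polynomial.eval_prod, ← Finset.prod_pow_eq_pow_sum]
  push_cast
  exact Finset.prod_dvd_prod_of_dvd _ _ (fun j _ => by have := hn j; push_cast at this; exact this)

lemma locc_single {r : ℕ} (Qs : Fin r → Polynomial ℤ) (p : ℕ) (j : Fin r) :
    locc Qs p (Pi.single j 1) ≤ rho (Qs j) p := by
  rw [rho_eq, locc]
  have : ∑ i, (Pi.single j 1 : Fin r → ℕ) i = 1 := by simp
  rw [this, pow_one]
  apply Finset.card_le_card
  apply Finset.monotone_filter_right
  intro n _ hn
  have := hn j
  simpa using this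

lemma rho_j_le {r : ℕ} (Qs : Fin r → Polynomial ℤ) (p : ℕ) (j : Fin r) :
    rho (Qs j) p ≤ rho (∏ j, Qs j) p := by
  rw [rho_eq, rho_eq]
  apply Finset.card_le_card
  apply Finset.monotone_filter_right
  intro n _ hn
  rw [Polynomial.eval_prod]
  exact hn.trans (Finset.dvd_prod_of_mem _ (Finset.mem_univ j))

lemma rho_sum_le {r : ℕ} (Qs : Fin r → Polynomial ℤ) (p : ℕ)
    (h : ∀ i j : Fin r, i ≠ j → ∀ n : ℤ, ¬ ((p:ℤ) ∣ (Qs i).eval n ∧ (p:ℤ) ∣ (Qs j).eval n)) :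
    ∑ j, rho (Qs j) p ≤ rho (∏ j, Qs j) p := by
  simp only [rho_eq]
  rw [← Finset.card_biUnion]
  · apply Finset.card_le_card
    intro n hn
    obtain ⟨j, _, hj⟩ := Finset.mem_biUnion.1 hn
    rw [Finset.mem_filter] at hj ⊢
    refine ⟨hj.1, ?_⟩
    rw [Polynomial.eval_prod]
    exact hj.2.trans (Finset.dvd_prod_of_mem _ (Finset.mem_univ j))
  · intro i _ j _ hij
    rw [Function.onFun, Finset.disjoint_left]
    intro n hi hj
    exact h i j hij n ⟨(Finset.mem_filter.1 hi).2, (Finset.mem_filter.1 hj).2⟩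

lemma locc_eq_zero {r : ℕ} (Qs : Fin r → Polynomial ℤ) (p : ℕ) (hp : p.Prime) (ν : Fin r → ℕ)
    (h : rho (∏ j, Qs j) p = 0) (hν : ν ≠ 0) : locc Qs p ν = 0 := by
  have hnone : ∀ n : ℤ, ¬ (p:ℤ) ∣ (∏ j, Qs j).eval n := by
    intro n hn
    rw [rho_eq, Finset.card_eq_zero] at h
    have hp0 : (p:ℤ) ≠ 0 := by exact_mod_cast hp.ne_zero
    have h1 : n % p - n ∣ (∏ j, Qs j).eval (n % p) - (∏ j, Qs j).eval n :=
      Polynomial.sub_dvd_eval_sub _ _ _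
    have h2 : (p:ℤ) ∣ n % p - n := by
      rw [Int.emod_def]; exact ⟨-(n / p), by ring⟩
    have h3 := (dvd_sub_left hn).1 (h2.trans h1)
    have : n % p ∈ (Finset.Ico (0:ℤ) p).filter (fun n => (p:ℤ) ∣ (∏ j, Qs j).eval n) :=
      Finset.mem_filter.2 ⟨Finset.mem_Ico.2 ⟨Int.emod_nonneg _ hp0,
        Int.emod_lt_of_pos _ (by have := hp.pos; omega)⟩, h3⟩
    rw [h] at this
    simp at this
  obtain ⟨j, hj⟩ : ∃ j, ν j ≠ 0 := by
    by_contra hcon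
    push Not at hcon
    exact hν (funext hcon)
  rw [locc, Finset.card_eq_zero, Finset.filter_eq_empty_iff]
  intro n _ hn
  apply hnone n
  rw [Polynomial.eval_prod]
  refine Dvd.dvd.trans ?_ ((hn j).trans (Finset.dvd_prod_of_mem _ (Finset.mem_univ j)))
  exact_mod_cast dvd_pow_self p hj

noncomputable def tht (g : ℕ) : ℝ := (2:ℝ) ^ (-(1 / (4 * g : ℝ)))

lemma tht_pos (g : ℕ) : 0 < tht g := by unfold tht; positivity

lemma tht_lt (g : ℕ) (hg : 1 ≤ g) : tht g < 1 := by
  unfold tht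
  apply Real.rpow_lt_one_of_one_lt_of_neg (by norm_num)
  have : (1:ℝ) ≤ g := by exact_mod_cast hg
  have : 0 < 1 / (4 * g : ℝ) := by positivity
  linarith

lemma tht_pow (g N : ℕ) : tht g ^ N = (2:ℝ) ^ (-(N / (4 * g : ℝ))) := by
  unfold tht
  rw [← Real.rpow_natCast, ← Real.rpow_mul (by norm_num)]
  congr 1
  ring

lemma tilt_bad (g : ℕ) (hg : 1 ≤ g) (p : ℕ) (hp : 2 ≤ p) (κ σ : ℝ) (hκ0 : 0 ≤ κ) (hσ0 : 0 ≤ σ)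
    (hσ : σ * (4 * g) ≤ 1) (hκ : (p:ℝ) ^ σ ≤ Real.exp κ) (m N : ℕ) (hN : N ≤ g * m) (hm : 1 ≤ m) :
    (p:ℝ) ^ (σ * N) / (p:ℝ) ^ m ≤ 2 * Real.exp (κ * g) / p * tht g ^ N := by
  have hp2 : (2:ℝ) ≤ p := by exact_mod_cast hp
  have hp0 : (0:ℝ) < p := by linarith
  have hg1 : (1:ℝ) ≤ g := by exact_mod_cast hg
  have hN' : (N:ℝ) ≤ g * m := by exact_mod_cast hN
  have hm' : (1:ℝ) ≤ m := by exact_mod_cast hm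
  have hdiv : (N:ℝ) / (4 * g) ≤ m / 4 := by
    rw [div_le_div_iff₀ (by positivity) (by norm_num)]; nlinarith
  rw [tht_pow]
  rcases Nat.lt_or_ge m 2 with h | h
  · have hm1 : m = 1 := by omega
    subst hm1
    rw [pow_one]
    have e1 : (p:ℝ) ^ (σ * N) ≤ Real.exp (κ * g) := by
      rw [Real.rpow_mul hp0.le, Real.exp_mul]
      calc ((p:ℝ) ^ σ) ^ (N:ℝ) ≤ (Real.exp κ) ^ (N:ℝ) :=
            Real.rpow_le_rpow (by positivity) hκ (by positivity)
        _ ≤ _ := Real.rpow_le_rpow_of_exponent_le (Real.one_le_exp hκ0) (by simpa using hN')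
    have e2 : (1:ℝ) ≤ 2 * (2:ℝ) ^ (-(N / (4 * g : ℝ))) := by
      have : (2:ℝ) ^ (-(1:ℝ)) ≤ (2:ℝ) ^ (-(N / (4 * g : ℝ))) := by
        apply Real.rpow_le_rpow_of_exponent_le (by norm_num)
        push_cast at hdiv
        linarith
      rw [Real.rpow_neg_one] at this
      linarith
    calc (p:ℝ) ^ (σ * N) / p ≤ Real.exp (κ * g) / p := by gcongr
      _ ≤ Real.exp (κ * g) / p * (2 * (2:ℝ) ^ (-(N / (4 * g : ℝ)))) :=
          le_mul_of_one_le_right (by positivity) e2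
      _ = _ := by ring
  · have hm2 : (2:ℝ) ≤ m := by exact_mod_cast h
    have e1 : (p:ℝ) ^ (σ * N) / (p:ℝ) ^ m ≤ (p:ℝ) ^ (-1 + -((m:ℝ) / 4)) := by
      rw [← Real.rpow_natCast (p:ℝ) m, ← Real.rpow_sub hp0]
      apply Real.rpow_le_rpow_of_exponent_le (by linarith)
      have : σ * N ≤ m / 4 := by
        calc σ * N ≤ σ * (g * m) := by gcongr
          _ = (σ * (4 * g)) * (m / 4) := by ring
          _ ≤ 1 * (m / 4) := by gcongr
          _ = _ := one_mul _
      linarith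
    have e2 : (p:ℝ) ^ (-((m:ℝ) / 4)) ≤ (2:ℝ) ^ (-(N / (4 * g : ℝ))) := by
      calc (p:ℝ) ^ (-((m:ℝ) / 4)) ≤ (2:ℝ) ^ (-((m:ℝ) / 4)) :=
            Real.rpow_le_rpow_of_nonpos (by norm_num) hp2 (by linarith)
        _ ≤ _ := Real.rpow_le_rpow_of_exponent_le (by norm_num) (by linarith)
    rw [Real.rpow_add hp0, Real.rpow_neg_one] at e1
    have e3 : (1:ℝ) ≤ 2 * Real.exp (κ * g) := by
      have := Real.one_le_exp (by positivity : 0 ≤ κ * g)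
      linarith
    calc _ ≤ (p:ℝ)⁻¹ * (p:ℝ) ^ (-((m:ℝ) / 4)) := e1
      _ ≤ (p:ℝ)⁻¹ * (2:ℝ) ^ (-(N / (4 * g : ℝ))) := by gcongr
      _ ≤ (2 * Real.exp (κ * g)) * ((p:ℝ)⁻¹ * (2:ℝ) ^ (-(N / (4 * g : ℝ)))) :=
          le_mul_of_one_le_left (by positivity) e3
      _ = _ := by ring

lemma tilt_good (g : ℕ) (hg : 1 ≤ g) (p : ℕ) (hp : 2 ≤ p) (σ : ℝ)
    (hσ : σ * (4 * g) ≤ 1) (N : ℕ) (hN : 2 ≤ N) :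
    (p:ℝ) ^ (σ * N) / (p:ℝ) ^ N ≤ 2 * (p:ℝ) ^ (-(3 / 2) : ℝ) * tht g ^ N := by
  have hp2 : (2:ℝ) ≤ p := by exact_mod_cast hp
  have hp0 : (0:ℝ) < p := by linarith
  have hg1 : (1:ℝ) ≤ g := by exact_mod_cast hg
  have hN' : (2:ℝ) ≤ N := by exact_mod_cast hN
  rw [tht_pow]
  have hσ' : σ ≤ 1 / 4 := by
    by_contra h; push Not at h; nlinarith
  have hdiv : (N:ℝ) / (4 * g) ≤ N / 4 := by
    apply div_le_div_of_nonneg_left (by positivity) (by norm_num); linarith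
  have e1 : (p:ℝ) ^ (σ * N) / (p:ℝ) ^ N ≤ (p:ℝ) ^ (-(3 / 2) + -(((N:ℝ) - 2) / 4)) := by
    rw [← Real.rpow_natCast (p:ℝ) N, ← Real.rpow_sub hp0]
    apply Real.rpow_le_rpow_of_exponent_le (by linarith)
    nlinarith
  have e2 : (p:ℝ) ^ (-(((N:ℝ) - 2) / 4)) ≤ 2 * (2:ℝ) ^ (-(N / (4 * g : ℝ))) := by
    calc (p:ℝ) ^ (-(((N:ℝ) - 2) / 4)) ≤ (2:ℝ) ^ (-(((N:ℝ) - 2) / 4)) :=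
          Real.rpow_le_rpow_of_nonpos (by norm_num) hp2 (by linarith)
      _ ≤ (2:ℝ) ^ (1 + -(N / (4 * g : ℝ))) :=
          Real.rpow_le_rpow_of_exponent_le (by norm_num) (by linarith)
      _ = _ := by rw [Real.rpow_add (by norm_num), Real.rpow_one]
  rw [Real.rpow_add hp0] at e1
  calc _ ≤ _ := e1
    _ ≤ (p:ℝ) ^ (-(3 / 2) : ℝ) * (2 * (2:ℝ) ^ (-(N / (4 * g : ℝ)))) := by gcongr
    _ = _ := by ring

/-- bundled arithmetic hypotheses -/
structure Setup {r : ℕ} (g : ℕ) (Qs : Fin r → Polynomial ℤ) (D : ℤ) : Prop where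
  hg : 1 ≤ g
  deg : (∏ j, Qs j).natDegree = g
  nofix : ∀ p : ℕ, p.Prime → rho (∏ j, Qs j) p < p
  D0 : D ≠ 0
  simple : ∀ p : ℕ, p.Prime → ¬ (p:ℤ) ∣ D → ∀ n : ℤ, (p:ℤ) ∣ (∏ j, Qs j).eval n →
    ¬ (p:ℤ) ∣ (Polynomial.derivative (∏ j, Qs j)).eval n
  copr : ∀ p : ℕ, p.Prime → ¬ (p:ℤ) ∣ D → ∀ i j : Fin r, i ≠ j → ∀ n : ℤ,
    ¬ ((p:ℤ) ∣ (Qs i).eval n ∧ (p:ℤ) ∣ (Qs j).eval n)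

/-- rho of the product over p -/
noncomputable def rq {r : ℕ} (Qs : Fin r → Polynomial ℤ) (p : ℕ) : ℝ :=
  (rho (∏ j, Qs j) p : ℝ) / p

noncomputable def hq {r : ℕ} (Qs : Fin r → Polynomial ℤ) (p : ℕ) : ℝ := (1 - rq Qs p)⁻¹

noncomputable def Wt {r : ℕ} (Qs : Fin r → Polynomial ℤ) (σ : ℝ) (p : ℕ) (ν : Fin r → ℕ) : ℝ :=
  if ν = 0 then 1 else
    (locc Qs p ν : ℝ) / (p:ℝ) ^ (∑ j, ν j) * (p:ℝ) ^ (σ * ((∑ j, ν j : ℕ) : ℝ)) * hq Qs p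

namespace Setup
variable {r g : ℕ} {Qs : Fin r → Polynomial ℤ} {D : ℤ}

lemma g1 (h : Setup g Qs D) : (1:ℝ) ≤ g := by exact_mod_cast h.hg

lemma rho_le (h : Setup g Qs D) {p : ℕ} (hp : p.Prime) : rho (∏ j, Qs j) p ≤ g :=
  h.deg ▸ rho_le_deg _ p hp (h.nofix p hp)

lemma rq_nonneg (p : ℕ) : 0 ≤ rq Qs p := by unfold rq; positivity

lemma rq_lt (h : Setup g Qs D) {p : ℕ} (hp : p.Prime) : rq Qs p < 1 := by
  unfold rq
  have : (0:ℝ) < p := by exact_mod_cast hp.pos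
  rw [div_lt_one this]
  exact_mod_cast h.nofix p hp

lemma rq_le (h : Setup g Qs D) {p : ℕ} (hp : p.Prime) : rq Qs p ≤ g / p := by
  unfold rq
  gcongr
  exact_mod_cast h.rho_le hp

lemma rqj_le (p : ℕ) (j : Fin r) : (rho (Qs j) p : ℝ) / p ≤ rq Qs p := by
  unfold rq
  gcongr
  exact rho_j_le Qs p j

lemma hq_ge (h : Setup g Qs D) {p : ℕ} (hp : p.Prime) : 1 ≤ hq Qs p := by
  unfold hq
  rw [one_le_inv₀ (by linarith [h.rq_lt hp])]
  linarith [rq_nonneg (Qs := Qs) p]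

lemma hq_exp (h : Setup g Qs D) {p : ℕ} (hp : p.Prime) : Real.exp (rq Qs p) ≤ hq Qs p := by
  unfold hq
  rw [← neg_neg (rq Qs p), Real.exp_neg, neg_neg]
  apply inv_anti₀ (by linarith [h.rq_lt hp])
  have := Real.add_one_le_exp (-rq Qs p)
  linarith

lemma hq_le (h : Setup g Qs D) {p : ℕ} (hp : p.Prime) : hq Qs p ≤ 2 * g := by
  unfold hq
  have hg := h.g1
  have hp0 : (0:ℝ) < p := by exact_mod_cast hp.pos
  apply inv_le_of_inv_le₀ (by linarith)
  rcases le_or_gt (p:ℝ) (2 * g) with h1 | h1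
  · have : (1:ℝ) / p ≤ 1 - rq Qs p := by
      have : (rho (∏ j, Qs j) p : ℝ) + 1 ≤ p := by exact_mod_cast h.nofix p hp
      unfold rq
      rw [le_sub_iff_add_le, ← add_div, div_le_one hp0]
      linarith
    refine le_trans ?_ this
    rw [one_div]
    exact inv_anti₀ hp0 h1
  · have e1 : rq Qs p ≤ 1 / 2 := by
      refine (h.rq_le hp).trans ?_
      rw [div_le_iff₀ hp0]; linarith
    have e2 : (2 * (g:ℝ))⁻¹ ≤ 2⁻¹ := inv_anti₀ (by norm_num) (by linarith)
    norm_num at e2 ⊢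
    linarith

lemma hq_eq (h : Setup g Qs D) {p : ℕ} (hp : p.Prime) : hq Qs p = 1 + rq Qs p * hq Qs p := by
  unfold hq
  have := h.rq_lt hp
  have : (1 - rq Qs p) ≠ 0 := by linarith
  field_simp
  ring

lemma Wt_nonneg (h : Setup g Qs D) {p : ℕ} (hp : p.Prime) (σ : ℝ) (ν : Fin r → ℕ) :
    0 ≤ Wt Qs σ p ν := by
  unfold Wt
  have := h.hq_ge hp
  split_ifs
  · norm_num
  · positivity

lemma Wt_bad (h : Setup g Qs D) {p : ℕ} (hp : p.Prime) (κ σ : ℝ) (hκ0 : 0 ≤ κ) (hσ0 : 0 ≤ σ)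
    (hσ : σ * (4 * g) ≤ 1) (hκ : (p:ℝ) ^ σ ≤ Real.exp κ) (ν : Fin r → ℕ) (hν : ν ≠ 0) :
    Wt Qs σ p ν ≤ 8 * g ^ 2 * Real.exp (κ * g) * rq Qs p * ∏ j, tht g ^ ν j := by
  unfold Wt
  rw [if_neg hν]
  have hg := h.g1
  have hp0 : (0:ℝ) < p := by exact_mod_cast hp.pos
  have ht := tht_pos g
  by_cases hz : rho (∏ j, Qs j) p = 0
  · rw [locc_eq_zero Qs p hp ν hz hν]
    simp [rq, hz]
  · have hr1 : (1:ℝ) / p ≤ rq Qs p := by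
      unfold rq
      gcongr
      exact_mod_cast Nat.one_le_iff_ne_zero.2 hz
    rw [Finset.prod_pow_eq_pow_sum]
    set N := ∑ j, ν j with hN
    have hN1 : 1 ≤ N := by
      by_contra hcon
      have : N = 0 := by omega
      rw [hN, Finset.sum_eq_zero_iff] at this
      exact hν (funext fun j => this j (Finset.mem_univ j))
    set m := (N - 1) / g + 1 with hm
    have hgm : g * (m - 1) < N := by
      have : g * ((N - 1) / g) ≤ N - 1 := Nat.mul_div_le _ _
      simp only [hm, Nat.add_sub_cancel]
      omega
    have hNm : N ≤ g * m := by
      have := Nat.lt_mul_div_succ (N - 1) (by have := h.hg; omega : 0 < g)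
      rw [hm]; omega
    have hmN : m ≤ N := by
      have : (N - 1) / g ≤ N - 1 := Nat.div_le_self _ _
      omega
    have e1 := rho_pow_le (∏ j, Qs j) g h.deg.le p hp (h.nofix p hp) m N hgm hmN
    have e2 : (locc Qs p ν : ℝ) ≤ 2 * g * ((p:ℝ) ^ N / (p:ℝ) ^ m) :=
      le_trans (by exact_mod_cast locc_le_rho Qs p ν) e1
    have e3 := tilt_bad g h.hg p hp.two_le κ σ hκ0 hσ0 hσ hκ m N hNm (by rw [hm]; exact Nat.le_add_left 1 _)
    have e4 : (locc Qs p ν : ℝ) / (p:ℝ) ^ N ≤ 2 * g / (p:ℝ) ^ m := by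
      rw [div_le_iff₀ (by positivity)]
      refine e2.trans_eq ?_
      ring
    calc (locc Qs p ν : ℝ) / (p:ℝ) ^ N * (p:ℝ) ^ (σ * (N:ℝ)) * hq Qs p
        ≤ 2 * g / (p:ℝ) ^ m * (p:ℝ) ^ (σ * (N:ℝ)) * (2 * g) := by
          have := h.hq_le hp
          have := h.hq_ge hp
          gcongr
      _ = 4 * g ^ 2 * ((p:ℝ) ^ (σ * (N:ℝ)) / (p:ℝ) ^ m) := by ring
      _ ≤ 4 * g ^ 2 * (2 * Real.exp (κ * g) / p * tht g ^ N) := by gcongr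
      _ = 8 * g ^ 2 * Real.exp (κ * g) * (1 / p) * tht g ^ N := by ring
      _ ≤ _ := by gcongr

lemma Wt_good (h : Setup g Qs D) {p : ℕ} (hp : p.Prime) (hD : ¬ (p:ℤ) ∣ D) (σ : ℝ)
    (hσ : σ * (4 * g) ≤ 1) (ν : Fin r → ℕ) (hν : 2 ≤ ∑ j, ν j) :
    Wt Qs σ p ν ≤ 4 * g ^ 2 * (p:ℝ) ^ (-(3 / 2) : ℝ) * ∏ j, tht g ^ ν j := by
  unfold Wt
  have hν0 : ν ≠ 0 := by rintro rfl; simp at hν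
  rw [if_neg hν0, Finset.prod_pow_eq_pow_sum]
  have hg := h.g1
  have hp0 : (0:ℝ) < p := by exact_mod_cast hp.pos
  have ht := tht_pos g
  set N := ∑ j, ν j with hN
  have e1 : (locc Qs p ν : ℝ) ≤ g := by
    have := (locc_le_rho Qs p ν).trans (hensel (∏ j, Qs j) p hp N (by omega) (h.simple p hp hD))
    exact_mod_cast this.trans (h.rho_le hp)
  have e3 := tilt_good g h.hg p hp.two_le σ hσ N hν
  calc (locc Qs p ν : ℝ) / (p:ℝ) ^ N * (p:ℝ) ^ (σ * (N:ℝ)) * hq Qs p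
      ≤ g / (p:ℝ) ^ N * (p:ℝ) ^ (σ * (N:ℝ)) * (2 * g) := by
        have := h.hq_le hp
        have := h.hq_ge hp
        gcongr
    _ = 2 * g ^ 2 * ((p:ℝ) ^ (σ * (N:ℝ)) / (p:ℝ) ^ N) := by ring
    _ ≤ 2 * g ^ 2 * (2 * (p:ℝ) ^ (-(3 / 2) : ℝ) * tht g ^ N) := by gcongr
    _ = _ := by ring

lemma Wt_single (h : Setup g Qs D) {p : ℕ} (hp : p.Prime) (σ : ℝ) (j : Fin r) :
    Wt Qs σ p (Pi.single j 1) ≤ (rho (Qs j) p : ℝ) / p * (p:ℝ) ^ σ * hq Qs p := by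
  unfold Wt
  have hν0 : (Pi.single j 1 : Fin r → ℕ) ≠ 0 := by
    intro h; have := congrFun h j; simp at this
  have hs : ∑ i, (Pi.single j 1 : Fin r → ℕ) i = 1 := by simp
  rw [if_neg hν0, hs, pow_one, Nat.cast_one, mul_one]
  have := h.hq_ge hp
  have : (locc Qs p (Pi.single j 1) : ℝ) ≤ rho (Qs j) p := by exact_mod_cast locc_single Qs p j
  gcongr

end Setup

lemma tht_sum (g r : ℕ) (hg : 1 ≤ g) (B : ℕ) :
    ∑ ν ∈ Fintype.piFinset (fun _ : Fin r => Finset.range B), ∏ j, tht g ^ ν j ≤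
      ((1 - tht g)⁻¹) ^ r := by
  rw [Finset.sum_prod_piFinset (Finset.range B) (fun _ n => tht g ^ n)]
  rw [Finset.prod_const, Finset.card_univ, Fintype.card_fin]
  have h1 := tht_lt g hg
  have h0 := tht_pos g
  apply pow_le_pow_left₀ (Finset.sum_nonneg fun _ _ => by positivity)
  rw [← tsum_geometric_of_lt_one h0.le h1]
  exact Summable.sum_le_tsum _ (fun _ _ => by positivity) (summable_geometric_of_lt_one h0.le h1)

noncomputable def c32 : ℝ := ∑' n : ℕ, (n:ℝ) ^ (-(3 / 2) : ℝ)

lemma c32_nonneg : 0 ≤ c32 := tsum_nonneg fun _ => by positivity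

lemma sum_c32 (s : Finset ℕ) : ∑ p ∈ s, (p:ℝ) ^ (-(3 / 2) : ℝ) ≤ c32 :=
  Summable.sum_le_tsum _ (fun _ _ => by positivity)
    (Real.summable_nat_rpow.2 (by norm_num))

/-- product over primes dividing D -/
noncomputable def Hd {r : ℕ} (Qs : Fin r → Polynomial ℤ) (D : ℤ) : ℝ :=
  ∏ p ∈ D.natAbs.primeFactors, hq Qs p

noncomputable def cth (g r : ℕ) : ℝ := ((1 - tht g)⁻¹) ^ r

lemma cth_nonneg (g r : ℕ) (hg : 1 ≤ g) : 0 ≤ cth g r := by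
  have := tht_lt g hg
  unfold cth
  have : 0 < 1 - tht g := by linarith
  positivity

namespace Setup
variable {r g : ℕ} {Qs : Fin r → Polynomial ℤ} {D : ℤ}

lemma Hd_ge (h : Setup g Qs D) : 1 ≤ Hd Qs D := by
  unfold Hd
  have : ∏ p ∈ D.natAbs.primeFactors, (1:ℝ) ≤ ∏ p ∈ D.natAbs.primeFactors, hq Qs p :=
    Finset.prod_le_prod (fun _ _ => by norm_num) fun p hp => h.hq_ge (Nat.prime_of_mem_primeFactors hp)
  simpa using this

lemma sum_div_D (h : Setup g Qs D) (s : Finset ℕ) (hs : ∀ p ∈ s, p.Prime ∧ (p:ℤ) ∣ D) :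
    ∑ p ∈ s, rq Qs p ≤ Real.log (Hd Qs D) := by
  have hsub : s ⊆ D.natAbs.primeFactors := by
    intro p hp
    rw [Nat.mem_primeFactors]
    exact ⟨(hs p hp).1, Int.natCast_dvd.1 (hs p hp).2, Int.natAbs_ne_zero.2 h.D0⟩
  refine (Finset.sum_le_sum_of_subset_of_nonneg hsub fun p _ _ => rq_nonneg p).trans ?_
  rw [Real.le_log_iff_exp_le (by linarith [h.Hd_ge]), Real.exp_sum]
  exact Finset.prod_le_prod (fun _ _ => by positivity)
    fun p hp => h.hq_exp (Nat.prime_of_mem_primeFactors hp)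

/-- sum over bad primes -/
lemma sum_bad (h : Setup g Qs D) (P0 : ℝ) (hP0 : 0 ≤ P0) (s : Finset ℕ)
    (hs : ∀ p ∈ s, p.Prime ∧ ¬ (P0 < (p:ℝ) ∧ ¬ (p:ℤ) ∣ D)) :
    ∑ p ∈ s, rq Qs p ≤ P0 + 1 + Real.log (Hd Qs D) := by
  rw [← Finset.sum_filter_add_sum_filter_not s (fun p : ℕ => (p:ℤ) ∣ D)]
  have h1 := h.sum_div_D (s.filter (fun p : ℕ => (p:ℤ) ∣ D))
    (fun p hp => ⟨(hs p (Finset.mem_filter.1 hp).1).1, (Finset.mem_filter.1 hp).2⟩)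
  have h2 : ∑ p ∈ s.filter (fun p : ℕ => ¬ (p:ℤ) ∣ D), rq Qs p ≤ P0 + 1 := by
    have hsub : s.filter (fun p : ℕ => ¬ (p:ℤ) ∣ D) ⊆ Finset.range (⌊P0⌋₊ + 1) := by
      intro p hp
      obtain ⟨hp1, hp2⟩ := Finset.mem_filter.1 hp
      have := (hs p hp1).2
      rw [Finset.mem_range]
      apply Nat.lt_succ_of_le
      apply Nat.le_floor
      by_contra hcon
      push Not at hcon
      exact this ⟨hcon, hp2⟩
    calc ∑ p ∈ s.filter (fun p : ℕ => ¬ (p:ℤ) ∣ D), rq Qs p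
        ≤ ∑ p ∈ s.filter (fun p : ℕ => ¬ (p:ℤ) ∣ D), (1:ℝ) :=
          Finset.sum_le_sum fun p hp => (h.rq_lt (hs p (Finset.mem_filter.1 hp).1).1).le
      _ ≤ ∑ p ∈ Finset.range (⌊P0⌋₊ + 1), (1:ℝ) :=
          Finset.sum_le_sum_of_subset_of_nonneg hsub fun _ _ _ => by norm_num
      _ = ⌊P0⌋₊ + 1 := by simp
      _ ≤ _ := by linarith [Nat.floor_le hP0]
  linarith

/-- total mass of nonzero states at any prime -/
lemma U_bad (h : Setup g Qs D) {p : ℕ} (hp : p.Prime) (κ σ : ℝ) (hκ0 : 0 ≤ κ) (hσ0 : 0 ≤ σ)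
    (hσ : σ * (4 * g) ≤ 1) (hκ : (p:ℝ) ^ σ ≤ Real.exp κ) (B : ℕ) (A : Finset (Fin r → ℕ))
    (hA : A ⊆ Fintype.piFinset (fun _ : Fin r => Finset.range B)) (hA0 : ∀ ν ∈ A, ν ≠ 0) :
    ∑ ν ∈ A, Wt Qs σ p ν ≤ 8 * g ^ 2 * Real.exp (κ * g) * cth g r * rq Qs p := by
  have hg := h.g1
  have ht := tht_pos g
  have hr := rq_nonneg (Qs := Qs) p
  calc ∑ ν ∈ A, Wt Qs σ p ν
      ≤ ∑ ν ∈ A, 8 * g ^ 2 * Real.exp (κ * g) * rq Qs p * ∏ j, tht g ^ ν j :=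
        Finset.sum_le_sum fun ν hν => h.Wt_bad hp κ σ hκ0 hσ0 hσ hκ ν (hA0 ν hν)
    _ = 8 * g ^ 2 * Real.exp (κ * g) * rq Qs p * ∑ ν ∈ A, ∏ j, tht g ^ ν j := by
        rw [← Finset.mul_sum]
    _ ≤ 8 * g ^ 2 * Real.exp (κ * g) * rq Qs p * cth g r := by
        apply mul_le_mul_of_nonneg_left _ (by positivity)
        refine le_trans ?_ (tht_sum g r h.hg B)
        exact Finset.sum_le_sum_of_subset_of_nonneg hA fun _ _ _ => by positivity
    _ = _ := by ring

lemma U_good (h : Setup g Qs D) {p : ℕ} (hp : p.Prime) (hD : ¬ (p:ℤ) ∣ D) (σ : ℝ)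
    (hσ : σ * (4 * g) ≤ 1) (B : ℕ) (A : Finset (Fin r → ℕ))
    (hA : A ⊆ Fintype.piFinset (fun _ : Fin r => Finset.range B)) (hA0 : ∀ ν ∈ A, 2 ≤ ∑ j, ν j) :
    ∑ ν ∈ A, Wt Qs σ p ν ≤ 4 * g ^ 2 * cth g r * (p:ℝ) ^ (-(3 / 2) : ℝ) := by
  have hg := h.g1
  have ht := tht_pos g
  calc ∑ ν ∈ A, Wt Qs σ p ν
      ≤ ∑ ν ∈ A, 4 * g ^ 2 * (p:ℝ) ^ (-(3 / 2) : ℝ) * ∏ j, tht g ^ ν j :=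
        Finset.sum_le_sum fun ν hν => h.Wt_good hp hD σ hσ ν (hA0 ν hν)
    _ = 4 * g ^ 2 * (p:ℝ) ^ (-(3 / 2) : ℝ) * ∑ ν ∈ A, ∏ j, tht g ^ ν j := by
        rw [← Finset.mul_sum]
    _ ≤ 4 * g ^ 2 * (p:ℝ) ^ (-(3 / 2) : ℝ) * cth g r := by
        apply mul_le_mul_of_nonneg_left _ (by positivity)
        refine le_trans ?_ (tht_sum g r h.hg B)
        exact Finset.sum_le_sum_of_subset_of_nonneg hA fun _ _ _ => by positivity
    _ = _ := by ring

end Setup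

lemma two_le_sum {r : ℕ} (ν : Fin r → ℕ) (h0 : ν ≠ 0) (h1 : ¬ ∃ j, ν = Pi.single j 1) :
    2 ≤ ∑ j, ν j := by
  by_contra hcon
  obtain ⟨j, hj⟩ : ∃ j, ν j ≠ 0 := by
    by_contra hc
    push Not at hc
    exact h0 (funext hc)
  apply h1
  refine ⟨j, ?_⟩
  have hs := Finset.add_sum_erase Finset.univ ν (Finset.mem_univ j)
  have hz : ∑ i ∈ Finset.univ.erase j, ν i = 0 := by omega
  rw [Finset.sum_eq_zero_iff] at hz
  ext i
  by_cases hij : i = j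
  · subst hij; simp; omega
  · rw [Pi.single_eq_of_ne hij]
    exact hz i (Finset.mem_erase.2 ⟨hij, Finset.mem_univ i⟩)

lemma rpow_tilt (T κ : ℝ) (hT : 2 ≤ T) (hκ0 : 0 ≤ κ) (p : ℕ) (hp : p ∈ primesBelow T) :
    (p:ℝ) ^ (κ / Real.log T) ≤ Real.exp κ ∧
    (p:ℝ) ^ (κ / Real.log T) - 1 ≤ Real.exp κ * (κ / Real.log T) * Real.log p := by
  obtain ⟨h1, h2⟩ := mem_primesBelow.1 hp
  have hp1 : (1:ℝ) < p := by exact_mod_cast h1.one_lt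
  have hlT : 0 < Real.log T := Real.log_pos (by linarith)
  have hlp : 0 < Real.log p := Real.log_pos hp1
  have hv : Real.log p * (κ / Real.log T) ≤ κ := by
    rw [← mul_div_assoc, div_le_iff₀ hlT, mul_comm]
    exact mul_le_mul_of_nonneg_left (Real.log_le_log (by linarith) h2) hκ0
  rw [Real.rpow_def_of_pos (by linarith)]
  set v := Real.log p * (κ / Real.log T) with hv'
  have hv0 : 0 ≤ v := by positivity
  refine ⟨Real.exp_le_exp.2 hv, ?_⟩
  have e1 : Real.exp v - 1 ≤ v * Real.exp v := by
    have := Real.add_one_le_exp (-v)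
    rw [Real.exp_neg] at this
    have hpos := Real.exp_pos v
    have h3 : (-v + 1) * Real.exp v ≤ 1 := by
      calc (-v + 1) * Real.exp v ≤ (Real.exp v)⁻¹ * Real.exp v := by gcongr
        _ = 1 := inv_mul_cancel₀ hpos.ne'
    linarith
  calc Real.exp v - 1 ≤ v * Real.exp v := e1
    _ ≤ v * Real.exp κ := by gcongr
    _ = _ := by rw [hv']; ring

/-- state space -/
abbrev Stt (r : ℕ) (T : ℝ) : Type := {p : ℕ // p ∈ primesBelow T} → (Fin r → ℕ)

noncomputable def SttF (r : ℕ) (T : ℝ) (B : ℕ) : Finset (Stt r T) :=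
  Fintype.piFinset fun _ => Fintype.piFinset fun _ : Fin r => Finset.range B

lemma sum_sub_filter (A : Finset ℕ) (q : ℕ → Prop) (F : ℕ → ℝ) :
    ∑ i ∈ (Finset.univ : Finset {p : ℕ // p ∈ A}).filter (fun i : {p : ℕ // p ∈ A} => q i), F i =
      ∑ p ∈ A.filter q, F p := by
  rw [Finset.sum_filter, Finset.sum_filter]
  exact Finset.sum_coe_sort A (fun p => if q p then F p else 0)

lemma log_two_bd (T : ℝ) (hT : 2 ≤ T) : 0.69 < Real.log T := by
  have : Real.log 2 ≤ Real.log T := Real.log_le_log (by norm_num) hT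
  have := Real.log_two_gt_d9
  linarith

lemma mert_sum_recip (T : ℝ) (hT : 2 ≤ T) : (Real.log T + 2) / Real.log T ≤ 4 := by
  have := log_two_bd T hT
  rw [div_le_iff₀ (by linarith)]
  linarith

theorem crude_euler {r g : ℕ} {Qs : Fin r → Polynomial ℤ} {D : ℤ} (h : Setup g Qs D)
    (κ T : ℝ) (hκ0 : 0 ≤ κ) (hT : 2 ≤ T) (hσ : κ * (4 * g) ≤ Real.log T) (B : ℕ) (hB : 1 ≤ B) :
    ∑ s ∈ SttF r T B, ∏ p : {p : ℕ // p ∈ primesBelow T}, Wt Qs (κ / Real.log T) p (s p) ≤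
      Real.exp (8 * g ^ 3 * Real.exp (κ * g) * cth g r * ∑ p ∈ primesBelow T, (1:ℝ) / p) := by
  have hlT := log_two_bd T hT
  have hσ0 : 0 ≤ κ / Real.log T := by positivity
  have hσ' : κ / Real.log T * (4 * g) ≤ 1 := by
    rw [div_mul_eq_mul_div, div_le_one (by linarith)]; exact hσ
  have hg := h.g1
  have hc := cth_nonneg g r h.hg
  unfold SttF
  rw [Finset.sum_prod_piFinset _ (fun (p : {p : ℕ // p ∈ primesBelow T}) ν => Wt Qs (κ / Real.log T) p ν)]
  rw [Finset.mul_sum, ← Finset.sum_coe_sort, Real.exp_sum]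
  apply Finset.prod_le_prod
  · intro p _
    exact Finset.sum_nonneg fun ν _ => h.Wt_nonneg (mem_primesBelow.1 p.2).1 _ _
  · intro p _
    have hp := (mem_primesBelow.1 p.2).1
    have h0 : (0 : Fin r → ℕ) ∈ Fintype.piFinset fun _ : Fin r => Finset.range B := by
      simp; omega
    rw [← Finset.add_sum_erase _ _ h0]
    have e1 := h.U_bad hp κ (κ / Real.log T) hκ0 hσ0 hσ' (rpow_tilt T κ hT hκ0 p p.2).1 B
      ((Fintype.piFinset fun _ : Fin r => Finset.range B).erase 0) (Finset.erase_subset _ _)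
      (fun ν hν => (Finset.mem_erase.1 hν).1)
    have e2 : Wt Qs (κ / Real.log T) p 0 = 1 := by simp [Wt]
    have e3 := h.rq_le hp
    have e4 : 8 * g ^ 2 * Real.exp (κ * g) * cth g r * rq Qs p ≤
        8 * g ^ 3 * Real.exp (κ * g) * cth g r * (1 / (p:ℝ)) := by
      calc 8 * g ^ 2 * Real.exp (κ * g) * cth g r * rq Qs p ≤
          8 * g ^ 2 * Real.exp (κ * g) * cth g r * (g / p) := by gcongr
        _ = _ := by ring
    have e5 := Real.add_one_le_exp (8 * g ^ 3 * Real.exp (κ * g) * cth g r * (1 / (p:ℝ)))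
    rw [e2]
    linarith

set_option maxHeartbeats 4000000 in
theorem conc_euler (r g : ℕ) (κ : ℝ) (hκ0 : 0 ≤ κ) : ∃ C K0 : ℝ, 0 < C ∧ 0 ≤ K0 ∧
    ∀ (Qs : Fin r → Polynomial ℤ) (D : ℤ), Setup g Qs D → ∀ (t T x : ℝ), 2 ≤ t → t ≤ T →
    T ≤ t ^ 2 → T ≤ x → κ * (4 * g) ≤ Real.log T → ∀ (B : ℕ) (f : Fin r → ℕ → ℝ),
    (∀ j, f j 1 = 0) → ∀ k : Fin r → ℝ,
    (∑ s ∈ (SttF r T B).filter (fun s => ∀ j, ∑ p : {p : ℕ // p ∈ primesBelow T},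
        f j ((p:ℕ) ^ s p j) = k j),
      ∏ p : {p : ℕ // p ∈ primesBelow T}, Wt Qs (κ / Real.log T) p (s p)) * ∏ p ∈ primesBelow t, (1 - rq Qs p) ≤
      C * Hd Qs D ^ K0 * Real.exp (r * g * (Real.log x / Real.log T)) *
        ∏ j, (1 / √(Ef (f j) x (fun p => (rho (Qs j) p : ℝ)))) := by
  set P0 : ℝ := 2 * g ^ 2 * Real.exp κ with hP0
  have hP00 : 0 ≤ P0 := by positivity
  set C2 : ℝ := 8 * g ^ 2 * Real.exp (κ * g) * |cth g r| with hC2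
  have hC20 : 0 ≤ C2 := by positivity
  set C3 : ℝ := C2 * (P0 + 1) + 4 * g ^ 2 * |cth g r| * c32 with hC3
  set C4 : ℝ := 4 * g * κ * Real.exp κ + 2 * g ^ 3 * Real.exp κ * c32 + 5 * g with hC4
  refine ⟨Real.exp C3 * (4 ^ r * Real.exp C4 * Real.exp (r * (P0 + 2 + 3 * g))), C2 + r, by positivity,
    by positivity, ?_⟩
  intro Qs D h t T x ht htT hTt hTx hσ B f hf1 k
  have hT : 2 ≤ T := ht.trans htT
  have hlT := log_two_bd T hT
  have hlt := log_two_bd t ht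
  have hg := h.g1
  have hH := h.Hd_ge
  have hc := cth_nonneg g r h.hg
  rw [abs_of_nonneg hc] at hC2 hC3
  have hσ0 : 0 ≤ κ / Real.log T := by positivity
  have hσ' : κ / Real.log T * (4 * g) ≤ 1 := by
    rw [div_mul_eq_mul_div, div_le_one (by linarith)]; exact hσ
  set σ := κ / Real.log T with hσd
  set good : ℕ → Prop := fun p => P0 < (p:ℝ) ∧ ¬ (p:ℤ) ∣ D with hgood
  set w : Fin r → ℕ → ℝ := fun j p => (rho (Qs j) p : ℝ) / p * (p:ℝ) ^ σ * hq Qs p with hw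
  have hpr : ∀ p : {p : ℕ // p ∈ primesBelow T}, (p:ℕ).Prime := fun p => (mem_primesBelow.1 p.2).1
  have htilt : ∀ p ∈ primesBelow T, (p:ℝ) ^ σ ≤ Real.exp κ := fun p hp =>
    (rpow_tilt T κ hT hκ0 p hp).1
  have hw0 : ∀ j, ∀ p : ℕ, p.Prime → 0 ≤ w j p := fun j p hp => by
    have := h.hq_ge hp
    simp only [hw]; positivity
  have hconc := concR (ι := {p : ℕ // p ∈ primesBelow T})
    (Fintype.piFinset fun _ : Fin r => Finset.range B)
    (fun p ν => Wt Qs σ p ν) (fun p ν => h.Wt_nonneg (hpr p) _ _) (fun p => by simp [Wt])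
    (fun p => good p) (fun j p => w j p) (fun j p => hw0 j p (hpr p))
    (fun j p hp => by
      have hpp := hpr p
      have e1 : (rho (Qs j) p : ℝ) / p ≤ g / p := (Setup.rqj_le p j).trans (h.rq_le hpp)
      have e2 := h.hq_le hpp
      have e3 := htilt p p.2
      have e4 := h.hq_ge hpp
      have hp0 : (0:ℝ) < (p:ℕ) := by exact_mod_cast hpp.pos
      simp only [hw]
      calc _ ≤ (g / (p:ℕ) : ℝ) * Real.exp κ * (2 * g) := by gcongr
        _ = P0 / (p:ℕ) := by rw [hP0]; ring
        _ ≤ 1 := by rw [div_le_one hp0]; exact hp.1.le)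
    (fun j p _ => h.Wt_single (hpr p) σ j)
    (fun j p n => f j ((p:ℕ) ^ n)) (fun j p => by simp [hf1 j]) k
  -- first factor
  have hF1 : ∏ p : {p : ℕ // p ∈ primesBelow T}, (1 + ∑ ν ∈ (Fintype.piFinset fun _ : Fin r =>
      Finset.range B).filter (fun ν => ν ≠ 0 ∧ ¬ (good p ∧ ∃ j, ν = Pi.single j 1)), Wt Qs σ p ν) ≤
      Real.exp C3 * Hd Qs D ^ C2 := by
    calc _ ≤ ∏ p : {p : ℕ // p ∈ primesBelow T}, Real.exp (if good p then
          4 * g ^ 2 * cth g r * (p:ℝ) ^ (-(3 / 2) : ℝ) else C2 * rq Qs p) := by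
          apply Finset.prod_le_prod
          · intro p _
            have : 0 ≤ ∑ ν ∈ (Fintype.piFinset fun _ : Fin r =>
              Finset.range B).filter (fun ν => ν ≠ 0 ∧ ¬ (good p ∧ ∃ j, ν = Pi.single j 1)),
              Wt Qs σ p ν := Finset.sum_nonneg fun ν _ => h.Wt_nonneg (hpr p) _ _
            linarith
          · intro p _
            split_ifs with hgp
            · have := h.U_good (hpr p) hgp.2 σ hσ' B ((Fintype.piFinset fun _ : Fin r =>
                Finset.range B).filter (fun ν => ν ≠ 0 ∧ ¬ (good p ∧ ∃ j, ν = Pi.single j 1)))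
                (Finset.filter_subset _ _) (fun ν hν => by
                  obtain ⟨_, h1, h2⟩ := Finset.mem_filter.1 hν
                  exact two_le_sum ν h1 (fun h3 => h2 ⟨hgp, h3⟩))
              have := Real.add_one_le_exp (4 * g ^ 2 * cth g r * (p:ℝ) ^ (-(3 / 2) : ℝ))
              linarith
            · have := h.U_bad (hpr p) κ σ hκ0 hσ0 hσ' (htilt p p.2) B ((Fintype.piFinset fun _ : Fin r =>
                Finset.range B).filter (fun ν => ν ≠ 0 ∧ ¬ (good p ∧ ∃ j, ν = Pi.single j 1)))
                (Finset.filter_subset _ _) (fun ν hν => (Finset.mem_filter.1 hν).2.1)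
              have := Real.add_one_le_exp (C2 * rq Qs p)
              rw [← hC2] at *
              linarith
      _ = Real.exp (∑ p ∈ (primesBelow T).filter good, 4 * g ^ 2 * cth g r * (p:ℝ) ^ (-(3 / 2) : ℝ) +
            ∑ p ∈ (primesBelow T).filter (fun p => ¬ good p), C2 * rq Qs p) := by
          rw [← Real.exp_sum, Finset.sum_coe_sort (primesBelow T) (fun p => if good p then
            4 * g ^ 2 * cth g r * (p:ℝ) ^ (-(3 / 2) : ℝ) else C2 * rq Qs p), Finset.sum_ite]
      _ ≤ Real.exp (C3 + Real.log (Hd Qs D) * C2) := by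
          apply Real.exp_le_exp.2
          rw [← Finset.mul_sum, ← Finset.mul_sum]
          have e1 := sum_c32 ((primesBelow T).filter good)
          have e2 := h.sum_bad P0 hP00 ((primesBelow T).filter (fun p => ¬ good p))
            (fun p hp => ⟨(mem_primesBelow.1 (Finset.mem_filter.1 hp).1).1, (Finset.mem_filter.1 hp).2⟩)
          have e3 : 4 * g ^ 2 * cth g r * ∑ p ∈ (primesBelow T).filter good, (p:ℝ) ^ (-(3 / 2) : ℝ) ≤
            4 * g ^ 2 * cth g r * c32 := by gcongr
          have e4 := mul_le_mul_of_nonneg_left e2 hC20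
          rw [hC3]
          linarith
      _ = _ := by
          rw [Real.exp_add, Real.rpow_def_of_pos (by linarith)]
  -- exponent sum
  have hF2 : ∑ j, ∑ p ∈ (primesBelow T).filter good, w j p ≤ ∑ p ∈ primesBelow t, rq Qs p + C4 := by
    rw [Finset.sum_comm]
    calc ∑ p ∈ (primesBelow T).filter good, ∑ j, w j p
        ≤ ∑ p ∈ (primesBelow T).filter good, (rq Qs p + g * Real.exp κ * σ * (Real.log p / p) +
            2 * g ^ 3 * Real.exp κ * (p:ℝ) ^ (-(3 / 2) : ℝ)) := by
          refine Finset.sum_le_sum fun p hp => ?_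
          obtain ⟨hp1, hp2⟩ := Finset.mem_filter.1 hp
          have hpp := (mem_primesBelow.1 hp1).1
          have hp0 : (1:ℝ) < p := by exact_mod_cast hpp.one_lt
          have hq1 := h.hq_ge hpp
          have hr0 := Setup.rq_nonneg (Qs := Qs) p
          have hrg := h.rq_le hpp
          have e0 : ∑ j, w j p ≤ rq Qs p * (p:ℝ) ^ σ * hq Qs p := by
            simp only [hw]
            rw [← Finset.sum_mul, ← Finset.sum_mul, ← Finset.sum_div]
            unfold rq
            gcongr
            exact_mod_cast rho_sum_le Qs p (h.copr p hpp hp2.2)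
          have e1 := (rpow_tilt T κ hT hκ0 p hp1).2
          have e2 := htilt p hp1
          have e3 : rq Qs p * ((p:ℝ) ^ σ - 1) ≤ g * Real.exp κ * σ * (Real.log p / p) := by
            calc rq Qs p * ((p:ℝ) ^ σ - 1) ≤ rq Qs p * (Real.exp κ * σ * Real.log p) := by gcongr
              _ ≤ g / p * (Real.exp κ * σ * Real.log p) := by
                  have := Real.log_pos hp0
                  gcongr
              _ = _ := by ring
          have e4 : rq Qs p * (p:ℝ) ^ σ * (rq Qs p * hq Qs p) ≤
              2 * g ^ 3 * Real.exp κ * (p:ℝ) ^ (-(3 / 2) : ℝ) := by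
            have := h.hq_le hpp
            calc rq Qs p * (p:ℝ) ^ σ * (rq Qs p * hq Qs p)
                ≤ g / p * Real.exp κ * (g / p * (2 * g)) := by gcongr
              _ = 2 * g ^ 3 * Real.exp κ * (p:ℝ) ^ (-2 : ℝ) := by
                  rw [Real.rpow_neg (by linarith), Real.rpow_two]
                  field_simp
              _ ≤ _ := by
                  gcongr
                  · exact hp0.le
                  · norm_num
          have e5 := h.hq_eq hpp
          calc ∑ j, w j p ≤ rq Qs p * (p:ℝ) ^ σ * hq Qs p := e0
            _ = rq Qs p * (p:ℝ) ^ σ * (1 + rq Qs p * hq Qs p) := by rw [← e5]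
            _ ≤ _ := by linarith
      _ = ∑ p ∈ (primesBelow T).filter good, rq Qs p +
            g * Real.exp κ * σ * ∑ p ∈ (primesBelow T).filter good, (Real.log p / p) +
            2 * g ^ 3 * Real.exp κ * ∑ p ∈ (primesBelow T).filter good, (p:ℝ) ^ (-(3 / 2) : ℝ) := by
          rw [Finset.sum_add_distrib, Finset.sum_add_distrib, Finset.mul_sum, Finset.mul_sum]
      _ ≤ _ := by
          have e1 : ∑ p ∈ (primesBelow T).filter good, (Real.log p / p) ≤ Real.log T + 2 := by
            refine le_trans (Finset.sum_le_sum_of_subset_of_nonneg (Finset.filter_subset _ _)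
              fun p hp _ => ?_) (mert T (by linarith))
            have hp1 : (1:ℝ) < p := by exact_mod_cast (mem_primesBelow.1 hp).1.one_lt
            exact div_nonneg (Real.log_nonneg hp1.le) (by linarith)
          have e2 := sum_c32 ((primesBelow T).filter good)
          have e3 : ∑ p ∈ (primesBelow T).filter good, rq Qs p ≤
              ∑ p ∈ primesBelow t, rq Qs p + 5 * g := by
            calc ∑ p ∈ (primesBelow T).filter good, rq Qs p ≤ ∑ p ∈ primesBelow T, rq Qs p :=
                  Finset.sum_le_sum_of_subset_of_nonneg (Finset.filter_subset _ _)
                    fun p _ _ => Setup.rq_nonneg p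
              _ ≤ ∑ p ∈ primesBelow t ∪ (primesBelow T).filter (fun p : ℕ => t < (p:ℝ)), rq Qs p := by
                  apply Finset.sum_le_sum_of_subset_of_nonneg _ fun p _ _ => Setup.rq_nonneg p
                  intro p hp
                  rw [Finset.mem_union, Finset.mem_filter, mem_primesBelow]
                  rcases le_or_gt (p:ℝ) t with h1 | h1
                  · exact Or.inl ⟨(mem_primesBelow.1 hp).1, h1⟩
                  · exact Or.inr ⟨hp, h1⟩
              _ ≤ ∑ p ∈ primesBelow t, rq Qs p +
                  ∑ p ∈ (primesBelow T).filter (fun p : ℕ => t < (p:ℝ)), rq Qs p := by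
                  rw [← Finset.sum_union_inter]
                  have : 0 ≤ ∑ p ∈ primesBelow t ∩ (primesBelow T).filter (fun p : ℕ => t < (p:ℝ)), rq Qs p :=
                    Finset.sum_nonneg fun p _ => Setup.rq_nonneg p
                  linarith
              _ ≤ _ := by
                  have : ∑ p ∈ (primesBelow T).filter (fun p : ℕ => t < (p:ℝ)), rq Qs p ≤ g * 5 := by
                    calc _ ≤ ∑ p ∈ (primesBelow T).filter (fun p : ℕ => t < (p:ℝ)), g * ((1:ℝ) / p) := by
                          refine Finset.sum_le_sum fun p hp => ?_
                          have := h.rq_le (mem_primesBelow.1 (Finset.mem_filter.1 hp).1).1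
                          rw [mul_one_div]; exact this
                      _ ≤ g * 5 := by
                          rw [← Finset.mul_sum]
                          have := recip_gap t T ht htT
                          have h2 : (Real.log T + 2) / Real.log t ≤ 5 := by
                            rw [div_le_iff₀ (by linarith)]
                            have : Real.log T ≤ 2 * Real.log t := by
                              have := Real.log_le_log (by linarith) hTt
                              rw [Real.log_pow] at this
                              push_cast at this
                              exact this
                            linarith
                          gcongr
                          linarith
                  linarith
          have e4 : g * Real.exp κ * σ * ∑ p ∈ (primesBelow T).filter good, (Real.log p / p) ≤
              4 * g * κ * Real.exp κ := by
            calc _ ≤ g * Real.exp κ * σ * (Real.log T + 2) := by gcongr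
              _ = g * Real.exp κ * κ * ((Real.log T + 2) / Real.log T) := by rw [hσd]; ring
              _ ≤ g * Real.exp κ * κ * 4 := by
                  have := mert_sum_recip T hT
                  gcongr
              _ = _ := by ring
          have e5 : 2 * g ^ 3 * Real.exp κ * ∑ p ∈ (primesBelow T).filter good, (p:ℝ) ^ (-(3 / 2) : ℝ)
            ≤ 2 * g ^ 3 * Real.exp κ * c32 := by gcongr
          rw [hC4]
          linarith
  -- comparison with E
  set A : ℝ := Real.exp (P0 + 2 + 3 * g + Real.log (Hd Qs D) + g * (Real.log x / Real.log T)) with hA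
  have hx1 : 1 ≤ x := by linarith
  have hlx : 0 ≤ Real.log x := Real.log_nonneg hx1
  have hF3 : ∀ j, 1 / √(1 + ∑ p ∈ ((primesBelow T).filter good).filter (fun p => f j p ≠ 0), w j p) ≤
      A * (1 / √(Ef (f j) x (fun p => (rho (Qs j) p : ℝ)))) := by
    intro j
    set Wj := ∑ p ∈ ((primesBelow T).filter good).filter (fun p => f j p ≠ 0), w j p with hWj
    have hWj0 : 0 ≤ Wj := Finset.sum_nonneg fun p hp => hw0 j p
      (mem_primesBelow.1 (Finset.mem_filter.1 (Finset.mem_filter.1 hp).1).1).1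
    have hE1 : 1 ≤ Ef (f j) x (fun p => (rho (Qs j) p : ℝ)) := by
      unfold Ef
      have : 0 ≤ ∑ p ∈ (primesBelow x).filter (fun p => f j p ≠ 0), (rho (Qs j) p : ℝ) / p :=
        Finset.sum_nonneg fun _ _ => by positivity
      linarith
    have hEle : Ef (f j) x (fun p => (rho (Qs j) p : ℝ)) ≤ (1 + Wj) * A := by
      have key : ∑ p ∈ (primesBelow x).filter (fun p => f j p ≠ 0), (rho (Qs j) p : ℝ) / p ≤
          Wj + (P0 + 1 + Real.log (Hd Qs D)) + g * ((Real.log x + 2) / Real.log T) := by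
        have hpt : ∀ p ∈ (primesBelow x).filter (fun p => f j p ≠ 0), (rho (Qs j) p : ℝ) / p ≤
            (if p ∈ ((primesBelow T).filter good).filter (fun p => f j p ≠ 0) then w j p else 0) +
            (if ¬ good p then rq Qs p else 0) + (if T < (p:ℝ) then g * ((1:ℝ) / p) else 0) := by
          intro p hp
          obtain ⟨hp1, hp2⟩ := Finset.mem_filter.1 hp
          have hpp := (mem_primesBelow.1 hp1).1
          have hr0 := Setup.rq_nonneg (Qs := Qs) p
          have hp0 : (1:ℝ) < p := by exact_mod_cast hpp.one_lt
          have a1 : 0 ≤ (if p ∈ ((primesBelow T).filter good).filter (fun p => f j p ≠ 0) then w j p else 0) := by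
            split_ifs
            · exact hw0 j p hpp
            · exact le_rfl
          have a2 : 0 ≤ (if ¬ good p then rq Qs p else 0) := by
            split_ifs
            · exact le_rfl
            · exact hr0
          have a3 : 0 ≤ (if T < (p:ℝ) then g * ((1:ℝ) / p) else 0) := by
            split_ifs <;> positivity
          have b := Setup.rqj_le (Qs := Qs) p j
          by_cases hgp : good p
          · rcases le_or_gt (p:ℝ) T with h1 | h1
            · rw [if_pos (Finset.mem_filter.2 ⟨Finset.mem_filter.2 ⟨mem_primesBelow.2 ⟨hpp, h1⟩, hgp⟩, hp2⟩)]
              have : (rho (Qs j) p : ℝ) / p ≤ w j p := by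
                simp only [hw]
                have h1 := h.hq_ge hpp
                have h2 : 1 ≤ (p:ℝ) ^ σ := Real.one_le_rpow hp0.le hσ0
                calc (rho (Qs j) p : ℝ) / p = (rho (Qs j) p : ℝ) / p * 1 * 1 := by ring
                  _ ≤ _ := by gcongr
              linarith
            · have := h.rq_le hpp
              rw [if_pos h1] at *
              rw [mul_one_div]
              linarith
          · rw [if_pos hgp] at *
            linarith
        refine (Finset.sum_le_sum hpt).trans ?_
        rw [Finset.sum_add_distrib, Finset.sum_add_distrib]
        have b1 : ∑ p ∈ (primesBelow x).filter (fun p => f j p ≠ 0),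
            (if p ∈ ((primesBelow T).filter good).filter (fun p => f j p ≠ 0) then w j p else 0) ≤ Wj := by
          rw [← Finset.sum_filter]
          apply Finset.sum_le_sum_of_subset_of_nonneg
          · intro p hp
            exact (Finset.mem_filter.1 hp).2
          · intro p hp _
            exact hw0 j p
              (mem_primesBelow.1 (Finset.mem_filter.1 (Finset.mem_filter.1 hp).1).1).1
        have b2 : ∑ p ∈ (primesBelow x).filter (fun p => f j p ≠ 0),
            (if ¬ good p then rq Qs p else 0) ≤ P0 + 1 + Real.log (Hd Qs D) := by
          rw [← Finset.sum_filter]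
          apply h.sum_bad P0 hP00
          intro p hp
          obtain ⟨hp1, hp2⟩ := Finset.mem_filter.1 hp
          exact ⟨(mem_primesBelow.1 (Finset.mem_filter.1 hp1).1).1, hp2⟩
        have b3 : ∑ p ∈ (primesBelow x).filter (fun p => f j p ≠ 0),
            (if T < (p:ℝ) then g * ((1:ℝ) / p) else 0) ≤ g * ((Real.log x + 2) / Real.log T) := by
          rw [← Finset.sum_filter, ← Finset.mul_sum]
          apply mul_le_mul_of_nonneg_left _ (by positivity)
          refine le_trans (Finset.sum_le_sum_of_subset_of_nonneg ?_ fun _ _ _ => by positivity)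
            (recip_gap T x hT hTx)
          exact Finset.filter_subset_filter _ (Finset.filter_subset _ _)
        linarith
      have hL0 : 0 ≤ Real.log (Hd Qs D) := Real.log_nonneg hH
      have hdiv : (Real.log x + 2) / Real.log T ≤ Real.log x / Real.log T + 3 := by
        rw [add_div]
        have : 2 / Real.log T ≤ 3 := by
          rw [div_le_iff₀ (by linarith)]; linarith
        linarith
      have h1 := mul_le_mul_of_nonneg_left hdiv (by linarith : (0:ℝ) ≤ g)
      have h2 := Real.add_one_le_exp (P0 + 2 + 3 * g + Real.log (Hd Qs D) + g * (Real.log x / Real.log T))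
      have h3 : 0 ≤ g * (Real.log x / Real.log T) := by positivity
      unfold Ef
      set a : ℝ := P0 + 2 + 3 * g + Real.log (Hd Qs D) + g * (Real.log x / Real.log T)
      have h4 : (1 + Wj) * (a + 1) ≤ (1 + Wj) * A := by gcongr
      have h5 : 0 ≤ a := by positivity
      nlinarith
    have hA1 : 1 ≤ A := by
      apply Real.one_le_exp
      have := Real.log_nonneg hH
      positivity
    have hs : √(Ef (f j) x (fun p => (rho (Qs j) p : ℝ))) ≤ √(1 + Wj) * A := by
      calc √(Ef (f j) x (fun p => (rho (Qs j) p : ℝ))) ≤ √((1 + Wj) * A) := Real.sqrt_le_sqrt hEle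
        _ = √(1 + Wj) * √A := Real.sqrt_mul (by linarith) _
        _ ≤ _ := by
          gcongr
          rw [Real.sqrt_le_left (by linarith)]
          nlinarith
    have hs1 : 0 < √(Ef (f j) x (fun p => (rho (Qs j) p : ℝ))) := Real.sqrt_pos.2 (by linarith)
    have hs2 : 0 < √(1 + Wj) := Real.sqrt_pos.2 (by linarith)
    rw [mul_one_div, div_le_div_iff₀ hs2 hs1, one_mul, mul_comm]
    exact hs
  -- assemble
  have hfilter : ∀ j, ∑ i ∈ (Finset.univ.filter (fun i : {p : ℕ // p ∈ primesBelow T} => good i)).filter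
      (fun i : {p : ℕ // p ∈ primesBelow T} => f j ((i:ℕ) ^ 1) ≠ 0), w j i =
      ∑ p ∈ ((primesBelow T).filter good).filter (fun p => f j p ≠ 0), w j p := by
    intro j
    simp only [pow_one]
    rw [Finset.filter_filter, Finset.filter_filter]
    convert sum_sub_filter (primesBelow T) (fun p => good p ∧ f j p ≠ 0) (w j)
  have hfilter2 : ∀ j, ∑ i ∈ Finset.univ.filter (fun i : {p : ℕ // p ∈ primesBelow T} => good i), w j i =
      ∑ p ∈ (primesBelow T).filter good, w j p := fun j => by
    convert sum_sub_filter (primesBelow T) good (w j)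
  have hconc2 : (∑ s ∈ (SttF r T B).filter (fun s => ∀ j, ∑ p : {p : ℕ // p ∈ primesBelow T},
        f j ((p:ℕ) ^ s p j) = k j),
      ∏ p : {p : ℕ // p ∈ primesBelow T}, Wt Qs σ p (s p)) ≤
      (∏ p : {p : ℕ // p ∈ primesBelow T}, (1 + ∑ ν ∈ (Fintype.piFinset fun _ : Fin r =>
      Finset.range B).filter (fun ν => ν ≠ 0 ∧ ¬ (good p ∧ ∃ j, ν = Pi.single j 1)), Wt Qs σ p ν)) *
      ∏ j : Fin r, (4 * Real.exp (∑ p ∈ (primesBelow T).filter good, w j p) /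
      √(1 + ∑ p ∈ ((primesBelow T).filter good).filter (fun p => f j p ≠ 0), w j p)) := by
    unfold SttF
    refine le_trans (le_of_eq ?_) (hconc.trans (le_of_eq ?_))
    · convert rfl
    · congr 1
      · convert rfl
      · refine Finset.prod_congr rfl fun j _ => ?_
        rw [← hfilter j, ← hfilter2 j]
        convert rfl
  have hprod2 : ∏ j : Fin r, (4 * Real.exp (∑ p ∈ (primesBelow T).filter good, w j p) /
      √(1 + ∑ p ∈ ((primesBelow T).filter good).filter (fun p => f j p ≠ 0), w j p)) ≤
      4 ^ r * Real.exp (∑ p ∈ primesBelow t, rq Qs p + C4) * (A ^ r *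
        ∏ j, (1 / √(Ef (f j) x (fun p => (rho (Qs j) p : ℝ))))) := by
    calc _ = 4 ^ r * Real.exp (∑ j, ∑ p ∈ (primesBelow T).filter good, w j p) *
        ∏ j, (1 / √(1 + ∑ p ∈ ((primesBelow T).filter good).filter (fun p => f j p ≠ 0), w j p)) := by
          rw [Real.exp_sum]
          have : (4:ℝ) ^ r = ∏ j : Fin r, 4 := by simp
          rw [this, ← Finset.prod_mul_distrib, ← Finset.prod_mul_distrib]
          refine Finset.prod_congr rfl fun j _ => ?_
          rw [mul_one_div]
      _ ≤ _ := by
          apply mul_le_mul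
          · gcongr
          · have : (A:ℝ) ^ r = ∏ j : Fin r, A := by simp
            rw [this, ← Finset.prod_mul_distrib]
            apply Finset.prod_le_prod
            · intro j _; positivity
            · intro j _; exact hF3 j
          · apply Finset.prod_nonneg; intro j _; positivity
          · positivity
  have hsieve : ∏ p ∈ primesBelow t, (1 - rq Qs p) ≤ Real.exp (-∑ p ∈ primesBelow t, rq Qs p) := by
    rw [← Finset.sum_neg_distrib, Real.exp_sum]
    apply Finset.prod_le_prod
    · intro p hp
      linarith [h.rq_lt (mem_primesBelow.1 hp).1]
    · intro p _
      have := Real.add_one_le_exp (-rq Qs p)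
      linarith
  have hsieve0 : 0 ≤ ∏ p ∈ primesBelow t, (1 - rq Qs p) := by
    apply Finset.prod_nonneg
    intro p hp
    linarith [h.rq_lt (mem_primesBelow.1 hp).1]
  have hE0 : 0 ≤ ∏ j, (1 / √(Ef (f j) x (fun p => (rho (Qs j) p : ℝ)))) := by
    apply Finset.prod_nonneg; intro j _; positivity
  have hH0 : 0 < Hd Qs D := by linarith
  have hAr : A ^ r = Real.exp (r * (P0 + 2 + 3 * g)) * Hd Qs D ^ (r:ℝ) *
      Real.exp (r * g * (Real.log x / Real.log T)) := by
    rw [hA, ← Real.exp_nat_mul, Real.rpow_def_of_pos hH0, ← Real.exp_add, ← Real.exp_add]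
    congr 1; ring
  refine le_trans (mul_le_mul_of_nonneg_right (hconc2.trans (mul_le_mul hF1 hprod2 ?_ ?_)) hsieve0) ?_
  · apply Finset.prod_nonneg; intro j _; positivity
  · positivity
  · refine (mul_le_mul_of_nonneg_left hsieve (by positivity)).trans ?_
    rw [hAr, Real.rpow_add hH0]
    apply le_of_eq
    have : Real.exp (∑ p ∈ primesBelow t, rq Qs p + C4) * Real.exp (-∑ p ∈ primesBelow t, rq Qs p) =
        Real.exp C4 := by
      rw [← Real.exp_add]; congr 1; ring
    rw [← this]
    ring

lemma emod_eq_of_dvd' {m a b : ℤ} (h : m ∣ a - b) : a % m = b % m :=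
  Int.emod_eq_emod_iff_emod_sub_eq_zero.2 (Int.emod_eq_zero_of_dvd h)

lemma dvd_of_emod_eq' {m a b : ℤ} (h : a % m = b % m) : m ∣ a - b :=
  Int.dvd_of_emod_eq_zero (Int.emod_eq_emod_iff_emod_sub_eq_zero.1 h)

set_option maxHeartbeats 1000000 in
lemma class_count {r g : ℕ} {Qs : Fin r → Polynomial ℤ} {D : ℤ} (h : Setup g Qs D)
    (t : ℝ) (ht : 2 ≤ t) (m : ℕ) (hm : 0 < m) (c : ℤ) (P : Finset ℕ) (hP : P ⊆ primesBelow t)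
    (hPm : ∀ p ∈ P, ¬ p ∣ m) (a b : ℤ) (hab : a ≤ b) :
    (((Finset.Ico a b).filter (fun n : ℤ => (m:ℤ) ∣ n - c ∧
      ∀ p ∈ P, ¬ (p:ℤ) ∣ (∏ j, Qs j).eval n)).card : ℝ) ≤
      2 * (((b - a : ℤ) : ℝ) / m + 1 + 2 * (t ^ (8 * g + 1)) ^ 6) * ∏ p ∈ P, (1 - rq Qs p) := by
  set Q := ∏ j, Qs j with hQ
  obtain ⟨Ω, hΩ⟩ : ∃ Ω : ℕ → ℤ → Prop, ∀ p k, Ω p k ↔ (p:ℤ) ∣ Q.eval (c + m * k) :=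
    ⟨_, fun _ _ => Iff.rfl⟩
  have hm0 : (0:ℝ) < m := by exact_mod_cast hm
  have hcong : ∀ (p : ℕ) (u v : ℤ), (p:ℤ) ∣ u - v → ((p:ℤ) ∣ Q.eval u ↔ (p:ℤ) ∣ Q.eval v) := by
    intro p u v huv
    have h1 : u - v ∣ Q.eval u - Q.eval v := Polynomial.sub_dvd_eval_sub _ _ _
    exact (Int.dvd_iff_dvd_of_dvd_sub (huv.trans h1))
  have hom : ∀ p ∈ P, omg Ω p = rho Q p := by
    intro p hp
    have hpp := (mem_primesBelow.1 (hP hp)).1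
    have hp0 : (p:ℤ) ≠ 0 := by exact_mod_cast hpp.ne_zero
    have hppos : (0:ℤ) < p := by exact_mod_cast hpp.pos
    have hcop : IsCoprime (m:ℤ) (p:ℤ) :=
      (Nat.isCoprime_iff_coprime.2 ((Nat.Prime.coprime_iff_not_dvd hpp).2 (hPm p hp))).symm
    obtain ⟨m', p', hmp⟩ := hcop
    rw [rho_eq, omg]
    apply Finset.card_bij (fun k _ => (c + m * k) % p)
    · intro k hk
      rw [Finset.mem_filter] at hk ⊢
      refine ⟨Finset.mem_Ico.2 ⟨Int.emod_nonneg _ hp0, Int.emod_lt_of_pos _ hppos⟩, ?_⟩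
      refine (hcong p _ _ ?_).1 ((hΩ _ _).1 hk.2)
      exact Int.dvd_self_sub_emod
    · intro k hk k' hk' he
      have hk := Finset.mem_Ico.1 (Finset.mem_filter.1 hk).1
      have hk' := Finset.mem_Ico.1 (Finset.mem_filter.1 hk').1
      have h1 : (p:ℤ) ∣ (c + m * k) - (c + m * k') := dvd_of_emod_eq' he
      have h2 : (p:ℤ) ∣ k - k' := by
        have : k - k' = m' * ((c + m * k) - (c + m * k')) + (p' * (k - k')) * p := by
          linear_combination (-(k - k')) * hmp
        rw [this]
        exact dvd_add (Dvd.dvd.mul_left h1 _) (Dvd.intro_left _ rfl)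
      rw [← Int.emod_eq_of_lt hk.1 hk.2, ← Int.emod_eq_of_lt hk'.1 hk'.2]
      exact (emod_eq_of_dvd' h2)
    · intro n hn
      rw [Finset.mem_filter, Finset.mem_Ico] at hn
      have hmod : (p:ℤ) ∣ (c + m * ((m' * (n - c)) % p)) - n := by
        have e : (m' * (n - c)) % p = m' * (n - c) - p * ((m' * (n - c)) / p) := Int.emod_def _ _
        refine ⟨-(p' * (n - c)) - m * ((m' * (n - c)) / p), ?_⟩
        rw [e]
        linear_combination (n - c) * hmp
      refine ⟨(m' * (n - c)) % p, ?_, ?_⟩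
      · rw [Finset.mem_filter, Finset.mem_Ico]
        exact ⟨⟨Int.emod_nonneg _ hp0, Int.emod_lt_of_pos _ hppos⟩, (hΩ _ _).2 ((hcong p _ _ hmod).2 hn.2)⟩
      · exact (emod_eq_of_dvd' hmod).trans (Int.emod_eq_of_lt hn.1.1 hn.1.2)
  set k0 : ℤ := ⌈((a - c : ℤ):ℝ) / m⌉ with hk0
  set k1 : ℤ := ⌈((b - c : ℤ):ℝ) / m⌉ with hk1
  have hk01 : k0 ≤ k1 := by
    apply Int.ceil_le_ceil
    gcongr
  have hlen : ((k1 - k0 : ℤ):ℝ) ≤ ((b - a : ℤ) : ℝ) / m + 1 := by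
    have h1 := Int.ceil_lt_add_one (((b - c : ℤ):ℝ) / m)
    have h2 := Int.le_ceil (((a - c : ℤ):ℝ) / m)
    have h3 : ((b - a : ℤ) : ℝ) / m = ((b - c : ℤ):ℝ) / m - ((a - c : ℤ):ℝ) / m := by
      push_cast; ring
    push_cast [hk0, hk1] at *
    linarith
  have hs := sieve_final t ht g P hP Ω (by
      intro p _ k
      rw [hΩ, hΩ]
      apply hcong
      exact ⟨m, by ring⟩) (by
      intro p hp; rw [hom p hp]; exact h.nofix p (mem_primesBelow.1 (hP hp)).1) (by
      intro p hp; rw [hom p hp]; exact h.rho_le (mem_primesBelow.1 (hP hp)).1) k0 k1 hk01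
  have hcard : ((Finset.Ico a b).filter (fun n : ℤ => (m:ℤ) ∣ n - c ∧
      ∀ p ∈ P, ¬ (p:ℤ) ∣ Q.eval n)).card ≤
      ((Finset.Ico k0 k1).filter (fun k => ∀ p ∈ P, ¬ Ω p k)).card := by
    apply Finset.card_le_card_of_injOn (fun n => (n - c) / m)
    · intro n hn
      obtain ⟨hn1, ⟨k, hk⟩, hn3⟩ := Finset.mem_filter.1 hn
      have hm' : (m:ℤ) ≠ 0 := by omega
      have e : (n - c) / m = k := by rw [hk]; exact Int.mul_ediv_cancel_left _ hm'
      have hn : n = c + m * k := by linarith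
      have hnR : (n:ℝ) = c + m * k := by rw [hn]; push_cast; ring
      obtain ⟨h1, h2⟩ := Finset.mem_Ico.1 hn1
      have h1R : (a:ℝ) ≤ n := by exact_mod_cast h1
      have h2R : (n:ℝ) < b := by exact_mod_cast h2
      simp only [e]
      rw [Finset.mem_coe, Finset.mem_filter, Finset.mem_Ico]
      refine ⟨⟨?_, ?_⟩, ?_⟩
      · rw [hk0, Int.ceil_le, div_le_iff₀ hm0]; push_cast; linarith
      · rw [hk1, Int.lt_ceil, lt_div_iff₀ hm0]; push_cast; linarith
      · intro p hp; rw [hΩ, ← hn]; exact hn3 p hp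
    · intro n hn n' hn' he
      obtain ⟨_, h1, _⟩ := Finset.mem_filter.1 hn
      obtain ⟨_, h2, _⟩ := Finset.mem_filter.1 hn'
      have := Int.ediv_left_inj h1 h2 |>.1 he
      linarith
  have hprod : ∏ p ∈ P, (1 - (omg Ω p : ℝ) / p) = ∏ p ∈ P, (1 - rq Qs p) := by
    refine Finset.prod_congr rfl fun p hp => ?_
    rw [hom p hp]; rfl
  have hprod0 : 0 ≤ ∏ p ∈ P, (1 - rq Qs p) := by
    apply Finset.prod_nonneg
    intro p hp
    linarith [h.rq_lt (mem_primesBelow.1 (hP hp)).1]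
  calc _ ≤ (((Finset.Ico k0 k1).filter (fun k => ∀ p ∈ P, ¬ Ω p k)).card : ℝ) := by exact_mod_cast hcard
    _ ≤ _ := hs
    _ ≤ _ := by
      rw [hprod]
      gcongr

noncomputable def amod {r : ℕ} {T : ℝ} (s : Stt r T) : ℕ :=
  ∏ p : {p : ℕ // p ∈ primesBelow T}, (p:ℕ) ^ (∑ j, s p j)

lemma amod_pos {r : ℕ} {T : ℝ} (s : Stt r T) : 0 < amod s := by
  unfold amod
  apply Finset.prod_pos
  intro p _
  exact pow_pos (mem_primesBelow.1 p.2).1.pos _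

noncomputable def Rset {r : ℕ} (Qs : Fin r → Polynomial ℤ) {T : ℝ} (s : Stt r T) : Finset ℤ :=
  (Finset.Ico (0:ℤ) (amod s)).filter (fun n : ℤ => ∀ p : {p : ℕ // p ∈ primesBelow T}, ∀ j,
    (((p:ℕ) ^ s p j : ℕ) : ℤ) ∣ (Qs j).eval n)

lemma Rset_card {r : ℕ} (Qs : Fin r → Polynomial ℤ) {T : ℝ} (s : Stt r T) :
    (Rset Qs s).card ≤ ∏ p : {p : ℕ // p ∈ primesBelow T}, locc Qs p (s p) := by
  unfold locc
  rw [← Fintype.card_piFinset]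
  apply Finset.card_le_card_of_injOn (fun (n : ℤ) (p : {p : ℕ // p ∈ primesBelow T}) =>
    n % (((p:ℕ) ^ (∑ j, s p j) : ℕ) : ℤ))
  · intro n hn
    rw [Finset.mem_coe, Fintype.mem_piFinset]
    intro p
    have hpp := (mem_primesBelow.1 p.2).1
    have hpos : (0:ℤ) < (((p:ℕ) ^ (∑ j, s p j) : ℕ) : ℤ) := by exact_mod_cast pow_pos hpp.pos _
    rw [Finset.mem_filter, Finset.mem_Ico]
    refine ⟨⟨Int.emod_nonneg _ hpos.ne', Int.emod_lt_of_pos _ hpos⟩, fun j => ?_⟩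
    have h1 := (Finset.mem_filter.1 hn).2 p j
    have h2 : n - n % (((p:ℕ) ^ (∑ j, s p j) : ℕ) : ℤ) ∣ (Qs j).eval n -
      (Qs j).eval (n % (((p:ℕ) ^ (∑ j, s p j) : ℕ) : ℤ)) := Polynomial.sub_dvd_eval_sub _ _ _
    have h3 : (((p:ℕ) ^ s p j : ℕ) : ℤ) ∣ (((p:ℕ) ^ (∑ j, s p j) : ℕ) : ℤ) := by
      exact_mod_cast pow_dvd_pow _ (Finset.single_le_sum (f := fun j => s p j) (fun _ _ => Nat.zero_le _) (Finset.mem_univ j))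
    exact (Int.dvd_iff_dvd_of_dvd_sub ((h3.trans Int.dvd_self_sub_emod).trans h2)).1 h1
  · intro n hn n' hn' he
    have hn := Finset.mem_Ico.1 (Finset.mem_filter.1 hn).1
    have hn' := Finset.mem_Ico.1 (Finset.mem_filter.1 hn').1
    have hd : ((amod s : ℕ):ℤ) ∣ n - n' := by
      unfold amod
      push_cast
      apply Finset.prod_dvd_of_coprime
      · intro p _ q _ hpq
        have hpp := (mem_primesBelow.1 p.2).1
        have hqq := (mem_primesBelow.1 q.2).1
        apply IsCoprime.pow
        exact Nat.isCoprime_iff_coprime.2 ((Nat.coprime_primes hpp hqq).2 (fun e => hpq (Subtype.ext e)))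
      · intro p _
        have h2 := dvd_of_emod_eq' (congrFun he p)
        exact_mod_cast h2
    rw [← Int.emod_eq_of_lt hn.1 hn.2, ← Int.emod_eq_of_lt hn'.1 hn'.2]
    exact emod_eq_of_dvd' hd

/-- the integers compatible with a state -/
def compat {r : ℕ} (Qs : Fin r → Polynomial ℤ) (t : ℝ) {T : ℝ} (s : Stt r T) (n : ℤ) : Prop :=
  (∀ p : {p : ℕ // p ∈ primesBelow T}, ∀ j, (((p:ℕ) ^ s p j : ℕ) : ℤ) ∣ (Qs j).eval n) ∧
    ∀ p ∈ primesBelow t, ¬ p ∣ amod s → ¬ (p:ℤ) ∣ (∏ j, Qs j).eval n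

lemma state_count {r g : ℕ} {Qs : Fin r → Polynomial ℤ} {D : ℤ} (h : Setup g Qs D)
    (t : ℝ) (ht : 2 ≤ t) {T : ℝ} (s : Stt r T) (a b : ℤ) (hab : a ≤ b) :
    (((Finset.Ico a b).filter (compat Qs t s)).card : ℝ) ≤
      (∏ p : {p : ℕ // p ∈ primesBelow T}, (locc Qs p (s p) : ℝ)) *
      (2 * (((b - a : ℤ) : ℝ) / amod s + 1 + 2 * (t ^ (8 * g + 1)) ^ 6) *
        ∏ p ∈ (primesBelow t).filter (fun p : ℕ => ¬ p ∣ amod s), (1 - rq Qs p)) := by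
  have hpos := amod_pos s
  have hz : (0:ℤ) < amod s := by exact_mod_cast hpos
  set P := (primesBelow t).filter (fun p : ℕ => ¬ p ∣ amod s) with hP
  have hsub : (Finset.Ico a b).filter (compat Qs t s) ⊆ (Rset Qs s).biUnion (fun c =>
      (Finset.Ico a b).filter (fun n : ℤ => ((amod s : ℕ):ℤ) ∣ n - c ∧
      ∀ p ∈ P, ¬ (p:ℤ) ∣ (∏ j, Qs j).eval n)) := by
    intro n hn
    obtain ⟨hn1, hn2, hn3⟩ := Finset.mem_filter.1 hn
    rw [Finset.mem_biUnion]
    refine ⟨n % amod s, ?_, ?_⟩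
    · unfold Rset
      refine Finset.mem_filter.2 ⟨Finset.mem_Ico.2 ⟨Int.emod_nonneg _ hz.ne', Int.emod_lt_of_pos _ hz⟩, ?_⟩
      intro p j
      have h1 := hn2 p j
      have h2 : n - n % ((amod s : ℕ) : ℤ) ∣ (Qs j).eval n -
        (Qs j).eval (n % ((amod s : ℕ) : ℤ)) := Polynomial.sub_dvd_eval_sub _ _ _
      have h3 : (((p:ℕ) ^ s p j : ℕ) : ℤ) ∣ ((amod s : ℕ) : ℤ) := by
        refine Int.natCast_dvd_natCast.2 (dvd_trans ?_ (Finset.dvd_prod_of_mem _ (Finset.mem_univ p)))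
        exact pow_dvd_pow _ (Finset.single_le_sum (f := fun j => s p j) (fun _ _ => Nat.zero_le _) (Finset.mem_univ j))
      exact (Int.dvd_iff_dvd_of_dvd_sub ((h3.trans Int.dvd_self_sub_emod).trans h2)).1 h1
    · refine Finset.mem_filter.2 ⟨hn1, Int.dvd_self_sub_emod, ?_⟩
      intro p hp
      obtain ⟨hp1, hp2⟩ := Finset.mem_filter.1 hp
      exact hn3 p hp1 hp2
  set Bd := 2 * (((b - a : ℤ) : ℝ) / amod s + 1 + 2 * (t ^ (8 * g + 1)) ^ 6) * ∏ p ∈ P, (1 - rq Qs p)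
    with hBd
  have hBd0 : 0 ≤ Bd := by
    have h1 : 0 ≤ ∏ p ∈ P, (1 - rq Qs p) := by
      apply Finset.prod_nonneg
      intro p hp
      linarith [h.rq_lt (mem_primesBelow.1 (Finset.mem_filter.1 hp).1).1]
    have h2 : (0:ℝ) ≤ ((b - a : ℤ) : ℝ) := by exact_mod_cast sub_nonneg.2 hab
    positivity
  calc (((Finset.Ico a b).filter (compat Qs t s)).card : ℝ)
      ≤ ∑ c ∈ Rset Qs s, (((Finset.Ico a b).filter (fun n : ℤ => ((amod s : ℕ):ℤ) ∣ n - c ∧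
      ∀ p ∈ P, ¬ (p:ℤ) ∣ (∏ j, Qs j).eval n)).card : ℝ) := by
        exact_mod_cast (Finset.card_le_card hsub).trans Finset.card_biUnion_le
    _ ≤ ∑ c ∈ Rset Qs s, Bd := by
        refine Finset.sum_le_sum fun c _ => ?_
        exact class_count h t ht (amod s) hpos c P (Finset.filter_subset _ _)
          (fun p hp => (Finset.mem_filter.1 hp).2) a b hab
    _ = (Rset Qs s).card * Bd := by rw [Finset.sum_const, nsmul_eq_mul]
    _ ≤ _ := by
        gcongr
        exact_mod_cast Rset_card Qs s

lemma sieve_fix {r g : ℕ} {Qs : Fin r → Polynomial ℤ} {D : ℤ} (h : Setup g Qs D)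
    (t : ℝ) {T : ℝ} (htT : t ≤ T) (s : Stt r T) :
    ∏ p ∈ (primesBelow t).filter (fun p : ℕ => ¬ p ∣ amod s), (1 - rq Qs p) ≤
      (∏ p ∈ primesBelow t, (1 - rq Qs p)) *
        ∏ p : {p : ℕ // p ∈ primesBelow T}, (if s p = 0 then 1 else hq Qs p) := by
  rw [← Finset.prod_filter_mul_prod_filter_not (primesBelow t) (fun p : ℕ => p ∣ amod s)]
  set X := ∏ p ∈ (primesBelow t).filter (fun p : ℕ => ¬ p ∣ amod s), (1 - rq Qs p) with hX
  have hX0 : 0 ≤ X := by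
    apply Finset.prod_nonneg
    intro p hp
    linarith [h.rq_lt (mem_primesBelow.1 (Finset.mem_filter.1 hp).1).1]
  set A := (primesBelow t).filter (fun p : ℕ => p ∣ amod s) with hA
  have h1 : ∏ p ∈ A, hq Qs p ≤
      ∏ p : {p : ℕ // p ∈ primesBelow T}, (if s p = 0 then 1 else hq Qs p) := by
    have e : ∏ p ∈ A, hq Qs p = ∏ p : {p : ℕ // p ∈ primesBelow T}, (if (p:ℕ) ∈ A then hq Qs p else 1) := by
      rw [Finset.prod_coe_sort (primesBelow T) (fun p => if p ∈ A then hq Qs p else 1),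
        ← Finset.prod_filter]
      refine Finset.prod_congr ?_ fun _ _ => rfl
      ext p
      constructor
      · intro hp
        exact Finset.mem_filter.2 ⟨primesBelow_mono htT (Finset.mem_filter.1 hp).1, hp⟩
      · exact fun hp => (Finset.mem_filter.1 hp).2
    rw [e]
    apply Finset.prod_le_prod
    · intro p _
      have := h.hq_ge (mem_primesBelow.1 p.2).1
      split_ifs <;> linarith
    · intro p _
      have hpp := (mem_primesBelow.1 p.2).1
      have := h.hq_ge hpp
      by_cases hpA : (p:ℕ) ∈ A
      · rw [if_pos hpA, if_neg]
        intro hs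
        have hd := (Finset.mem_filter.1 hpA).2
        unfold amod at hd
        obtain ⟨q, _, hq⟩ := (Prime.dvd_finsetProd_iff hpp.prime _).1 hd
        have h2 := (Nat.prime_dvd_prime_iff_eq hpp (mem_primesBelow.1 q.2).1).1 (hpp.dvd_of_dvd_pow hq)
        have h3 : p = q := Subtype.ext h2
        subst h3
        rw [hs] at hq
        simp at hq
        exact hpp.one_lt.ne' hq
      · rw [if_neg hpA]
        split_ifs <;> linarith
  have h2 : (∏ p ∈ A, (1 - rq Qs p)) * ∏ p ∈ A, hq Qs p = 1 := by
    rw [← Finset.prod_mul_distrib]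
    apply Finset.prod_eq_one
    intro p hp
    have := h.rq_lt (mem_primesBelow.1 (Finset.mem_filter.1 hp).1).1
    unfold hq
    exact mul_inv_cancel₀ (by linarith)
  have h3 : 0 ≤ ∏ p ∈ A, (1 - rq Qs p) := by
    apply Finset.prod_nonneg
    intro p hp
    linarith [h.rq_lt (mem_primesBelow.1 (Finset.mem_filter.1 hp).1).1]
  have h4 := mul_le_mul_of_nonneg_left h1 h3
  rw [h2] at h4
  calc X = 1 * X := (one_mul _).symm
    _ ≤ _ * X := mul_le_mul_of_nonneg_right h4 hX0
    _ = _ := by ring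

lemma Wt_prod {r : ℕ} (Qs : Fin r → Polynomial ℤ) (σ : ℝ) {T : ℝ} (s : Stt r T) :
    ∏ p : {p : ℕ // p ∈ primesBelow T}, Wt Qs σ p (s p) =
      (∏ p : {p : ℕ // p ∈ primesBelow T}, (locc Qs p (s p) : ℝ)) / amod s * (amod s : ℝ) ^ σ *
        ∏ p : {p : ℕ // p ∈ primesBelow T}, (if s p = 0 then 1 else hq Qs p) := by
  have e : (amod s : ℝ) = ∏ p : {p : ℕ // p ∈ primesBelow T}, ((p:ℕ):ℝ) ^ (∑ j, s p j) := by
    unfold amod; push_cast; rfl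
  rw [e, ← Real.finsetProd_rpow _ _ (fun _ _ => by positivity), ← Finset.prod_div_distrib,
    ← Finset.prod_mul_distrib, ← Finset.prod_mul_distrib]
  refine Finset.prod_congr rfl fun p _ => ?_
  unfold Wt
  split_ifs with h0
  · rw [h0, locc_zero]; simp
  · rw [← Real.rpow_natCast ((p:ℕ):ℝ) (∑ j, s p j), ← Real.rpow_mul (by positivity), mul_comm σ]

lemma state_count' {r g : ℕ} {Qs : Fin r → Polynomial ℤ} {D : ℤ} (h : Setup g Qs D)
    (t : ℝ) (ht : 2 ≤ t) {T : ℝ} (htT : t ≤ T) (s : Stt r T) (a b : ℤ) (hab : a ≤ b)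
    (Y σ : ℝ) (hY : 0 < Y) (hσ : 0 ≤ σ) (hYa : Y ≤ amod s)
    (hL : amod s * (1 + 2 * (t ^ (8 * g + 1)) ^ 6) ≤ ((b - a : ℤ) : ℝ)) :
    (((Finset.Ico a b).filter (compat Qs t s)).card : ℝ) ≤
      4 * ((b - a : ℤ) : ℝ) * Y ^ (-σ) * ((∏ p : {p : ℕ // p ∈ primesBelow T}, Wt Qs σ p (s p)) *
        ∏ p ∈ primesBelow t, (1 - rq Qs p)) := by
  have ha0 : (0:ℝ) < amod s := by exact_mod_cast amod_pos s
  set L := ((b - a : ℤ) : ℝ) with hLd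
  have hL0 : (0:ℝ) ≤ L := by rw [hLd]; exact_mod_cast sub_nonneg.2 hab
  have h1 := state_count h t ht s a b hab
  have h2 := sieve_fix h t htT s
  set H := ∏ p : {p : ℕ // p ∈ primesBelow T}, (if s p = 0 then 1 else hq Qs p) with hH
  set lc := ∏ p : {p : ℕ // p ∈ primesBelow T}, (locc Qs p (s p) : ℝ) with hlc
  have hlc0 : 0 ≤ lc := Finset.prod_nonneg fun _ _ => by positivity
  set S := ∏ p ∈ primesBelow t, (1 - rq Qs p) with hS
  have hS0 : 0 ≤ S := by
    apply Finset.prod_nonneg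
    intro p hp
    linarith [h.rq_lt (mem_primesBelow.1 hp).1]
  have hH0 : 0 ≤ H := by
    apply Finset.prod_nonneg
    intro p _
    have := h.hq_ge (mem_primesBelow.1 p.2).1
    split_ifs <;> linarith
  have h3 : 1 + 2 * (t ^ (8 * g + 1)) ^ 6 ≤ L / amod s := by
    rw [le_div_iff₀ ha0]; linarith
  have h4 : 1 ≤ Y ^ (-σ) * (amod s : ℝ) ^ σ := by
    rw [Real.rpow_neg hY.le, inv_mul_eq_div, one_le_div (by positivity)]
    exact Real.rpow_le_rpow hY.le hYa hσ
  rw [← hLd] at h1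
  set X := ∏ p ∈ (primesBelow t).filter (fun p : ℕ => ¬ p ∣ amod s), (1 - rq Qs p) with hX
  have hX0 : 0 ≤ X := by
    apply Finset.prod_nonneg
    intro p hp
    linarith [h.rq_lt (mem_primesBelow.1 (Finset.mem_filter.1 hp).1).1]
  rw [Wt_prod, ← hlc, ← hH]
  clear_value L lc H S X
  calc _ ≤ _ := h1
    _ ≤ lc * (2 * (2 * (L / amod s)) * (S * H)) := by
        have : L / amod s + 1 + 2 * (t ^ (8 * g + 1)) ^ 6 ≤ 2 * (L / amod s) := by linarith
        gcongr
    _ = 4 * L * (lc / amod s * H * S) := by ring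
    _ ≤ 4 * L * (lc / amod s * H * S) * (Y ^ (-σ) * (amod s : ℝ) ^ σ) :=
        le_mul_of_one_le_right (by positivity) h4
    _ = _ := by
        ring

lemma card_le_sum_compat {α : Type*} (I A : Finset ℤ) (S : Finset α) (G : α → ℤ → Prop)
    (hA : A ⊆ I) (hw : ∀ n ∈ A, ∃ s ∈ S, G s n) :
    (A.card : ℝ) ≤ ∑ s ∈ S, ((I.filter (G s)).card : ℝ) := by
  have : A ⊆ S.biUnion (fun s => I.filter (G s)) := by
    intro n hn
    obtain ⟨s, hs, hG⟩ := hw n hn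
    exact Finset.mem_biUnion.2 ⟨s, hs, Finset.mem_filter.2 ⟨hA hn, hG⟩⟩
  exact_mod_cast (Finset.card_le_card this).trans Finset.card_biUnion_le

/-- crude count -/
theorem count_crude {r g : ℕ} {Qs : Fin r → Polynomial ℤ} {D : ℤ} (h : Setup g Qs D)
    (t : ℝ) (ht : 2 ≤ t) {T : ℝ} (htT : t ≤ T) (a b : ℤ) (hab : a ≤ b)
    (Y κ : ℝ) (hY : 0 < Y) (hκ0 : 0 ≤ κ) (hσ : κ * (4 * g) ≤ Real.log T) (B : ℕ) (hB : 1 ≤ B)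
    (A : Finset ℤ) (hA : A ⊆ Finset.Ico a b)
    (hw : ∀ n ∈ A, ∃ s ∈ SttF r T B, compat Qs t s n ∧ Y ≤ amod s ∧
      amod s * (1 + 2 * (t ^ (8 * g + 1)) ^ 6) ≤ ((b - a : ℤ) : ℝ)) :
    (A.card : ℝ) ≤ 4 * ((b - a : ℤ) : ℝ) * Y ^ (-(κ / Real.log T)) *
      Real.exp (8 * g ^ 3 * Real.exp (κ * g) * cth g r * ∑ p ∈ primesBelow T, (1:ℝ) / p) := by
  have hT := ht.trans htT
  have hlT := log_two_bd T hT
  have hL0 : (0:ℝ) ≤ ((b - a : ℤ) : ℝ) := by exact_mod_cast sub_nonneg.2 hab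
  have h1 := card_le_sum_compat (Finset.Ico a b) A ((SttF r T B).filter (fun s => Y ≤ amod s ∧
      amod s * (1 + 2 * (t ^ (8 * g + 1)) ^ 6) ≤ ((b - a : ℤ) : ℝ))) (fun s => compat Qs t s) hA
      (fun n hn => by
        obtain ⟨s, hs, h1, h2⟩ := hw n hn
        exact ⟨s, Finset.mem_filter.2 ⟨hs, h2⟩, h1⟩)
  have hsv : ∏ p ∈ primesBelow t, (1 - rq Qs p) ≤ 1 := by
    apply Finset.prod_le_one
    · intro p hp
      linarith [h.rq_lt (mem_primesBelow.1 hp).1]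
    · intro p hp
      linarith [Setup.rq_nonneg (Qs := Qs) p]
  have hW0 : ∀ s : Stt r T, 0 ≤ ∏ p : {p : ℕ // p ∈ primesBelow T}, Wt Qs (κ / Real.log T) p (s p) :=
    fun s => Finset.prod_nonneg fun p _ => h.Wt_nonneg (mem_primesBelow.1 p.2).1 _ _
  refine h1.trans ?_
  calc _ ≤ ∑ s ∈ (SttF r T B).filter (fun s => Y ≤ amod s ∧
      amod s * (1 + 2 * (t ^ (8 * g + 1)) ^ 6) ≤ ((b - a : ℤ) : ℝ)),
        4 * ((b - a : ℤ) : ℝ) * Y ^ (-(κ / Real.log T)) *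
          (∏ p : {p : ℕ // p ∈ primesBelow T}, Wt Qs (κ / Real.log T) p (s p)) := by
        refine Finset.sum_le_sum fun s hs => ?_
        obtain ⟨_, h2, h3⟩ := Finset.mem_filter.1 hs
        refine (state_count' h t ht htT s a b hab Y (κ / Real.log T) hY (by positivity) h2 h3).trans ?_
        apply mul_le_mul_of_nonneg_left _ (by positivity)
        exact mul_le_of_le_one_right (hW0 s) hsv
    _ ≤ ∑ s ∈ SttF r T B, 4 * ((b - a : ℤ) : ℝ) * Y ^ (-(κ / Real.log T)) *
          (∏ p : {p : ℕ // p ∈ primesBelow T}, Wt Qs (κ / Real.log T) p (s p)) := by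
        apply Finset.sum_le_sum_of_subset_of_nonneg (Finset.filter_subset _ _)
        intro s _ _
        have := hW0 s
        positivity
    _ ≤ _ := by
        rw [← Finset.mul_sum]
        apply mul_le_mul_of_nonneg_left _ (by positivity)
        exact crude_euler h κ T hκ0 hT hσ B hB

theorem count_N (r g : ℕ) (κ : ℝ) (hκ0 : 0 ≤ κ) : ∃ C K0 : ℝ, 0 < C ∧ 0 ≤ K0 ∧
    ∀ (Qs : Fin r → Polynomial ℤ) (D : ℤ), Setup g Qs D → ∀ (t T x : ℝ), 2 ≤ t → t ≤ T →
    T ≤ t ^ 2 → T ≤ x → κ * (4 * g) ≤ Real.log T → ∀ (B : ℕ) (f : Fin r → ℕ → ℝ),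
    (∀ j, f j 1 = 0) → ∀ k : Fin r → ℝ, ∀ (a b : ℤ), a ≤ b → ∀ Y : ℝ, 0 < Y →
    ∀ (Vals : Fin r → Finset ℝ) (Vb : ℝ), 0 ≤ Vb → (∀ j, ((Vals j).card : ℝ) ≤ Vb) →
    ∀ (A : Finset ℤ), A ⊆ Finset.Ico a b →
    (∀ n ∈ A, ∃ s ∈ SttF r T B, compat Qs t s n ∧ Y ≤ amod s ∧
      amod s * (1 + 2 * (t ^ (8 * g + 1)) ^ 6) ≤ ((b - a : ℤ) : ℝ) ∧
      ∀ j, ∃ v ∈ Vals j, ∑ p : {p : ℕ // p ∈ primesBelow T}, f j ((p:ℕ) ^ s p j) = k j - v) →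
    (A.card : ℝ) ≤ C * ((b - a : ℤ) : ℝ) * Y ^ (-(κ / Real.log T)) * Vb ^ r * Hd Qs D ^ K0 *
      Real.exp (r * g * (Real.log x / Real.log T)) *
        ∏ j, (1 / √(Ef (f j) x (fun p => (rho (Qs j) p : ℝ)))) := by
  obtain ⟨C, K0, hC, hK0, hmain⟩ := conc_euler r g κ hκ0
  refine ⟨4 * C, K0, by positivity, hK0, ?_⟩
  intro Qs D h t T x ht htT hTt hTx hσ B f hf1 k a b hab Y hY Vals Vb hVb0 hVb A hA hw
  have hT := ht.trans htT
  have hlT := log_two_bd T hT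
  have hL0 : (0:ℝ) ≤ ((b - a : ℤ) : ℝ) := by exact_mod_cast sub_nonneg.2 hab
  have hW0 : ∀ s : Stt r T, 0 ≤ ∏ p : {p : ℕ // p ∈ primesBelow T}, Wt Qs (κ / Real.log T) p (s p) :=
    fun s => Finset.prod_nonneg fun p _ => h.Wt_nonneg (mem_primesBelow.1 p.2).1 _ _
  have hsv0 : 0 ≤ ∏ p ∈ primesBelow t, (1 - rq Qs p) := by
    apply Finset.prod_nonneg
    intro p hp
    linarith [h.rq_lt (mem_primesBelow.1 hp).1]
  set R : Stt r T → Prop := fun s => Y ≤ amod s ∧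
      amod s * (1 + 2 * (t ^ (8 * g + 1)) ^ 6) ≤ ((b - a : ℤ) : ℝ) with hR
  set F : (Fin r → ℝ) → Finset (Stt r T) := fun w => (SttF r T B).filter
    (fun s => ∀ j, ∑ p : {p : ℕ // p ∈ primesBelow T}, f j ((p:ℕ) ^ s p j) = k j - w j) with hF
  set S := (Fintype.piFinset Vals).sigma (fun w => (F w).filter R) with hS
  have h1 := card_le_sum_compat (Finset.Ico a b) A S (fun ws => compat Qs t ws.2) hA (by
    intro n hn
    obtain ⟨s, hs, hc, hY, hL, hv⟩ := hw n hn
    choose v hv1 hv2 using hv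
    exact ⟨⟨v, s⟩, Finset.mem_sigma.2 ⟨Fintype.mem_piFinset.2 hv1, Finset.mem_filter.2
      ⟨Finset.mem_filter.2 ⟨hs, hv2⟩, hY, hL⟩⟩, hc⟩)
  refine h1.trans ?_
  rw [hS, Finset.sum_sigma]
  set Bd := C * Hd Qs D ^ K0 * Real.exp (r * g * (Real.log x / Real.log T)) *
        ∏ j, (1 / √(Ef (f j) x (fun p => (rho (Qs j) p : ℝ)))) with hBd
  have hBd0 : 0 ≤ Bd := by
    have := h.Hd_ge
    have : 0 ≤ ∏ j, (1 / √(Ef (f j) x (fun p => (rho (Qs j) p : ℝ)))) :=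
      Finset.prod_nonneg fun _ _ => by positivity
    positivity
  calc _ ≤ ∑ w ∈ Fintype.piFinset Vals, 4 * ((b - a : ℤ) : ℝ) * Y ^ (-(κ / Real.log T)) * Bd := by
        refine Finset.sum_le_sum fun w _ => ?_
        calc _ ≤ ∑ s ∈ (F w).filter R, 4 * ((b - a : ℤ) : ℝ) * Y ^ (-(κ / Real.log T)) *
            ((∏ p : {p : ℕ // p ∈ primesBelow T}, Wt Qs (κ / Real.log T) p (s p)) *
              ∏ p ∈ primesBelow t, (1 - rq Qs p)) := by
              refine Finset.sum_le_sum fun s hs => ?_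
              obtain ⟨_, h2, h3⟩ := Finset.mem_filter.1 hs
              exact state_count' h t ht htT s a b hab Y (κ / Real.log T) hY (by positivity) h2 h3
          _ ≤ ∑ s ∈ F w, 4 * ((b - a : ℤ) : ℝ) * Y ^ (-(κ / Real.log T)) *
            ((∏ p : {p : ℕ // p ∈ primesBelow T}, Wt Qs (κ / Real.log T) p (s p)) *
              ∏ p ∈ primesBelow t, (1 - rq Qs p)) := by
              apply Finset.sum_le_sum_of_subset_of_nonneg (Finset.filter_subset _ _)
              intro s _ _
              have := hW0 s
              positivity
          _ ≤ _ := by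
              rw [← Finset.mul_sum, ← Finset.sum_mul]
              apply mul_le_mul_of_nonneg_left _ (by positivity)
              exact hmain Qs D h t T x ht htT hTt hTx hσ B f hf1 (fun j => k j - w j)
    _ = (∏ j, ((Vals j).card : ℝ)) * (4 * ((b - a : ℤ) : ℝ) * Y ^ (-(κ / Real.log T)) * Bd) := by
        rw [Finset.sum_const, Fintype.card_piFinset, nsmul_eq_mul]; push_cast; rfl
    _ ≤ Vb ^ r * (4 * ((b - a : ℤ) : ℝ) * Y ^ (-(κ / Real.log T)) * Bd) := by
        gcongr
        calc ∏ j, ((Vals j).card : ℝ) ≤ ∏ j : Fin r, Vb :=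
              Finset.prod_le_prod (fun _ _ => by positivity) fun j _ => hVb j
          _ = Vb ^ r := by simp
    _ = _ := by rw [hBd]; ring

noncomputable def Sm (N q : ℕ) : ℕ := ∏ p ∈ (Finset.range q).filter Nat.Prime, p ^ N.factorization p

lemma Sm_pos (N q : ℕ) : 0 < Sm N q :=
  Finset.prod_pos fun p hp => pow_pos (Finset.mem_filter.1 hp).2.pos _

lemma split_smooth (N q : ℕ) (hN : N ≠ 0) : ∃ b, 0 < b ∧ N = Sm N q * b ∧ Nat.Coprime (Sm N q) b ∧
    ∀ p : ℕ, p.Prime → p ∣ b → q ≤ p := by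
  refine ⟨∏ p ∈ N.primeFactors.filter (fun p => ¬ p < q), p ^ N.factorization p, ?_, ?_, ?_, ?_⟩
  · exact Finset.prod_pos fun p hp =>
      pow_pos (Nat.prime_of_mem_primeFactors (Finset.mem_filter.1 hp).1).pos _
  · have h1 : Sm N q = ∏ p ∈ N.primeFactors.filter (fun p => p < q), p ^ N.factorization p := by
      unfold Sm
      symm
      apply Finset.prod_subset
      · intro p hp
        obtain ⟨h1, h2⟩ := Finset.mem_filter.1 hp
        exact Finset.mem_filter.2 ⟨Finset.mem_range.2 h2, Nat.prime_of_mem_primeFactors h1⟩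
      · intro p hp hp'
        obtain ⟨h1, h2⟩ := Finset.mem_filter.1 hp
        have : p ∉ N.primeFactors := fun h3 => hp' (Finset.mem_filter.2 ⟨h3, Finset.mem_range.1 h1⟩)
        rw [← Nat.support_factorization, Finsupp.notMem_support_iff] at this
        rw [this, pow_zero]
    rw [h1, Finset.prod_filter_mul_prod_filter_not]
    exact (Nat.prod_factorization_pow_eq_self hN).symm
  · unfold Sm
    apply Nat.Coprime.prod_left
    intro p hp
    apply Nat.Coprime.prod_right
    intro p' hp'
    obtain ⟨h1, h2⟩ := Finset.mem_filter.1 hp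
    obtain ⟨h3, h4⟩ := Finset.mem_filter.1 hp'
    apply Nat.Coprime.pow
    rw [Nat.coprime_primes h2 (Nat.prime_of_mem_primeFactors h3)]
    rintro rfl
    exact h4 (Finset.mem_range.1 h1)
  · intro p hp hd
    obtain ⟨p', hp', hd'⟩ := (Prime.dvd_finsetProd_iff hp.prime _).1 hd
    obtain ⟨h3, h4⟩ := Finset.mem_filter.1 hp'
    have := (Nat.prime_dvd_prime_iff_eq hp (Nat.prime_of_mem_primeFactors h3)).1 (hp.dvd_of_dvd_pow hd')
    omega

lemma additive_prod (f : ℕ → ℝ) (hf : ∀ m n : ℕ, Nat.Coprime m n → f (m * n) = f m + f n)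
    (P : Finset ℕ) (hP : ∀ p ∈ P, p.Prime) (e : ℕ → ℕ) :
    f (∏ p ∈ P, p ^ e p) = ∑ p ∈ P, f (p ^ e p) := by
  induction P using Finset.induction_on with
  | empty =>
    have := hf 1 1 (by simp)
    simp at this ⊢
    exact this
  | insert a s ha ih =>
    rw [Finset.prod_insert ha, Finset.sum_insert ha, hf, ih (fun p hp => hP p (Finset.mem_insert_of_mem hp))]
    apply Nat.Coprime.prod_right
    intro p hp
    apply Nat.Coprime.pow
    rw [Nat.coprime_primes (hP a (Finset.mem_insert_self _ _)) (hP p (Finset.mem_insert_of_mem hp))]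
    rintro rfl
    exact ha hp

lemma sub_sum_cut {M : Type*} [AddCommMonoid M] (T : ℝ) (q : ℕ) (hq : (q:ℝ) ≤ T + 1) (F : ℕ → M)
    (G : ℕ → M) (hG : ∀ p, p < q → F p = G p) (h0 : ∀ p, ¬ p < q → F p = 0) :
    ∑ p : {p : ℕ // p ∈ primesBelow T}, F p = ∑ p ∈ (Finset.range q).filter Nat.Prime, G p := by
  rw [Finset.sum_coe_sort (primesBelow T) F]
  have hsub : (Finset.range q).filter Nat.Prime ⊆ primesBelow T := by
    intro p hp
    obtain ⟨h1, h2⟩ := Finset.mem_filter.1 hp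
    refine mem_primesBelow.2 ⟨h2, ?_⟩
    have : (p:ℝ) + 1 ≤ q := by exact_mod_cast Finset.mem_range.1 h1
    linarith
  rw [← Finset.sum_subset hsub (fun p hp hp' => h0 p (fun h => hp' (Finset.mem_filter.2
    ⟨Finset.mem_range.2 h, (mem_primesBelow.1 hp).1⟩)))]
  refine Finset.sum_congr rfl fun p hp => hG p (Finset.mem_range.1 (Finset.mem_filter.1 hp).1)

lemma sub_prod_cut {M : Type*} [CommMonoid M] (T : ℝ) (q : ℕ) (hq : (q:ℝ) ≤ T + 1) (F : ℕ → M)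
    (G : ℕ → M) (hG : ∀ p, p < q → F p = G p) (h0 : ∀ p, ¬ p < q → F p = 1) :
    ∏ p : {p : ℕ // p ∈ primesBelow T}, F p = ∏ p ∈ (Finset.range q).filter Nat.Prime, G p :=
  sub_sum_cut (M := Additive M) T q hq F G hG h0

theorem witness {r : ℕ} (Qs : Fin r → Polynomial ℤ) (f : Fin r → ℕ → ℝ)
    (hf : ∀ j, ∀ m n : ℕ, Nat.Coprime m n → f j (m * n) = f j m + f j n)
    (t T : ℝ) (q : ℕ) (htq : t < q) (hqT : (q:ℝ) ≤ T + 1) (n : ℤ)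
    (hn : (∏ j, Qs j).eval n ≠ 0) (B : ℕ) (hB : ((∏ j, Qs j).eval n).natAbs < B) :
    ∃ s ∈ SttF r T B, compat Qs t s n ∧ amod s = Sm ((∏ j, Qs j).eval n).natAbs q ∧
      ∀ j, ∃ b : ℕ, 0 < b ∧ b ≤ ((∏ j, Qs j).eval n).natAbs ∧
        (∀ p : ℕ, p.Prime → p ∣ b → t < (p:ℝ)) ∧
        f j ((Qs j).eval n).natAbs =
          ∑ p : {p : ℕ // p ∈ primesBelow T}, f j ((p:ℕ) ^ s p j) + f j b := by
  set N : Fin r → ℕ := fun j => ((Qs j).eval n).natAbs with hN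
  have hprod : ((∏ j, Qs j).eval n).natAbs = ∏ j, N j := by
    rw [Polynomial.eval_prod, ← Int.natAbsHom_apply, map_prod]; rfl
  have hne : ((∏ j, Qs j).eval n).natAbs ≠ 0 := Int.natAbs_ne_zero.2 hn
  have hNj0 : ∀ j, N j ≠ 0 := by
    intro j
    rw [hprod, Finset.prod_ne_zero_iff] at hne
    exact hne j (Finset.mem_univ j)
  have hNle : ∀ j, N j ≤ ((∏ j, Qs j).eval n).natAbs := by
    intro j
    rw [hprod]
    apply Nat.le_of_dvd (by rw [← hprod]; omega)
    exact Finset.dvd_prod_of_mem _ (Finset.mem_univ j)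
  have hfact : ∀ p, (((∏ j, Qs j).eval n).natAbs).factorization p = ∑ j, (N j).factorization p := by
    intro p
    rw [hprod, Nat.factorization_prod (fun j _ => hNj0 j), Finsupp.finsetSum_apply]
  have hf1 : ∀ j, f j 1 = 0 := by
    intro j
    have := hf j 1 1 (by simp)
    simp at this
    exact this
  refine ⟨fun p j => if (p:ℕ) < q then (N j).factorization p else 0, ?_, ⟨?_, ?_⟩, ?_, ?_⟩
  · unfold SttF
    rw [Fintype.mem_piFinset]
    intro p
    rw [Fintype.mem_piFinset]
    intro j
    rw [Finset.mem_range]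
    have h1 := Nat.factorization_lt (p:ℕ) (hNj0 j)
    have h2 := hNle j
    split_ifs <;> omega
  · intro p j
    dsimp only
    split_ifs
    · rw [Int.natCast_dvd]
      exact Nat.ordProj_dvd _ _
    · simp
  · intro p hp hnd hd
    apply hnd
    obtain ⟨hpp, hpt⟩ := mem_primesBelow.1 hp
    have hpq : p < q := by exact_mod_cast hpt.trans_lt htq
    have hpT : p ∈ primesBelow T := by
      refine mem_primesBelow.2 ⟨hpp, ?_⟩
      have : (p:ℝ) + 1 ≤ q := by exact_mod_cast hpq
      linarith
    refine dvd_trans ?_ (Finset.dvd_prod_of_mem _ (Finset.mem_univ ⟨p, hpT⟩))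
    apply dvd_pow_self
    simp only [hpq, if_true]
    rw [← hfact]
    rw [Int.natCast_dvd] at hd
    exact (hpp.factorization_pos_of_dvd hne hd).ne'
  · unfold amod Sm
    apply sub_prod_cut T q hqT (fun p => p ^ (∑ j, if p < q then (N j).factorization p else 0))
    · intro p hp
      simp only [hp, if_true]
      rw [hfact]
    · intro p hp
      simp [hp]
  · intro j
    obtain ⟨b, hb0, hNb, hcop, hb⟩ := split_smooth (N j) q (hNj0 j)
    refine ⟨b, hb0, ?_, ?_, ?_⟩
    · refine le_trans ?_ (hNle j)
      apply Nat.le_of_dvd (Nat.pos_of_ne_zero (hNj0 j))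
      rw [hNb]; exact Dvd.intro_left _ rfl
    · intro p hp hd
      have : (q:ℝ) ≤ p := by exact_mod_cast hb p hp hd
      linarith
    · have e : ((Qs j).eval n).natAbs = Sm (N j) q * b := hNb
      rw [e, hf j _ _ hcop]
      congr 1
      unfold Sm
      rw [additive_prod (f j) (hf j) _ (fun p hp => (Finset.mem_filter.1 hp).2)]
      symm
      apply sub_sum_cut T q hqT (fun p => f j (p ^ (if p < q then (N j).factorization p else 0)))
      · intro p hp
        simp [hp]
      · intro p hp
        simp [hp, hf1]

def Zp (Q : Polynomial ℤ) (X Y : ℝ) (n : ℤ) : Prop :=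
  ∃ q ∈ primesBelow X, ∃ m : ℕ, Y ≤ (q:ℝ) ^ m ∧ (q:ℤ) ^ m ∣ Q.eval n

lemma primesBelow_card (X : ℝ) (hX : 1 ≤ X) : ((primesBelow X).card : ℝ) ≤ X := by
  have : primesBelow X ⊆ Finset.Icc 1 ⌊X⌋₊ := by
    intro p hp
    obtain ⟨h1, h2⟩ := mem_primesBelow.1 hp
    exact Finset.mem_Icc.2 ⟨h1.one_lt.le, Nat.le_floor h2⟩
  have h := Finset.card_le_card this
  rw [Nat.card_Icc] at h
  have h2 : ((primesBelow X).card : ℝ) ≤ (⌊X⌋₊ : ℝ) := by exact_mod_cast (by omega)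
  exact h2.trans (Nat.floor_le (by linarith))

theorem Zcount {r g : ℕ} {Qs : Fin r → Polynomial ℤ} {D : ℤ} (h : Setup g Qs D)
    (X Y : ℝ) (hX : 1 ≤ X) (hY : 1 < Y) (a b : ℤ) (hab : a ≤ b) :
    (((Finset.Ico a b).filter (Zp (∏ j, Qs j) X Y)).card : ℝ) ≤
      X * ((((b - a : ℤ) : ℝ) / Y ^ (1 / g : ℝ) + 1) * g) := by
  have hg := h.g1
  have hL0 : (0:ℝ) ≤ ((b - a : ℤ) : ℝ) := by exact_mod_cast sub_nonneg.2 hab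
  have hbd : ∀ q ∈ primesBelow X, (((Finset.Ico a b).filter (fun n : ℤ => ∃ m : ℕ, Y ≤ (q:ℝ) ^ m ∧
      (q:ℤ) ^ m ∣ (∏ j, Qs j).eval n)).card : ℝ) ≤ (((b - a : ℤ) : ℝ) / Y ^ (1 / g : ℝ) + 1) * g := by
    intro q hq
    have hqp := (mem_primesBelow.1 hq).1
    have hq1 : (1:ℝ) < q := by exact_mod_cast hqp.one_lt
    have hex : ∃ m : ℕ, Y ≤ (q:ℝ) ^ m := by
      obtain ⟨m, hm⟩ := pow_unbounded_of_one_lt Y hq1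
      exact ⟨m, hm.le⟩
    set m0 := Nat.find hex with hm0
    have hm0s : Y ≤ (q:ℝ) ^ m0 := Nat.find_spec hex
    have hm01 : m0 ≠ 0 := by
      intro h0
      rw [h0] at hm0s
      simp at hm0s
      linarith
    set m' := (m0 - 1) / g + 1 with hm'
    have hgpos : 0 < g := h.hg
    have e1 : g * (m' - 1) < m0 := by
      have : g * ((m0 - 1) / g) ≤ m0 - 1 := Nat.mul_div_le _ _
      rw [hm', Nat.add_sub_cancel]
      omega
    have e2 : m0 ≤ g * m' := by
      have := Nat.lt_mul_div_succ (m0 - 1) hgpos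
      rw [hm']
      omega
    have hd := dens (∏ j, Qs j) g h.deg.le q hqp (h.nofix q hqp) m' m0 e1 a b hab
    have e3 : Y ^ (1 / g : ℝ) ≤ (q:ℝ) ^ m' := by
      calc Y ^ (1 / g : ℝ) ≤ ((q:ℝ) ^ (g * m')) ^ (1 / g : ℝ) := by
            apply Real.rpow_le_rpow (by linarith) _ (by positivity)
            exact hm0s.trans (pow_le_pow_right₀ hq1.le e2)
        _ = (q:ℝ) ^ m' := by
            rw [← Real.rpow_natCast, ← Real.rpow_mul (by linarith), ← Real.rpow_natCast]
            congr 1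
            push_cast
            field_simp
    have hYg : 0 < Y ^ (1 / g : ℝ) := by positivity
    calc _ ≤ (((Finset.Ico a b).filter (fun n => (q:ℤ) ^ m0 ∣ (∏ j, Qs j).eval n)).card : ℝ) := by
          have : (Finset.Ico a b).filter (fun n : ℤ => ∃ m : ℕ, Y ≤ (q:ℝ) ^ m ∧
              (q:ℤ) ^ m ∣ (∏ j, Qs j).eval n) ⊆
              (Finset.Ico a b).filter (fun n => (q:ℤ) ^ m0 ∣ (∏ j, Qs j).eval n) := by
            intro n hn
            obtain ⟨h1, m, h2, h3⟩ := Finset.mem_filter.1 hn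
            exact Finset.mem_filter.2 ⟨h1, (pow_dvd_pow _ (Nat.find_min' hex h2)).trans h3⟩
          exact_mod_cast Finset.card_le_card this
      _ ≤ _ := hd
      _ ≤ _ := by gcongr
  calc _ ≤ ∑ q ∈ primesBelow X, (((Finset.Ico a b).filter (fun n : ℤ => ∃ m : ℕ, Y ≤ (q:ℝ) ^ m ∧
      (q:ℤ) ^ m ∣ (∏ j, Qs j).eval n)).card : ℝ) := by
        apply card_le_sum_compat (Finset.Ico a b) _ (primesBelow X) (fun q n => ∃ m : ℕ, Y ≤ (q:ℝ) ^ m ∧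
          (q:ℤ) ^ m ∣ (∏ j, Qs j).eval n) (Finset.filter_subset _ _)
        intro n hn
        exact (Finset.mem_filter.1 hn).2
    _ ≤ ∑ q ∈ primesBelow X, (((b - a : ℤ) : ℝ) / Y ^ (1 / g : ℝ) + 1) * g := Finset.sum_le_sum hbd
    _ = (primesBelow X).card * ((((b - a : ℤ) : ℝ) / Y ^ (1 / g : ℝ) + 1) * g) := by
        rw [Finset.sum_const, nsmul_eq_mul]
    _ ≤ _ := by
        have := primesBelow_card X hX
        gcongr

lemma Zp_zero (Q : Polynomial ℤ) (X Y : ℝ) (hX : 2 ≤ X) (n : ℤ) (hn : Q.eval n = 0) : Zp Q X Y n := by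
  obtain ⟨m, hm⟩ := pow_unbounded_of_one_lt Y (by norm_num : (1:ℝ) < 2)
  exact ⟨2, mem_primesBelow.2 ⟨Nat.prime_two, by exact_mod_cast hX⟩, m, by exact_mod_cast hm.le,
    by rw [hn]; exact dvd_zero _⟩

lemma Sm_succ (N q : ℕ) : Sm N (q + 1) = Sm N q * (if q.Prime then q ^ N.factorization q else 1) := by
  unfold Sm
  rw [Finset.range_add_one, Finset.filter_insert]
  split_ifs with hq
  · rw [Finset.prod_insert (by simp), mul_comm]
  · rw [mul_one]

lemma Sm_small (N q : ℕ) (hq : q ≤ 2) : Sm N q = 1 := by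
  unfold Sm
  apply Finset.prod_eq_one
  intro p hp
  obtain ⟨h1, h2⟩ := Finset.mem_filter.1 hp
  have := h2.two_le
  have := Finset.mem_range.1 h1
  omega

lemma decomp (Q : Polynomial ℤ) (X Y : ℝ) (hX : 2 ≤ X) (hY : 1 < Y) (n : ℤ) (hZ : ¬ Zp Q X Y n) :
    Q.eval n ≠ 0 ∧ ((Sm (Q.eval n).natAbs (⌊X⌋₊ + 1) : ℝ) ≤ Y ^ 2 ∨
      ∃ q : ℕ, 2 < q ∧ (q:ℝ) ≤ X ∧ Y ≤ Sm (Q.eval n).natAbs q ∧ (Sm (Q.eval n).natAbs q : ℝ) ≤ Y ^ 2) := by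
  have h0 : Q.eval n ≠ 0 := fun h => hZ (Zp_zero Q X Y hX n h)
  refine ⟨h0, ?_⟩
  rcases le_or_gt (Sm (Q.eval n).natAbs (⌊X⌋₊ + 1) : ℝ) (Y ^ 2) with h | h
  · exact Or.inl h
  right
  set N := (Q.eval n).natAbs with hN
  have hex : ∃ q : ℕ, Y ^ 2 < Sm N (q + 1) := ⟨_, h⟩
  set q := Nat.find hex with hq
  have hq1 : Y ^ 2 < Sm N (q + 1) := Nat.find_spec hex
  have hqX : q ≤ ⌊X⌋₊ := Nat.find_min' hex h
  have hqX' : (q:ℝ) ≤ X := (Nat.cast_le.2 hqX).trans (Nat.floor_le (by linarith))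
  have hle : (Sm N q : ℝ) ≤ Y ^ 2 := by
    rcases Nat.eq_zero_or_pos q with h1 | h1
    · rw [h1, Sm_small _ _ (by norm_num)]
      push_cast
      nlinarith
    · have := Nat.find_min hex (m := q - 1) (by omega)
      rw [not_lt, Nat.sub_add_cancel h1] at this
      exact this
  have hYle : Y ≤ Sm N q := by
    rw [Sm_succ] at hq1
    split_ifs at hq1 with hp
    · have hlt : (q:ℝ) ^ (N.factorization q) < Y := by
        by_contra hcon
        push Not at hcon
        apply hZ
        refine ⟨q, mem_primesBelow.2 ⟨hp, hqX'⟩, N.factorization q, hcon, ?_⟩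
        rw [← Int.natCast_pow, Int.natCast_dvd]
        exact Nat.ordProj_dvd _ _
      push_cast at hq1
      have hq0 : (0:ℝ) < (q:ℝ) ^ (N.factorization q) := by
        have := hp.pos
        positivity
      have hS0 : (0:ℝ) < Sm N q := by exact_mod_cast Sm_pos N q
      nlinarith
    · rw [mul_one] at hq1
      linarith
  refine ⟨q, ?_, hqX', hYle, hle⟩
  by_contra hcon
  rw [Sm_small N q (by omega)] at hYle
  push_cast at hYle
  linarith

lemma eval_bound (Q : Polynomial ℤ) (g : ℕ) (hg : Q.natDegree ≤ g) (n : ℤ) (X : ℝ) (hX : 1 ≤ X) (hn0 : 0 ≤ n)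
    (hn : (n:ℝ) ≤ X) : ((Q.eval n).natAbs : ℝ) ≤ (g + 1) * polyNorm Q * X ^ g := by
  have h1 : ((Q.eval n).natAbs : ℝ) = |((Q.eval n : ℤ) : ℝ)| := by
    rw [Nat.cast_natAbs]; push_cast; rfl
  rw [h1, Polynomial.eval_eq_sum_range' (Nat.lt_succ_of_le hg)]
  push_cast
  have hnR : (0:ℝ) ≤ n := by exact_mod_cast hn0
  have hc : ∀ i, |((Q.coeff i : ℤ):ℝ)| ≤ polyNorm Q := by
    intro i
    have e : |((Q.coeff i : ℤ):ℝ)| = ((Q.coeff i).natAbs : ℝ) := by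
      rw [Nat.cast_natAbs]; push_cast; rfl
    rw [e]
    unfold polyNorm
    by_cases hi : i ∈ Q.support
    · exact_mod_cast Finset.le_sup (f := fun i => (Q.coeff i).natAbs) hi
    · rw [Polynomial.notMem_support_iff.1 hi]
      simp
  calc _ ≤ ∑ i ∈ Finset.range (g + 1), |((Q.coeff i : ℤ):ℝ) * (n:ℝ) ^ i| := Finset.abs_sum_le_sum_abs _ _
    _ ≤ ∑ i ∈ Finset.range (g + 1), polyNorm Q * X ^ g := by
        refine Finset.sum_le_sum fun i hi => ?_
        have hi : i ≤ g := by have := Finset.mem_range.1 hi; omega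
        rw [abs_mul, abs_of_nonneg (by positivity : (0:ℝ) ≤ (n:ℝ) ^ i)]
        have : (n:ℝ) ^ i ≤ X ^ g :=
          (pow_le_pow_left₀ hnR hn i).trans (pow_le_pow_right₀ hX hi)
        have := hc i
        have h0 : 0 ≤ polyNorm Q := by unfold polyNorm; positivity
        gcongr
    _ = _ := by
        rw [Finset.sum_const, Finset.card_range, nsmul_eq_mul]; push_cast; ring

lemma polyNorm_ge (Q : Polynomial ℤ) (h : Q ≠ 0) : 1 ≤ polyNorm Q := by
  unfold polyNorm
  have h1 := Finset.le_sup (f := fun i => (Q.coeff i).natAbs) (Polynomial.natDegree_mem_support_of_nonzero h)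
  have h2 : 1 ≤ (Q.coeff Q.natDegree).natAbs := by
    have : Q.coeff Q.natDegree ≠ 0 := by simpa using h
    omega
  exact_mod_cast h2.trans h1

lemma Ef_ge (f : ℕ → ℝ) (x : ℝ) (Q : Polynomial ℤ) : 1 ≤ Ef f x (fun p => (rho Q p : ℝ)) := by
  unfold Ef
  have : 0 ≤ ∑ p ∈ (primesBelow x).filter (fun p => f p ≠ 0), (rho Q p : ℝ) / p :=
    Finset.sum_nonneg fun _ _ => by positivity
  linarith

lemma Ef_le {r g : ℕ} {Qs : Fin r → Polynomial ℤ} {D : ℤ} (h : Setup g Qs D) (f : ℕ → ℝ) (x : ℝ)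
    (hx : 3 ≤ x) (hl : 1 ≤ Real.log x) (j : Fin r) :
    √(Ef f x (fun p => (rho (Qs j) p : ℝ))) ≤ 40 * g * Real.log x := by
  have hg := h.g1
  have h1 : Ef f x (fun p => (rho (Qs j) p : ℝ)) ≤ 40 * g * Real.log x := by
    unfold Ef
    have : ∑ p ∈ (primesBelow x).filter (fun p => f p ≠ 0), (rho (Qs j) p : ℝ) / p ≤
        ∑ p ∈ primesBelow x, g * ((1:ℝ) / p) := by
      calc _ ≤ ∑ p ∈ primesBelow x, (rho (Qs j) p : ℝ) / p :=
            Finset.sum_le_sum_of_subset_of_nonneg (Finset.filter_subset _ _) fun _ _ _ => by positivity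
        _ ≤ _ := by
            refine Finset.sum_le_sum fun p hp => ?_
            rw [mul_one_div]
            exact (Setup.rqj_le p j).trans (h.rq_le (mem_primesBelow.1 hp).1)
    rw [← Finset.mul_sum] at this
    have h2 := recip_sum x hx
    have h3 : Real.log (Real.log x) ≤ Real.log x := Real.log_le_self (by linarith)
    have h4 : (g:ℝ) * ∑ p ∈ primesBelow x, (1:ℝ) / p ≤ g * (32 * Real.log x) := by
      gcongr
      linarith
    nlinarith
  rw [Real.sqrt_le_left (by positivity)]
  have : 1 ≤ 40 * g * Real.log x := by nlinarith
  nlinarith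

theorem level_count (r g V : ℕ) (hV : 1 ≤ V) (κ B' : ℝ) (hκ0 : 0 ≤ κ) (hB' : 1 ≤ B') :
    ∃ C K0 : ℝ, 0 < C ∧ 0 ≤ K0 ∧
    ∀ (Qs : Fin r → Polynomial ℤ) (D : ℤ), Setup g Qs D → ∀ (t T x : ℝ), 2 ≤ t → t ≤ T →
    T ≤ t ^ 2 → T ≤ x → κ * (4 * g) ≤ Real.log T → ∀ (f : Fin r → ℕ → ℝ),
    (∀ j, ∀ m n : ℕ, Nat.Coprime m n → f j (m * n) = f j m + f j n) →
    (∀ j, ∀ u : ℝ, 1 ≤ u →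
          (({v : ℝ | ∃ n : ℕ, 0 < n ∧ (n : ℝ) ≤ t ^ u ∧
              (∀ p : ℕ, p.Prime → p ∣ n → t < (p : ℝ)) ∧ f j n = v}).ncard : ℝ) ≤ (V : ℝ) ^ u) →
    ∀ k : Fin r → ℝ, ∀ (a b : ℤ), a ≤ b → ∀ Y : ℝ, 0 < Y → ∀ W : ℝ,
    W * (1 + 2 * (t ^ (8 * g + 1)) ^ 6) ≤ ((b - a : ℤ) : ℝ) →
    ∀ (A : Finset ℤ), A ⊆ Finset.Ico a b →
    (∀ n ∈ A, (∏ j, Qs j).eval n ≠ 0 ∧ ((((∏ j, Qs j).eval n).natAbs : ℕ) : ℝ) ≤ x ^ B' ∧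
      (∀ j, f j ((Qs j).eval n).natAbs = k j) ∧
      ∃ q : ℕ, t < q ∧ (q:ℝ) ≤ T + 1 ∧ Y ≤ Sm ((∏ j, Qs j).eval n).natAbs q ∧
        (Sm ((∏ j, Qs j).eval n).natAbs q : ℝ) ≤ W) →
    (A.card : ℝ) ≤ C * ((b - a : ℤ) : ℝ) * Y ^ (-(κ / Real.log T)) *
      Real.exp ((2 * r * B' * Real.log V + r * g) * (Real.log x / Real.log T)) * Hd Qs D ^ K0 *
        ∏ j, (1 / √(Ef (f j) x (fun p => (rho (Qs j) p : ℝ)))) := by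
  obtain ⟨C, K0, hC, hK0, hmain⟩ := count_N r g κ hκ0
  refine ⟨C, K0, hC, hK0, ?_⟩
  intro Qs D h t T x ht htT hTt hTx hσ f hf hval k a b hab Y hY W hW A hA hw
  have hT := ht.trans htT
  have hlT := log_two_bd T hT
  have hlt := log_two_bd t ht
  have hL0 : (0:ℝ) ≤ ((b - a : ℤ) : ℝ) := by exact_mod_cast sub_nonneg.2 hab
  have hf1 : ∀ j, f j 1 = 0 := by
    intro j
    have := hf j 1 1 (by simp)
    simp at this
    exact this
  have hltT : Real.log T ≤ 2 * Real.log t := by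
    have := Real.log_le_log (by linarith) hTt
    rwa [Real.log_pow, Nat.cast_ofNat] at this
  have hlTx : Real.log T ≤ Real.log x := Real.log_le_log (by linarith) hTx
  have hlttT : Real.log t ≤ Real.log T := Real.log_le_log (by linarith) htT
  have hVR : (1:ℝ) ≤ V := by exact_mod_cast hV
  have hlV : 0 ≤ Real.log V := Real.log_nonneg hVR
  obtain ⟨u, hu⟩ : ∃ u, u = B' * Real.log x / Real.log t := ⟨_, rfl⟩
  have hu1 : 1 ≤ u := by
    rw [hu, le_div_iff₀ (by linarith)]
    nlinarith
  have hxpos : 0 < x := by linarith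
  have htu : t ^ u = x ^ B' := by
    rw [Real.rpow_def_of_pos (by linarith), Real.rpow_def_of_pos hxpos, hu]
    congr 1
    field_simp
  obtain ⟨S, hS⟩ : ∃ S : Finset ℕ, ∀ n, n ∈ S ↔ 0 < n ∧ (n:ℝ) ≤ x ^ B' ∧
      (∀ p : ℕ, p.Prime → p ∣ n → t < (p : ℝ)) := by
    refine ⟨(Finset.range (⌊x ^ B'⌋₊ + 1)).filter (fun n : ℕ => 0 < n ∧ (n:ℝ) ≤ x ^ B' ∧
      (∀ p : ℕ, p.Prime → p ∣ n → t < (p : ℝ))), fun n => ?_⟩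
    rw [Finset.mem_filter, Finset.mem_range]
    constructor
    · exact fun h => h.2
    · exact fun h => ⟨Nat.lt_succ_of_le (Nat.le_floor h.2.1), h⟩
  have hVals : ∀ j, (((S.image (f j)).card : ℕ) : ℝ) ≤ (V:ℝ) ^ u := by
    intro j
    have h1 := hval j u hu1
    have h2 : {v : ℝ | ∃ n : ℕ, 0 < n ∧ (n : ℝ) ≤ t ^ u ∧
              (∀ p : ℕ, p.Prime → p ∣ n → t < (p : ℝ)) ∧ f j n = v} = ↑(S.image (f j)) := by
      ext v
      rw [Finset.coe_image]
      simp only [Set.mem_ofPred_eq, Set.mem_image, Finset.mem_coe, hS, htu]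
      constructor
      · rintro ⟨n, a, b, c, d⟩
        exact ⟨n, ⟨a, b, c⟩, d⟩
      · rintro ⟨n, ⟨a, b, c⟩, d⟩
        exact ⟨n, a, b, c, d⟩
    rw [h2, Set.ncard_coe_finset] at h1
    exact h1
  have hm := hmain Qs D h t T x ht htT hTt hTx hσ (⌊x ^ B'⌋₊ + 1) f hf1 k a b hab Y hY
    (fun j => S.image (f j)) ((V:ℝ) ^ u) (by positivity) hVals A hA (by
      intro n hn
      obtain ⟨h1, h2, h3, q, h4, h5, h6, h7⟩ := hw n hn
      obtain ⟨s, s1, s2, s3, s4⟩ := witness Qs f hf t T q h4 h5 n h1 (⌊x ^ B'⌋₊ + 1)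
        (Nat.lt_succ_of_le (Nat.le_floor h2))
      refine ⟨s, s1, s2, by rw [s3]; exact h6, ?_, ?_⟩
      · rw [s3]
        refine le_trans ?_ hW
        gcongr
      · intro j
        obtain ⟨b, b1, b2, b3, b4⟩ := s4 j
        refine ⟨f j b, Finset.mem_image_of_mem _ ((hS b).2 ⟨b1, ?_, b3⟩), ?_⟩
        · exact le_trans (by exact_mod_cast b2) h2
        · rw [← h3 j, b4]; ring)
  refine hm.trans ?_
  have hH := h.Hd_ge
  have hP : 0 ≤ ∏ j, (1 / √(Ef (f j) x (fun p => (rho (Qs j) p : ℝ)))) :=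
    Finset.prod_nonneg fun _ _ => by positivity
  have hkey : ((V:ℝ) ^ u) ^ r * Real.exp (r * g * (Real.log x / Real.log T)) ≤
      Real.exp ((2 * r * B' * Real.log V + r * g) * (Real.log x / Real.log T)) := by
    rw [Real.rpow_def_of_pos (by linarith), ← Real.exp_nat_mul, ← Real.exp_add]
    apply Real.exp_le_exp.2
    have hu2 : u ≤ 2 * B' * (Real.log x / Real.log T) := by
      rw [hu, mul_div_assoc', div_le_div_iff₀ (by linarith) (by linarith)]
      have : 0 ≤ B' * Real.log x := by
        apply mul_nonneg <;> linarith
      nlinarith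
    have : (r:ℝ) * (Real.log V * u) ≤ r * (Real.log V * (2 * B' * (Real.log x / Real.log T))) := by
      gcongr
    linarith
  have hHK : 0 ≤ Hd Qs D ^ K0 := by positivity
  calc _ = C * ((b - a : ℤ) : ℝ) * Y ^ (-(κ / Real.log T)) * (((V:ℝ) ^ u) ^ r *
      Real.exp (r * g * (Real.log x / Real.log T))) * Hd Qs D ^ K0 *
        ∏ j, (1 / √(Ef (f j) x (fun p => (rho (Qs j) p : ℝ)))) := by ring
    _ ≤ _ := by gcongr

theorem level_crude {r g : ℕ} {Qs : Fin r → Polynomial ℤ} {D : ℤ} (h : Setup g Qs D)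
    {T : ℝ} (htT : 2 ≤ T) (a b : ℤ) (hab : a ≤ b)
    (Y : ℝ) (hY : 0 < Y) (hσ : 4 * (g:ℝ) ≤ Real.log T) (B : ℝ) (W : ℝ)
    (hW : W * (1 + 2 * ((2:ℝ) ^ (8 * g + 1)) ^ 6) ≤ ((b - a : ℤ) : ℝ))
    (A : Finset ℤ) (hA : A ⊆ Finset.Ico a b)
    (hw : ∀ n ∈ A, (∏ j, Qs j).eval n ≠ 0 ∧ ((((∏ j, Qs j).eval n).natAbs : ℕ) : ℝ) ≤ B ∧
      ∃ q : ℕ, 2 < q ∧ (q:ℝ) ≤ T + 1 ∧ Y ≤ Sm ((∏ j, Qs j).eval n).natAbs q ∧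
        (Sm ((∏ j, Qs j).eval n).natAbs q : ℝ) ≤ W) :
    (A.card : ℝ) ≤ 4 * ((b - a : ℤ) : ℝ) * Y ^ (-(1 / Real.log T)) *
      Real.exp (8 * g ^ 3 * Real.exp g * cth g r * ∑ p ∈ primesBelow T, (1:ℝ) / p) := by
  have hm := count_crude h 2 le_rfl htT a b hab Y 1 hY zero_le_one (by linarith) (⌊B⌋₊ + 1) (by omega)
    A hA (by
      intro n hn
      obtain ⟨h1, h2, q, h4, h5, h6, h7⟩ := hw n hn
      obtain ⟨s, s1, s2, s3, s4⟩ := witness Qs (fun _ _ => (0:ℝ)) (by simp) 2 T q (by exact_mod_cast h4) h5 n h1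
        (⌊B⌋₊ + 1) (Nat.lt_succ_of_le (Nat.le_floor h2))
      refine ⟨s, s1, s2, by rw [s3]; exact h6, ?_⟩
      rw [s3]
      refine le_trans ?_ hW
      gcongr)
  rw [one_mul] at hm
  exact hm

open Filter in
lemma log_pow_event (A B e s : ℝ) (he : 0 < e) (hs : 0 < s) :
    ∀ᶠ l : ℝ in atTop, A + B * Real.log l ≤ e * l ^ s := by
  have h1 : ∀ᶠ l : ℝ in atTop, A ≤ e / 2 * l ^ s :=
    ((tendsto_rpow_atTop hs).const_mul_atTop (by positivity : 0 < e / 2)).eventually_ge_atTop A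
  have h2 : ∀ᶠ l : ℝ in atTop, ‖Real.log l‖ ≤ (e / (2 * (|B| + 1))) * ‖l ^ s‖ :=
    (isLittleO_log_rpow_atTop hs).bound (by positivity)
  filter_upwards [h1, h2, eventually_ge_atTop 1] with l h1 h2 h3
  rw [Real.norm_eq_abs, Real.norm_eq_abs, abs_of_nonneg (by positivity : 0 ≤ l ^ s)] at h2
  have h4 : B * Real.log l ≤ |B| * |Real.log l| := by
    rw [← abs_mul]; exact le_abs_self _
  have h5 : |B| * |Real.log l| ≤ (|B| + 1) * ((e / (2 * (|B| + 1))) * l ^ s) := by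
    gcongr
    linarith
  have h6 : (|B| + 1) * ((e / (2 * (|B| + 1))) * l ^ s) = e / 2 * l ^ s := by
    have : |B| + 1 ≠ 0 := by positivity
    field_simp
  linarith

open Filter in
lemma large_l (r g : ℕ) (hg : 1 ≤ g) (c ε lam η κ : ℝ) (hε : 0 < ε) (hη : 0 < η) (hlam : 0 < lam) (hlam1 : lam < 1) :
    ∀ᶠ l : ℝ in atTop, 2 ≤ l ∧ (g + 1) * 2 ^ g ≤ Real.exp l ∧ 6 ≤ Real.exp (ε / 4 * l) ∧
      κ * (4 * g) ≤ l ^ (1 - lam) ∧ 4 * (g:ℝ) ≤ l ^ (1 - lam) ∧ 2 ≤ l ^ (1 - lam) ∧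
      l ^ (1 - lam) ≤ η * l ∧
      (40 * g * l) ^ r ≤ Real.exp (ε / (8 * g) * l) ∧
      (40 * g * l) ^ r * Real.exp (c * (16 * Real.log (2 * l ^ (1 - lam)) + 16)) ≤
        Real.exp (ε / 8 * l ^ lam) := by
  have hgR : (1:ℝ) ≤ g := by exact_mod_cast hg
  have hE : Tendsto (fun l : ℝ => Real.exp (ε / 4 * l)) atTop atTop :=
    Real.tendsto_exp_atTop.comp (tendsto_id.const_mul_atTop (by positivity))
  have hp : Tendsto (fun l : ℝ => l ^ (1 - lam)) atTop atTop := tendsto_rpow_atTop (by linarith)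
  have hq : Tendsto (fun l : ℝ => η * l ^ lam) atTop atTop :=
    (tendsto_rpow_atTop hlam).const_mul_atTop hη
  have e1 := log_pow_event (r * Real.log (40 * g)) r (ε / (8 * g)) 1 (by positivity) one_pos
  have e2 := log_pow_event (r * Real.log (40 * g) + 16 * c * Real.log 2 + 16 * c) (r + 16 * c * (1 - lam))
    (ε / 8) lam (by positivity) hlam
  filter_upwards [eventually_ge_atTop 2, Real.tendsto_exp_atTop.eventually_ge_atTop ((g + 1) * 2 ^ g),
    hE.eventually_ge_atTop 6, hp.eventually_ge_atTop (κ * (4 * g)), hp.eventually_ge_atTop (4 * g),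
    hp.eventually_ge_atTop 2, hq.eventually_ge_atTop 1, e1, e2] with l h1 h2 h3 h4 h5 h6 h7 h8 h9
  have hl : 0 < l := by linarith
  have hpow : (40 * g * l) ^ r = Real.exp (r * Real.log (40 * g) + r * Real.log l) := by
    rw [← mul_add, ← Real.log_mul (by positivity) (by positivity), Real.exp_nat_mul,
      Real.exp_log (by positivity)]
  refine ⟨h1, h2, h3, h4, h5, h6, ?_, ?_, ?_⟩
  · have : l = l ^ (1 - lam) * l ^ lam := by
      rw [← Real.rpow_add hl]; simp
    have h0 : 0 < l ^ (1 - lam) := by positivity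
    calc l ^ (1 - lam) = l ^ (1 - lam) * 1 := by ring
      _ ≤ l ^ (1 - lam) * (η * l ^ lam) := by gcongr
      _ = η * (l ^ (1 - lam) * l ^ lam) := by ring
      _ = _ := by rw [← this]
  · rw [hpow]
    rw [Real.rpow_one] at h8
    exact Real.exp_le_exp.2 h8
  · rw [hpow, ← Real.exp_add]
    apply Real.exp_le_exp.2
    rw [Real.log_mul (x := 2) (y := l ^ (1 - lam)) (by norm_num) (by positivity), Real.log_rpow hl]
    linarith

/-- choosing the dyadic level -/
lemma level_exists (s q : ℝ) (hq : 1 < q) (hs : q ≤ Real.exp s) :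
    ∃ i : ℕ, Real.exp (s / 2 ^ (i + 1)) < q ∧ q ≤ Real.exp (s / 2 ^ i) := by
  have hlq : 0 < Real.log q := Real.log_pos hq
  have hex : ∃ i : ℕ, s / 2 ^ (i + 1) < Real.log q := by
    obtain ⟨m, hm⟩ := pow_unbounded_of_one_lt (s / Real.log q) (by norm_num : (1:ℝ) < 2)
    refine ⟨m, ?_⟩
    rw [div_lt_iff₀ hlq] at hm
    rw [div_lt_iff₀ (by positivity), pow_succ]
    nlinarith [pow_pos (by norm_num : (0:ℝ) < 2) m]
  refine ⟨Nat.find hex, ?_, ?_⟩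
  · rw [← Real.lt_log_iff_exp_lt (by linarith)]
    exact Nat.find_spec hex
  · rw [← Real.log_le_iff_le_exp (by linarith)]
    rcases Nat.eq_zero_or_pos (Nat.find hex) with h | h
    · rw [h, pow_zero, div_one]
      rwa [Real.log_le_iff_le_exp (by linarith)]
    · have := Nat.find_min hex (m := Nat.find hex - 1) (by omega)
      rw [not_lt, Nat.sub_add_cancel h] at this
      exact this

lemma geo_sum (η : ℝ) (hη : 0 < η) (hη1 : η ≤ 1) (N : ℕ) :
    ∑ i ∈ Finset.range N, Real.exp (-(2 ^ i / η)) ≤ 1 := by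
  have h1 : ∀ i ∈ Finset.range N, Real.exp (-(2 ^ i / η)) ≤ (1 / 2 : ℝ) ^ i * (1 / 2) := by
    intro i _
    have a1 : ((i:ℝ) + 1) ≤ 2 ^ i := by exact_mod_cast Nat.lt_two_pow_self
    have a2 : (2:ℝ) ^ i ≤ 2 ^ i / η := by
      rw [le_div_iff₀ hη]
      nlinarith [pow_pos (by norm_num : (0:ℝ) < 2) i]
    have a3 : Real.exp (-1) ≤ 1 / 2 := by
      rw [Real.exp_neg, inv_eq_one_div]
      apply one_div_le_one_div_of_le (by norm_num)
      linarith [Real.add_one_le_exp 1]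
    calc Real.exp (-(2 ^ i / η)) ≤ Real.exp (((i + 1 : ℕ):ℝ) * (-1)) := by
          apply Real.exp_le_exp.2
          push_cast
          linarith
      _ = Real.exp (-1) ^ (i + 1) := by rw [Real.exp_nat_mul]
      _ ≤ (1 / 2 : ℝ) ^ (i + 1) := by gcongr
      _ = _ := by rw [pow_succ]
  refine (Finset.sum_le_sum h1).trans ?_
  rw [← Finset.sum_mul]
  have := sum_geometric_two_le N
  linarith

lemma zarith (g : ℕ) (hg : 1 ≤ g) (ε η l y L : ℝ) (hl : 0 ≤ l) (hL : L ≤ 2 * y)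
    (hy : Real.exp (ε * l) < y) (h1 : η ≤ ε / (8 * g)) (h2 : η + ε / (8 * g) ≤ ε) :
    Real.exp (η * l) * ((L / Real.exp (ε / 4 * l) ^ (1 / g : ℝ) + 1) * g) ≤
      3 * g * y * Real.exp (-(ε / (8 * g) * l)) := by
  have hgR : (1:ℝ) ≤ g := by exact_mod_cast hg
  have hy0 : 0 < y := (Real.exp_pos _).trans hy
  rw [← Real.exp_mul]
  have e1 : Real.exp (η * l) / Real.exp (ε / 4 * l * (1 / g)) ≤ Real.exp (-(ε / (8 * g) * l)) := by
    rw [← Real.exp_sub]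
    apply Real.exp_le_exp.2
    have : ε / 4 * l * (1 / g) = 2 * (ε / (8 * g)) * l := by field_simp; ring
    rw [this]
    nlinarith
  have e2 : Real.exp (η * l) ≤ y * Real.exp (-(ε / (8 * g) * l)) := by
    calc Real.exp (η * l) ≤ Real.exp (ε * l) * Real.exp (-(ε / (8 * g) * l)) := by
          rw [← Real.exp_add]
          apply Real.exp_le_exp.2
          nlinarith
      _ ≤ _ := by gcongr
  calc _ = (L * (Real.exp (η * l) / Real.exp (ε / 4 * l * (1 / g))) + Real.exp (η * l)) * g := by
        ring
    _ ≤ (2 * y * Real.exp (-(ε / (8 * g) * l)) + y * Real.exp (-(ε / (8 * g) * l))) * g := by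
        gcongr
    _ = _ := by ring

lemma farith (ε lam l y L c S P : ℝ) (hl : 0 < l) (hy : 0 < y) (hL : L ≤ 2 * y) (hc : 0 ≤ c)
    (hS : S ≤ 16 * Real.log (2 * l ^ (1 - lam)) + 16)
    (G : ℝ) (hG : 0 < G) (hP : 1 / G ≤ P)
    (h : G * Real.exp (c * (16 * Real.log (2 * l ^ (1 - lam)) + 16)) ≤ Real.exp (ε / 8 * l ^ lam)) :
    4 * L * Real.exp (ε / 4 * l) ^ (-(1 / (2 * l ^ (1 - lam)))) * Real.exp (c * S) ≤ 8 * y * P := by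
  have e1 : Real.exp (ε / 4 * l) ^ (-(1 / (2 * l ^ (1 - lam)))) = (Real.exp (ε / 8 * l ^ lam))⁻¹ := by
    rw [← Real.exp_mul, ← Real.exp_neg]
    congr 1
    have hd : l ^ (1 - lam) ≠ 0 := by positivity
    have : l = l ^ (1 - lam) * l ^ lam := by
      rw [← Real.rpow_add hl]; simp
    have h2 : l / l ^ (1 - lam) = l ^ lam := by
      rw [div_eq_iff hd, mul_comm]; exact this
    rw [← h2]
    field_simp
    ring
  rw [e1]
  have e2 : Real.exp (c * S) ≤ Real.exp (ε / 8 * l ^ lam) * P := by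
    calc Real.exp (c * S) ≤ Real.exp (c * (16 * Real.log (2 * l ^ (1 - lam)) + 16)) := by gcongr
      _ ≤ Real.exp (ε / 8 * l ^ lam) * (1 / G) := by
          rw [mul_one_div, le_div_iff₀ hG]
          linarith
      _ ≤ _ := by gcongr
  have hE := Real.exp_pos (ε / 8 * l ^ lam)
  calc _ ≤ 4 * (2 * y) * (Real.exp (ε / 8 * l ^ lam))⁻¹ * (Real.exp (ε / 8 * l ^ lam) * P) := by
        gcongr
    _ = 8 * y * P := by field_simp; norm_num

lemma size_arith (g : ℕ) (ε η l y L t : ℝ) (hl : 0 ≤ l) (hε : 0 < ε)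
    (hη : η = ε / (24 * (8 * g + 1))) (ht0 : 0 ≤ t)
    (ht : t ≤ Real.exp (η * l)) (h6 : 6 ≤ Real.exp (ε / 4 * l)) (hy : Real.exp (ε * l) < y) (hL : y / 2 ≤ L) :
    Real.exp (ε / 4 * l) ^ 2 * (1 + 2 * (t ^ (8 * g + 1)) ^ 6) ≤ L := by
  have h1 : (t ^ (8 * g + 1)) ^ 6 ≤ Real.exp (ε / 4 * l) := by
    calc (t ^ (8 * g + 1)) ^ 6 ≤ (Real.exp (η * l) ^ (8 * g + 1)) ^ 6 := by gcongr
      _ = Real.exp (ε / 4 * l) := by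
          rw [← Real.exp_nat_mul, ← Real.exp_nat_mul]
          congr 1
          rw [hη]
          push_cast
          field_simp
          ring
  have h2 : Real.exp (ε * l) = Real.exp (ε / 4 * l) ^ 4 := by
    rw [← Real.exp_nat_mul]
    congr 1
    push_cast
    ring
  rw [h2] at hy
  set e := Real.exp (ε / 4 * l)
  have h3 : e ^ 2 * (1 + 2 * (t ^ (8 * g + 1)) ^ 6) ≤ e ^ 2 * (1 + 2 * e) := by gcongr
  have h4 : e ^ 2 * (1 + 2 * e) ≤ e ^ 4 / 2 := by
    have : 1 + 2 * e ≤ e ^ 2 / 2 := by nlinarith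
    calc _ ≤ e ^ 2 * (e ^ 2 / 2) := by gcongr
      _ = _ := by ring
  linarith

lemma prod_low {r g : ℕ} {Qs : Fin r → Polynomial ℤ} {D : ℤ} (h : Setup g Qs D) (f : Fin r → ℕ → ℝ) (x : ℝ)
    (hx : 3 ≤ x) (hl : 1 ≤ Real.log x) :
    1 / (40 * g * Real.log x) ^ r ≤ ∏ j, (1 / √(Ef (f j) x (fun p => (rho (Qs j) p : ℝ)))) := by
  have hg := h.g1
  have h1 : ∏ j : Fin r, (1 / (40 * g * Real.log x)) ≤
      ∏ j, (1 / √(Ef (f j) x (fun p => (rho (Qs j) p : ℝ)))) := by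
    apply Finset.prod_le_prod
    · intros; positivity
    · intro j _
      apply one_div_le_one_div_of_le
      · have := Ef_ge (f j) x (Qs j)
        apply Real.sqrt_pos.2
        linarith
      · exact Ef_le h (f j) x hx hl j
  rw [Finset.prod_const, Finset.card_univ, Fintype.card_fin, one_div_pow] at h1
  exact h1

lemma Q_size (Q : Polynomial ℤ) (g : ℕ) (hQg : Q.natDegree ≤ g) (δ x : ℝ) (hδ : 0 < δ) (hx1 : 1 ≤ x)
    (hg2 : (g + 1) * 2 ^ g ≤ x) (hN : polyNorm Q ^ δ ≤ x) (n : ℤ) (hn0 : 0 ≤ n) (hn : (n:ℝ) ≤ 2 * x) :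
    ((Q.eval n).natAbs : ℝ) ≤ x ^ (1 / δ + g + 1) := by
  have h1 := eval_bound Q g hQg n (2 * x) (by linarith) hn0 hn
  have hp0 : 0 ≤ polyNorm Q := by unfold polyNorm; positivity
  have h2 : polyNorm Q ≤ x ^ (1 / δ) := by
    calc polyNorm Q = (polyNorm Q ^ δ) ^ (1 / δ) := by
          rw [← Real.rpow_mul hp0]
          field_simp
          simp
      _ ≤ _ := by gcongr
  calc _ ≤ _ := h1
    _ = (g + 1) * 2 ^ g * polyNorm Q * x ^ g := by rw [mul_pow]; ring
    _ ≤ x * x ^ (1 / δ) * x ^ g := by gcongr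
    _ = x ^ (1 / δ + g + 1) := by
        rw [Real.rpow_add (by linarith), Real.rpow_add (by linarith), Real.rpow_one, Real.rpow_natCast]
        ring

set_option maxHeartbeats 4000000 in
theorem main_count (r g V : ℕ) (ε δ lam : ℝ) (hg : 1 ≤ g) (hV : 1 ≤ V)
    (hε : 0 < ε) (hε1 : ε < 1) (hδ : 0 < δ) (hlam : 0 < lam) (hlam1 : lam < 1) :
    ∃ C K0 X0 : ℝ, 0 < C ∧ 0 ≤ K0 ∧ 1 ≤ X0 ∧
      ∀ (Qs : Fin r → Polynomial ℤ) (D : ℤ), Setup g Qs D →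
        ∀ (x y : ℝ) (f : Fin r → ℕ → ℝ) (k : Fin r → ℝ), X0 ≤ x →
        polyNorm (∏ j, Qs j) ^ δ ≤ x → x ^ ε < y → y ≤ x →
        (∀ j, ∀ m n : ℕ, Nat.Coprime m n → f j (m * n) = f j m + f j n) →
        (∀ j, ∀ t u : ℝ, Real.exp ((Real.log x) ^ (1 - lam)) ≤ t → 1 ≤ u →
          (({v : ℝ | ∃ n : ℕ, 0 < n ∧ (n : ℝ) ≤ t ^ u ∧
              (∀ p : ℕ, p.Prime → p ∣ n → t < (p : ℝ)) ∧ f j n = v}).ncard : ℝ) ≤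
            (V : ℝ) ^ u) →
        ∀ A : Finset ℤ, A ⊆ Finset.Ico (⌊x⌋ + 1) (⌊x + y⌋ + 1) →
        (∀ n ∈ A, ∀ j, extZ (f j) ((Qs j).eval n) = k j) →
        (A.card : ℝ) ≤ C * y * Hd Qs D ^ K0 *
          ∏ j, (1 / √(Ef (f j) x (fun p => (rho (Qs j) p : ℝ)))) := by
  have hgR : (1:ℝ) ≤ g := by exact_mod_cast hg
  have hVR : (1:ℝ) ≤ V := by exact_mod_cast hV
  have hlV : 0 ≤ Real.log V := Real.log_nonneg hVR
  obtain ⟨η, hη⟩ : ∃ η, η = ε / (24 * (8 * g + 1)) := ⟨_, rfl⟩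
  obtain ⟨B', hB'⟩ : ∃ B', B' = 1 / δ + g + 1 := ⟨_, rfl⟩
  have hB'1 : 1 ≤ B' := by
    rw [hB']
    have : 0 < 1 / δ := by positivity
    linarith
  obtain ⟨κ1, hκ1⟩ : ∃ κ1, κ1 = 2 * r * B' * Real.log V + r * g := ⟨_, rfl⟩
  have hκ10 : 0 ≤ κ1 := by rw [hκ1]; positivity
  obtain ⟨κ, hκ⟩ : ∃ κ, κ = 4 / ε * (κ1 + 1) := ⟨_, rfl⟩
  have hκ0 : 0 ≤ κ := by rw [hκ]; positivity
  obtain ⟨c, hc⟩ : ∃ c, c = 8 * g ^ 3 * Real.exp g * cth g r := ⟨_, rfl⟩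
  have hc0 : 0 ≤ c := by
    have := cth_nonneg g r hg
    rw [hc]; positivity
  have hη0 : 0 < η := by rw [hη]; positivity
  have hηa : η ≤ ε / (8 * g) := by
    rw [hη]
    apply div_le_div_of_nonneg_left hε.le (by positivity)
    linarith
  have h8 : ε / (8 * g) ≤ ε / 8 := by
    apply div_le_div_of_nonneg_left hε.le (by positivity)
    linarith
  have hηb : η + ε / (8 * g) ≤ ε := by linarith
  have hη1 : η ≤ 1 := by linarith
  obtain ⟨C, K0, hC, hK0, hmain⟩ := level_count r g V hV κ B' hκ0 hB'1
  obtain ⟨l0, hl0⟩ := Filter.eventually_atTop.1 (large_l r g hg c ε lam η κ hε hη0 hlam hlam1)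
  refine ⟨2 * C * (Real.exp (κ1 / η) + 1) + 3 * g + 8, K0, max 1 (Real.exp l0), by positivity, hK0,
    le_max_left _ _, ?_⟩
  intro Qs D h x y f k hX0 hN hxy hyx hf hval A hA hk
  have hx1 : 1 ≤ x := (le_max_left _ _).trans hX0
  have hx0 : 0 < x := by linarith
  obtain ⟨l, hl⟩ : ∃ l, l = Real.log x := ⟨_, rfl⟩
  have hxl : x = Real.exp l := by rw [hl, Real.exp_log hx0]
  have hll0 : l0 ≤ l := by
    rw [hl, Real.le_log_iff_exp_le hx0]
    exact (le_max_right _ _).trans hX0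
  obtain ⟨L1, L2, L3, L4, L5, L6, L7, L8, L9⟩ := hl0 l hll0
  rw [← hl] at hval
  have hlpos : 0 < l := by linarith
  have hx3 : 3 ≤ x := by
    rw [hxl]
    linarith [Real.add_one_le_exp l]
  have hxe : x ^ ε = Real.exp (ε * l) := by
    rw [hxl, ← Real.exp_mul, mul_comm]
  rw [hxe] at hxy
  have hy2 : 2 ≤ y := by
    have : Real.exp (ε / 4 * l) ≤ Real.exp (ε * l) := by
      apply Real.exp_le_exp.2
      exact mul_le_mul_of_nonneg_right (by linarith only [hε]) hlpos.le
    linarith only [this, L3, hxy]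
  obtain ⟨a, ha⟩ : ∃ a, a = ⌊x⌋ + 1 := ⟨_, rfl⟩
  obtain ⟨b, hb⟩ : ∃ b, b = ⌊x + y⌋ + 1 := ⟨_, rfl⟩
  rw [← ha, ← hb] at hA
  have hab : a ≤ b := by
    rw [ha, hb]
    have : ⌊x⌋ ≤ ⌊x + y⌋ := Int.floor_le_floor (by linarith)
    omega
  obtain ⟨L, hL⟩ : ∃ L : ℝ, L = ((b - a : ℤ) : ℝ) := ⟨_, rfl⟩
  have hLe : L = (⌊x + y⌋ : ℝ) - (⌊x⌋ : ℝ) := by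
    rw [hL, ha, hb]; push_cast; ring
  have f1 := Int.floor_le x
  have f2 := Int.lt_floor_add_one x
  have f3 := Int.floor_le (x + y)
  have f4 := Int.lt_floor_add_one (x + y)
  have hL1 : y / 2 ≤ L := by linarith
  have hL2 : L ≤ 2 * y := by linarith
  have hsize : ∀ t, 0 ≤ t → t ≤ Real.exp (η * l) →
      Real.exp (ε / 4 * l) ^ 2 * (1 + 2 * (t ^ (8 * g + 1)) ^ 6) ≤ ((b - a : ℤ) : ℝ) := by
    intro t ht0 ht
    rw [← hL]
    exact size_arith g ε η l y L t hlpos.le hε hη ht0 ht L3 hxy hL1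
  have hQs : ∀ n ∈ A, (((∏ j, Qs j).eval n).natAbs : ℝ) ≤ x ^ B' := by
    intro n hn
    obtain ⟨n1, n2⟩ := Finset.mem_Ico.1 (hA hn)
    have n3 : n ≤ ⌊x + y⌋ := by omega
    have n4 : (n:ℝ) ≤ x + y := Int.le_floor.1 n3
    have n5 : 0 ≤ ⌊x⌋ := Int.floor_nonneg.2 hx0.le
    rw [hB']
    refine Q_size _ g h.deg.le δ x hδ hx1 ?_ hN n (by omega) (by linarith)
    rw [hxl]; exact L2
  have hkk : ∀ n ∈ A, (∏ j, Qs j).eval n ≠ 0 → ∀ j, f j ((Qs j).eval n).natAbs = k j := by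
    intro n hn hn0 j
    have h1 := hk n hn j
    unfold extZ at h1
    rw [if_neg] at h1
    · exact h1
    · intro h2
      apply hn0
      rw [Polynomial.eval_prod]
      exact Finset.prod_eq_zero (Finset.mem_univ j) h2
  obtain ⟨P, hP⟩ : ∃ P, P = ∏ j, (1 / √(Ef (f j) x (fun p => (rho (Qs j) p : ℝ)))) := ⟨_, rfl⟩
  have hPlow : 1 / (40 * g * l) ^ r ≤ P := by
    rw [hP, hl]
    exact prod_low h f x hx3 (by rw [← hl]; linarith)
  have hG0 : 0 < (40 * g * l) ^ r := by positivity
  have hP0 : 0 ≤ P := le_trans (by positivity) hPlow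
  have hH : 1 ≤ Hd Qs D ^ K0 := Real.one_le_rpow h.Hd_ge hK0
  obtain ⟨H, hHe⟩ : ∃ H, H = Hd Qs D ^ K0 := ⟨_, rfl⟩
  obtain ⟨X, hX⟩ : ∃ X, X = Real.exp (η * l) := ⟨_, rfl⟩
  obtain ⟨Y, hY⟩ : ∃ Y, Y = Real.exp (ε / 4 * l) := ⟨_, rfl⟩
  obtain ⟨Z, hZ⟩ : ∃ Z : ℝ, Z = l ^ (1 - lam) := ⟨_, rfl⟩
  rw [← hZ] at L4 L5 L6 L7 hval
  obtain ⟨T, hT⟩ : ∃ T : ℕ → ℝ, ∀ i, T i = Real.exp (η * l / 2 ^ i) := ⟨_, fun _ => rfl⟩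
  have hX2 : 2 ≤ X := by
    rw [hX]
    linarith [Real.add_one_le_exp (η * l)]
  have hY1 : 1 < Y := by rw [hY]; linarith
  obtain ⟨Q, hQ⟩ : ∃ Q, Q = ∏ j, Qs j := ⟨_, rfl⟩
  rw [← hQ] at hQs hkk
  -- the four pieces
  obtain ⟨AZ, hAZ⟩ : ∃ AZ : Finset ℤ, AZ = (Finset.Ico a b).filter (Zp Q X Y) := ⟨_, rfl⟩
  obtain ⟨AM, hAM⟩ : ∃ AM : Finset ℤ, AM = A.filter (fun n => Q.eval n ≠ 0 ∧
    (Sm (Q.eval n).natAbs (⌊X⌋₊ + 1) : ℝ) ≤ Y ^ 2) := ⟨_, rfl⟩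
  obtain ⟨AI, hAI⟩ : ∃ AI : ℕ → Finset ℤ, ∀ i, AI i = A.filter (fun n => Q.eval n ≠ 0 ∧
    Z ≤ η * l / 2 ^ (i + 1) ∧
    ∃ q : ℕ, T (i + 1) < q ∧ (q:ℝ) ≤ T i ∧ Y ≤ Sm (Q.eval n).natAbs q ∧
      (Sm (Q.eval n).natAbs q : ℝ) ≤ Y ^ 2) := ⟨_, fun _ => rfl⟩
  obtain ⟨AF, hAF⟩ : ∃ AF : Finset ℤ, AF = A.filter (fun n => Q.eval n ≠ 0 ∧
    ∃ q : ℕ, 2 < q ∧ (q:ℝ) ≤ Real.exp (2 * Z) ∧ Y ≤ Sm (Q.eval n).natAbs q ∧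
      (Sm (Q.eval n).natAbs q : ℝ) ≤ Y ^ 2) := ⟨_, rfl⟩
  obtain ⟨N, hNdef⟩ : ∃ N : ℕ, N = ⌊η * l⌋₊ + 1 := ⟨_, rfl⟩
  have hcover : A ⊆ AZ ∪ AM ∪ (Finset.range N).biUnion AI ∪ AF := by
    intro n hn
    by_cases hz : Zp Q X Y n
    · have : n ∈ AZ := by rw [hAZ]; exact Finset.mem_filter.2 ⟨hA hn, hz⟩
      simp [this]
    obtain ⟨d1, d2⟩ := decomp Q X Y hX2 hY1 n hz
    rcases d2 with d2 | ⟨q, q1, q2, q3, q4⟩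
    · have : n ∈ AM := by rw [hAM]; exact Finset.mem_filter.2 ⟨hn, d1, d2⟩
      simp [this]
    by_cases hqz : (q:ℝ) ≤ Real.exp (2 * Z)
    · have : n ∈ AF := by rw [hAF]; exact Finset.mem_filter.2 ⟨hn, d1, q, q1, hqz, q3, q4⟩
      simp [this]
    push Not at hqz
    have hq1R : (1:ℝ) < q := by
      have : 1 < q := by omega
      exact_mod_cast this
    rw [hX] at q2
    obtain ⟨i, i1, i2⟩ := level_exists (η * l) q hq1R q2
    have i3 : 2 * Z < η * l / 2 ^ i := Real.exp_lt_exp.1 (hqz.trans_le i2)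
    have i4 : Z ≤ η * l / 2 ^ (i + 1) := by
      rw [pow_succ, ← div_div]
      linarith
    have i5 : i ∈ Finset.range N := by
      rw [Finset.mem_range, hNdef]
      apply Nat.lt_succ_of_le
      apply Nat.le_floor
      have i6 : (i:ℝ) ≤ 2 ^ i := by exact_mod_cast Nat.lt_two_pow_self.le
      have i7 : (1:ℝ) ≤ η * l / 2 ^ i := by linarith
      rw [le_div_iff₀ (by positivity)] at i7
      linarith
    have : n ∈ AI i := by
      rw [hAI, Finset.mem_filter]
      refine ⟨hn, d1, i4, q, ?_, ?_, q3, q4⟩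
      · rw [hT]; exact i1
      · rw [hT]; exact i2
    have : n ∈ (Finset.range N).biUnion AI := Finset.mem_biUnion.2 ⟨i, i5, this⟩
    simp only [Finset.mem_union]
    tauto
  have hcard : (A.card : ℝ) ≤ AZ.card + AM.card + ∑ i ∈ Finset.range N, ((AI i).card : ℝ) + AF.card := by
    have c1 := Finset.card_le_card hcover
    have c2 := Finset.card_union_le (AZ ∪ AM ∪ (Finset.range N).biUnion AI) AF
    have c3 := Finset.card_union_le (AZ ∪ AM) ((Finset.range N).biUnion AI)
    have c4 := Finset.card_union_le AZ AM
    have c5 : ((Finset.range N).biUnion AI).card ≤ ∑ i ∈ Finset.range N, (AI i).card :=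
      Finset.card_biUnion_le
    have : A.card ≤ AZ.card + AM.card + ∑ i ∈ Finset.range N, (AI i).card + AF.card := by omega
    exact_mod_cast this
  have bZ : (AZ.card : ℝ) ≤ 3 * g * y * P := by
    have z1 := Zcount h X Y (by linarith) hY1 a b hab
    rw [← hQ, ← hL] at z1
    rw [hAZ]
    refine z1.trans ?_
    rw [hX, hY]
    refine (zarith g hg ε η l y L hlpos.le hL2 hxy hηa hηb).trans ?_
    have : Real.exp (-(ε / (8 * g) * l)) ≤ P := by
      refine le_trans ?_ hPlow
      rw [Real.exp_neg, inv_eq_one_div]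
      exact one_div_le_one_div_of_le hG0 L8
    gcongr
  have hX_le : X ≤ x := by
    rw [hX, hxl]
    apply Real.exp_le_exp.2
    exact mul_le_of_le_one_left hlpos.le hη1
  have hZX : Real.exp Z ≤ X := by
    rw [hX]; exact Real.exp_le_exp.2 L7
  have hlogX : Real.log X = η * l := by rw [hX, Real.log_exp]
  have hHP : 0 ≤ H := by rw [hHe]; linarith
  have bM : (AM.card : ℝ) ≤ C * (2 * y) * Real.exp (κ1 / η) * H * P := by
    have m1 := hmain Qs D h X X x hX2 le_rfl (by nlinarith only [hX2]) hX_le (by rw [hlogX]; linarith) f hf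
      (fun j u hu => hval j X u hZX hu) k a b hab 1 one_pos (Y ^ 2)
      (by rw [hY]; exact hsize X (by linarith) hX.le) AM
      (by rw [hAM]; exact (Finset.filter_subset _ _).trans hA) (by
        intro n hn
        rw [hAM, Finset.mem_filter] at hn
        obtain ⟨n1, n2, n3⟩ := hn
        rw [← hQ]
        refine ⟨n2, hQs n n1, hkk n n1 n2, ⌊X⌋₊ + 1, ?_, ?_, ?_, n3⟩
        · push_cast; exact Nat.lt_floor_add_one X
        · push_cast
          have := Nat.floor_le (by linarith : 0 ≤ X)
          linarith
        · exact_mod_cast Sm_pos _ _)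
    rw [Real.one_rpow, mul_one, ← hL, ← hκ1, ← hHe, ← hP, ← hl, hlogX] at m1
    refine m1.trans ?_
    have e : κ1 * (l / (η * l)) = κ1 / η := by field_simp
    rw [e]
    gcongr
  have bI : ∀ i ∈ Finset.range N, ((AI i).card : ℝ) ≤ C * (2 * y) * H * P * Real.exp (-(2 ^ i / η)) := by
    intro i _
    by_cases hi : Z ≤ η * l / 2 ^ (i + 1)
    · have hTT : T i = T (i + 1) ^ 2 := by
        rw [hT, hT, ← Real.exp_nat_mul]
        congr 1
        rw [pow_succ]
        push_cast
        field_simp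
      have hZT : Real.exp Z ≤ T (i + 1) := by rw [hT]; exact Real.exp_le_exp.2 hi
      have hT2 : 2 ≤ T (i + 1) := by linarith [Real.add_one_le_exp Z]
      have hTle : T (i + 1) ≤ T i := by rw [hTT]; nlinarith only [hT2]
      have hTX : T i ≤ X := by
        rw [hT, hX]
        apply Real.exp_le_exp.2
        apply div_le_self (by positivity)
        exact one_le_pow₀ (by norm_num)
      have hlogT : Real.log (T i) = η * l / 2 ^ i := by rw [hT, Real.log_exp]
      have hlogT' : Z ≤ η * l / 2 ^ i := by
        rw [← hlogT, Real.le_log_iff_exp_le (by linarith)]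
        linarith
      have m1 := hmain Qs D h (T (i + 1)) (T i) x hT2 hTle hTT.le (hTX.trans hX_le)
        (by rw [hlogT]; linarith) f hf (fun j u hu => hval j _ u hZT hu) k a b hab Y (by linarith) (Y ^ 2)
        (by rw [hY]; exact hsize _ (by linarith) (by rw [← hX]; linarith)) (AI i)
        (by rw [hAI]; exact (Finset.filter_subset _ _).trans hA) (by
          intro n hn
          rw [hAI, Finset.mem_filter] at hn
          obtain ⟨n1, n2, -, q, q1, q2, q3, q4⟩ := hn
          rw [← hQ]
          exact ⟨n2, hQs n n1, hkk n n1 n2, q, q1, by linarith, q3, q4⟩)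
      rw [← hL, ← hκ1, ← hHe, ← hP, ← hl, hlogT] at m1
      refine m1.trans ?_
      have e : Y ^ (-(κ / (η * l / 2 ^ i))) * Real.exp (κ1 * (l / (η * l / 2 ^ i))) =
          Real.exp (-(2 ^ i / η)) := by
        rw [hY, ← Real.exp_mul, ← Real.exp_add]
        congr 1
        rw [hκ]
        field_simp
        ring
      calc _ = C * L * H * P * (Y ^ (-(κ / (η * l / 2 ^ i))) *
            Real.exp (κ1 * (l / (η * l / 2 ^ i)))) := by ring
        _ = C * L * H * P * Real.exp (-(2 ^ i / η)) := by rw [e]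
        _ ≤ _ := by gcongr
    · have : AI i = ∅ := by
        rw [hAI]
        apply Finset.filter_eq_empty_iff.2
        intro n _ hn
        exact hi hn.2.1
      rw [this, Finset.card_empty]
      push_cast
      positivity
  have bI' : ∑ i ∈ Finset.range N, ((AI i).card : ℝ) ≤ C * (2 * y) * H * P := by
    refine (Finset.sum_le_sum bI).trans ?_
    rw [← Finset.mul_sum]
    have := geo_sum η hη0 hη1 N
    have h0 : 0 ≤ C * (2 * y) * H * P := by positivity
    exact mul_le_of_le_one_right h0 this
  have bF : (AF.card : ℝ) ≤ 8 * y * P := by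
    have hT3 : 3 ≤ Real.exp (2 * Z) := by linarith [Real.add_one_le_exp (2 * Z)]
    have m1 := level_crude h (T := Real.exp (2 * Z)) (by linarith) a b hab Y (by linarith)
      (by rw [Real.log_exp]; linarith) (x ^ B') (Y ^ 2)
      (by rw [hY]; exact hsize 2 (by norm_num) (by rw [← hX]; exact hX2)) AF
      (by rw [hAF]; exact (Finset.filter_subset _ _).trans hA) (by
        intro n hn
        rw [hAF, Finset.mem_filter] at hn
        obtain ⟨n1, n2, q, q1, q2, q3, q4⟩ := hn
        rw [← hQ]
        exact ⟨n2, hQs n n1, q, q1, by linarith, q3, q4⟩)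
    rw [Real.log_exp, ← hL, ← hc, hZ, hY] at m1
    refine m1.trans ?_
    refine farith ε lam l y L c _ P hlpos (by linarith) hL2 hc0 ?_ _ hG0 hPlow L9
    have := recip_sum (Real.exp (2 * Z)) hT3
    rw [Real.log_exp, hZ] at this
    exact this
  rw [← hHe, ← hP]
  have hH1 : 1 ≤ H := by rw [hHe]; exact hH
  have hyP : 0 ≤ y * P := by positivity
  have hfin : (3 * g + 8) * (y * P) ≤ (3 * g + 8) * (y * P) * H := by
    apply le_mul_of_one_le_right _ hH1
    positivity
  calc (A.card : ℝ) ≤ _ := hcard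
    _ ≤ 3 * g * y * P + C * (2 * y) * Real.exp (κ1 / η) * H * P + C * (2 * y) * H * P + 8 * y * P := by
        linarith
    _ = (3 * g + 8) * (y * P) + (2 * C * (Real.exp (κ1 / η) + 1)) * y * H * P := by ring
    _ ≤ (3 * g + 8) * (y * P) * H + (2 * C * (Real.exp (κ1 / η) + 1)) * y * H * P := by linarith
    _ = _ := by ring

lemma phi_ratio {r g : ℕ} {Qs : Fin r → Polynomial ℤ} {D : ℤ} (h : Setup g Qs D) :
    Hd Qs D ≤ ((((∏ j, Qs j).leadingCoeff * D).natAbs : ℝ) /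
              phiRho (fun p => (rho (∏ j, Qs j) p : ℝ)) ((∏ j, Qs j).leadingCoeff * D).natAbs) := by
  have hQ0 : (∏ j, Qs j) ≠ 0 := by
    intro h0
    have h1 := h.deg
    rw [h0, Polynomial.natDegree_zero] at h1
    have := h.hg
    omega
  have hne : ((∏ j, Qs j).leadingCoeff * D).natAbs ≠ 0 :=
    Int.natAbs_ne_zero.2 (mul_ne_zero (Polynomial.leadingCoeff_ne_zero.2 hQ0) h.D0)
  have hsub : D.natAbs.primeFactors ⊆ ((∏ j, Qs j).leadingCoeff * D).natAbs.primeFactors := by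
    apply Nat.primeFactors_mono _ hne
    rw [Int.natAbs_mul]
    exact dvd_mul_left _ _
  set m := ((∏ j, Qs j).leadingCoeff * D).natAbs with hm
  have hmR : (m:ℝ) ≠ 0 := by exact_mod_cast hne
  have e : (m:ℝ) / phiRho (fun p => (rho (∏ j, Qs j) p : ℝ)) m = ∏ p ∈ m.primeFactors, hq Qs p := by
    unfold phiRho hq rq
    rw [Finset.prod_inv_distrib, div_mul_eq_div_div, div_self hmR, one_div]
  rw [e]
  unfold Hd
  have hge : ∀ p ∈ m.primeFactors, 1 ≤ hq Qs p := fun p hp => h.hq_ge (Nat.prime_of_mem_primeFactors hp)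
  rw [← Finset.prod_sdiff hsub]
  have h1 : 1 ≤ ∏ p ∈ m.primeFactors \ D.natAbs.primeFactors, hq Qs p :=
    Finset.prod_induction _ (fun y : ℝ => 1 ≤ y) (fun a b ha hb => one_le_mul_of_one_le_of_one_le ha hb) le_rfl
      (fun p hp => hge p (Finset.mem_sdiff.1 hp).1)
  have h2 : 0 ≤ ∏ p ∈ D.natAbs.primeFactors, hq Qs p :=
    Finset.prod_nonneg fun p hp => zero_le_one.trans (hge p (hsub hp))
  exact le_mul_of_one_le_left h2 h1

/-- Theorem 1 of the paper: simultaneous concentration of additive functions along polynomial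
shifts. Fix `r, g, 𝔙 ≥ 1` and `0 < ε, δ, λ < 1`. There exist constants `K, c₀, c₁, c₂ > 0`
(depending only on these parameters) such that the stated uniform upper bound holds, with
`z := exp((log x)^{1−λ})`, `M := ∑ M_j`, `M' := ∑ M'_j`. -/
theorem statement3 (r g V : ℕ) (ε δ lam : ℝ)
    (hr : 1 ≤ r) (hg : 1 ≤ g) (hV : 1 ≤ V)
    (hε : 0 < ε) (hε1 : ε < 1) (hδ : 0 < δ) (hδ1 : δ < 1)
    (hlam : 0 < lam) (hlam1 : lam < 1) :
    ∃ K c₀ c₁ c₂ : ℝ, 0 < K ∧ 0 < c₀ ∧ 0 < c₁ ∧ 0 < c₂ ∧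
      ∀ (Qs : Fin r → Polynomial ℤ) (D : ℤ) (Mj Mj' : Fin r → ℝ)
        (x y : ℝ) (f : Fin r → ℕ → ℝ) (k : Fin r → ℝ),
        -- the `Q_j` are irreducible and pairwise coprime
        (∀ j, Irreducible (Qs j)) →
        (∀ i j, i ≠ j → IsRelPrime (Qs i) (Qs j)) →
        -- `Q := ∏ Q_j` has degree `g` and no fixed prime divisor
        (∏ j, Qs j).natDegree = g →
        (∀ p : ℕ, p.Prime → rho (∏ j, Qs j) p < p) →
        -- `D ≠ 0` is divisible by every prime modulo which `Q` has a repeated root or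
        -- modulo which two of the `Q_j` share a common root
        D ≠ 0 →
        (∀ p : ℕ, p.Prime →
          ((∃ n : ℤ, (p : ℤ) ∣ (∏ j, Qs j).eval n ∧
              (p : ℤ) ∣ (Polynomial.derivative (∏ j, Qs j)).eval n) ∨
           (∃ i j : Fin r, i ≠ j ∧ ∃ n : ℤ,
              (p : ℤ) ∣ (Qs i).eval n ∧ (p : ℤ) ∣ (Qs j).eval n)) →
          (p : ℤ) ∣ D) →
        -- the constants `M_j, M'_j ≥ 1`
        (∀ j, 1 ≤ Mj j) → (∀ j, 1 ≤ Mj' j) →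
        (∀ j, ∀ t : ℝ, 2 ≤ t →
          |(∑ p ∈ primesBelow t, (rho (Qs j) p : ℝ) / p) - Real.log (Real.log t)| ≤ Mj j) →
        (∀ j, ∀ t : ℝ, 2 ≤ t →
          |(∑ p ∈ primesBelow t, (rho (Qs j) p : ℝ)) - Li t| ≤
            Mj' j + t * Real.exp (-(c₁ * Real.sqrt (Real.log t)))) →
        -- ranges of `x` and `y`
        c₀ * polyNorm (∏ j, Qs j) ^ δ ≤ x → x ^ ε < y → y ≤ x →
        -- the `f_j` are additive
        (∀ j, ∀ m n : ℕ, Nat.Coprime m n → f j (m * n) = f j m + f j n) →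
        -- condition (⁎): `#{f_j(n) : n ≤ t^u, P⁻(n) > t} ≤ 𝔙^u` for `t ≥ z`, `u ≥ 1`
        (∀ j, ∀ t u : ℝ, Real.exp ((Real.log x) ^ (1 - lam)) ≤ t → 1 ≤ u →
          (({v : ℝ | ∃ n : ℕ, 0 < n ∧ (n : ℝ) ≤ t ^ u ∧
              (∀ p : ℕ, p.Prime → p ∣ n → t < (p : ℝ)) ∧ f j n = v}).ncard : ℝ) ≤
            (V : ℝ) ^ u) →
        -- conclusion
        (({n : ℤ | x < (n : ℝ) ∧ (n : ℝ) ≤ x + y ∧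
            ∀ j, extZ (f j) ((Qs j).eval n) = k j}).ncard : ℝ) ≤
          c₂ * ((((∏ j, Qs j).leadingCoeff * D).natAbs : ℝ) /
              phiRho (fun p => (rho (∏ j, Qs j) p : ℝ))
                ((∏ j, Qs j).leadingCoeff * D).natAbs) ^ K *
            Real.exp (3 * (∑ j, Mj j) +
              (∑ j, Mj' j) / Real.exp ((Real.log x) ^ (1 - lam))) * y /
            ∏ j, Real.sqrt (Ef (f j) x (fun p => (rho (Qs j) p : ℝ))) := by
  obtain ⟨C, K0, X0, hC, hK0, hX0, hmain⟩ := main_count r g V ε δ lam hg hV hε hε1 hδ hlam hlam1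
  refine ⟨K0 + 1, X0, 1, C, by linarith, by linarith, one_pos, hC, ?_⟩
  intro Qs D Mj Mj' x y f k hirr hcop hdeg hnofix hD0 hD hM hM' _ _ hx hxy hyx hf hval
  have hS : Setup g Qs D := by
    refine ⟨hg, hdeg, hnofix, hD0, ?_, ?_⟩
    · intro p hp hpD n h1 h2
      exact hpD (hD p hp (Or.inl ⟨n, h1, h2⟩))
    · intro p hp hpD i j hij n h1
      exact hpD (hD p hp (Or.inr ⟨i, j, hij, n, h1⟩))
  have hQ0 : (∏ j, Qs j) ≠ 0 := by
    intro h0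
    rw [h0, Polynomial.natDegree_zero] at hdeg
    omega
  have hN1 : 1 ≤ polyNorm (∏ j, Qs j) ^ δ := Real.one_le_rpow (polyNorm_ge _ hQ0) hδ.le
  have hxX0 : X0 ≤ x := by nlinarith
  have hxN : polyNorm (∏ j, Qs j) ^ δ ≤ x := by nlinarith
  have hxpos : 0 < x := by linarith
  have hy : 0 < y := (Real.rpow_pos_of_pos hxpos ε).trans hxy
  obtain ⟨A, hA⟩ : ∃ A : Finset ℤ, A = (Finset.Ico (⌊x⌋ + 1) (⌊x + y⌋ + 1)).filter
      (fun n : ℤ => ∀ j, extZ (f j) ((Qs j).eval n) = k j) := ⟨_, rfl⟩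
  have hset : {n : ℤ | x < (n : ℝ) ∧ (n : ℝ) ≤ x + y ∧
      ∀ j, extZ (f j) ((Qs j).eval n) = k j} = ↑A := by
    ext n
    rw [hA]
    simp only [Set.mem_ofPred_eq, Finset.coe_filter, Finset.mem_Ico, Int.lt_add_one_iff,
      Int.add_one_le_iff, Int.floor_lt, Int.le_floor]
    tauto
  rw [hset, Set.ncard_coe_finset]
  have h1 := hmain Qs D hS x y f k hxX0 hxN hxy hyx hf hval A
    (by rw [hA]; exact Finset.filter_subset _ _)
    (by intro n hn; rw [hA] at hn; exact (Finset.mem_filter.1 hn).2)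
  refine h1.trans ?_
  have hR := phi_ratio hS
  have hH := hS.Hd_ge
  obtain ⟨R, hRe⟩ : ∃ R : ℝ, R = ((((∏ j, Qs j).leadingCoeff * D).natAbs : ℝ) /
      phiRho (fun p => (rho (∏ j, Qs j) p : ℝ)) ((∏ j, Qs j).leadingCoeff * D).natAbs) := ⟨_, rfl⟩
  rw [← hRe] at hR ⊢
  have hRK : Hd Qs D ^ K0 ≤ R ^ (K0 + 1) := by
    calc Hd Qs D ^ K0 ≤ R ^ K0 := Real.rpow_le_rpow (by linarith) hR hK0
      _ ≤ R ^ (K0 + 1) := Real.rpow_le_rpow_of_exponent_le (by linarith) (by linarith)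
  have hE : 1 ≤ Real.exp (3 * (∑ j, Mj j) +
      (∑ j, Mj' j) / Real.exp ((Real.log x) ^ (1 - lam))) := by
    apply Real.one_le_exp
    have e1 : 0 ≤ ∑ j, Mj j := Finset.sum_nonneg fun j _ => zero_le_one.trans (hM j)
    have e2 : 0 ≤ ∑ j, Mj' j := Finset.sum_nonneg fun j _ => zero_le_one.trans (hM' j)
    positivity
  obtain ⟨E, hEe⟩ : ∃ E : ℝ, E = Real.exp (3 * (∑ j, Mj j) +
      (∑ j, Mj' j) / Real.exp ((Real.log x) ^ (1 - lam))) := ⟨_, rfl⟩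
  rw [← hEe] at hE ⊢
  rw [Finset.prod_div_distrib, Finset.prod_const_one, mul_one_div]
  apply div_le_div_of_nonneg_right _ (Finset.prod_nonneg fun _ _ => Real.sqrt_nonneg _)
  have hRp : 0 ≤ R ^ (K0 + 1) := Real.rpow_nonneg (by linarith) _
  calc C * y * Hd Qs D ^ K0 ≤ C * y * R ^ (K0 + 1) :=
        mul_le_mul_of_nonneg_left hRK (by positivity)
    _ ≤ C * y * R ^ (K0 + 1) * E := le_mul_of_one_le_right (by positivity) hE
    _ = C * R ^ (K0 + 1) * E * y := by ring
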